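/- For every integer n ≥ 2 and every integer i with 0 ≤ i ≤ n−2, the real number I_{n,i} = ∫₀¹ s^i / √(1 − s^{2n}) ds is transcendental over ℚ. In particular, the length 2n·2^{1/n}·I_{n,0} of the Erdős lemniscate with n leaves is transcendental. -/

import Mathlib

namespace ErdosLemniscate

/-! ### No rational function solves the differential equation of the Abelian integrals -/

section CoprimeSolutions

open Polynomial

theorem polynomial_ode_coprime {n i : ℕ} (hn : 2 ≤ n) (hi : i ≤ n - 2) {k : ℂ} (hk : k ≠ 0)
    {α b : ℂ[X]} (hα : α ≠ 0) (hcop : IsCoprime α b)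
    (h : (1 - X ^ (2 * n)) * (α * derivative b - derivative α * b)
      + C (n : ℂ) * X ^ (2 * n - 1) * α * b = C k * X ^ i * (1 - X ^ (2 * n)) * α ^ 2) :
    False := by
  have hn0 : (n : ℂ) ≠ 0 := by exact_mod_cast (by omega : n ≠ 0)
  have hds : derivative (1 - X ^ (2 * n) : ℂ[X]) = - (C (2 * n : ℂ) * X ^ (2 * n - 1)) := by
    simp [derivative_X_pow]
  -- the denominator has no roots
  have hroot : ∀ β, ¬ α.IsRoot β := by
    intro β hβ
    obtain ⟨α₁, hα₁, hnd⟩ := exists_eq_pow_rootMultiplicity_mul_and_not_dvd α hα β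
    obtain ⟨m, hm⟩ : ∃ m, α.rootMultiplicity β = m + 1 :=
      ⟨α.rootMultiplicity β - 1, by have := (rootMultiplicity_pos hα).2 hβ; omega⟩
    rw [hm] at hα₁
    have h1 : α₁.eval β ≠ 0 := fun h0 => hnd (dvd_iff_isRoot.2 h0)
    have hb : b.eval β ≠ 0 := by
      obtain ⟨u, v, huv⟩ := hcop
      intro h0
      have := congrArg (eval β) huv
      simp [h0, hβ.eq_zero] at this
    have key : (1 - X ^ (2 * n)) * ((X - C β) * (α₁ * derivative b - derivative α₁ * b)
        - C (m + 1 : ℂ) * α₁ * b)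
        + C (n : ℂ) * X ^ (2 * n - 1) * ((X - C β) * α₁ * b)
        = C k * X ^ i * (1 - X ^ (2 * n)) * ((X - C β) ^ (m + 2) * α₁ ^ 2) := by
      have hx : (X - C β : ℂ[X]) ^ m ≠ 0 := pow_ne_zero _ (X_sub_C_ne_zero β)
      apply mul_left_cancel₀ hx
      rw [hα₁] at h
      simp only [derivative_mul, derivative_pow, derivative_sub, derivative_X, derivative_C,
        Nat.add_sub_cancel] at h
      push_cast at h ⊢
      simp only [map_add, map_natCast, map_one] at h ⊢
      linear_combination h
    have hs0 : (1 - X ^ (2 * n) : ℂ[X]).eval β = 0 := by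
      have := congrArg (eval β) key
      simp only [eval_add, eval_mul, eval_sub, eval_X, eval_C, sub_self, zero_mul, mul_zero,
        zero_sub, eval_pow, zero_pow (by omega : m + 2 ≠ 0), add_zero] at this
      have hm1 : (m + 1 : ℂ) ≠ 0 := by exact_mod_cast Nat.succ_ne_zero m
      simpa [hb, h1, hm1] using this
    obtain ⟨s₁, hs₁⟩ := dvd_iff_isRoot.2 hs0
    have hs1 : s₁.eval β = - (2 * n * β ^ (2 * n - 1)) := by
      have := congrArg (eval β) hds
      rw [hs₁] at this
      simpa [derivative_mul] using this
    have key2 : s₁ * ((X - C β) * (α₁ * derivative b - derivative α₁ * b)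
        - C (m + 1 : ℂ) * α₁ * b)
        + C (n : ℂ) * X ^ (2 * n - 1) * (α₁ * b)
        = C k * X ^ i * s₁ * ((X - C β) ^ (m + 2) * α₁ ^ 2) := by
      apply mul_left_cancel₀ (X_sub_C_ne_zero β)
      rw [hs₁] at key
      linear_combination key
    have h3 := congrArg (eval β) key2
    simp only [eval_add, eval_mul, eval_sub, eval_X, eval_C, sub_self, zero_mul, mul_zero,
        zero_sub, eval_pow, zero_pow (by omega : m + 2 ≠ 0), hs1] at h3
    have hβ0 : β ≠ 0 := by
      rintro rfl
      simp [show n ≠ 0 by omega] at hs0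
    have h4 : (n : ℂ) * β ^ (2 * n - 1) * (α₁.eval β * b.eval β) * ((2 * m + 3 : ℕ) : ℂ) = 0 := by
      push_cast
      linear_combination h3
    have h5 : ((2 * m + 3 : ℕ) : ℂ) ≠ 0 := by exact_mod_cast (by omega : 2 * m + 3 ≠ 0)
    simp [hn0, hβ0, h1, hb] at h4
    norm_cast at h4
  obtain ⟨a, ha⟩ : ∃ a, α = C a := by
    by_cases hd : α.degree = 0
    · exact ⟨_, eq_C_of_degree_eq_zero hd⟩
    · obtain ⟨β, hβ⟩ := IsAlgClosed.exists_root α hd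
      exact (hroot β hβ).elim
  have ha0 : a ≠ 0 := by rintro rfl; simp [ha] at hα
  have hCa : (C a : ℂ[X]) ≠ 0 := by simpa using ha0
  have e1 : (1 - X ^ (2 * n)) * derivative b + C (n : ℂ) * X ^ (2 * n - 1) * b
      = C (k * a) * X ^ i * (1 - X ^ (2 * n)) := by
    apply mul_left_cancel₀ hCa
    rw [ha] at h
    simp only [derivative_C, zero_mul, sub_zero, map_mul] at h ⊢
    linear_combination h
  have hcop2 : IsCoprime (1 - X ^ (2 * n) : ℂ[X]) (C (n : ℂ) * X ^ (2 * n - 1)) := by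
    refine ⟨1, C ((n : ℂ)⁻¹) * X, ?_⟩
    have : (C ((n : ℂ)⁻¹) : ℂ[X]) * C (n : ℂ) = 1 := by rw [← C_mul]; simp [hn0]
    have h2 : (X : ℂ[X]) * X ^ (2 * n - 1) = X ^ (2 * n) := by
      rw [← pow_succ']; congr 1; omega
    linear_combination (X * X ^ (2 * n - 1)) * this + h2
  obtain ⟨b₁, hb₁⟩ : (1 - X ^ (2 * n) : ℂ[X]) ∣ b := by
    apply hcop2.dvd_of_dvd_mul_left
    exact ⟨C (k * a) * X ^ i - derivative b, by linear_combination e1⟩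
  have hsne : (1 - X ^ (2 * n) : ℂ[X]) ≠ 0 := by
    intro h0
    have := congrArg (eval 0) h0
    simp [show n ≠ 0 by omega] at this
  have e2 : (1 - X ^ (2 * n)) * derivative b₁ - C (n : ℂ) * X ^ (2 * n - 1) * b₁
      = C (k * a) * X ^ i := by
    apply mul_left_cancel₀ hsne
    rw [hb₁, derivative_mul, hds] at e1
    have : (C (2 * n : ℂ) : ℂ[X]) = 2 * C (n : ℂ) := by rw [C_mul, map_ofNat]
    rw [this] at e1
    linear_combination e1
  have hb1 : b₁ ≠ 0 := by
    rintro rfl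
    simp [hk, ha0] at e2
  have h7 := congrArg (fun p => coeff p (b₁.natDegree + (2 * n - 1))) e2
  simp only [coeff_sub, coeff_C_mul, sub_mul, one_mul, mul_assoc, coeff_X_pow_mul, coeff_X_pow] at h7
  rw [if_neg (by omega)] at h7
  have h8 : (derivative b₁).coeff (b₁.natDegree + (2 * n - 1)) = 0 := by
    rw [coeff_derivative, coeff_eq_zero_of_natDegree_lt (by omega), zero_mul]
  have h9 : (X ^ (2 * n) * derivative b₁).coeff (b₁.natDegree + (2 * n - 1))
      = b₁.natDegree * b₁.leadingCoeff := by
    rw [coeff_X_pow_mul']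
    rcases Nat.eq_zero_or_pos b₁.natDegree with h0 | h0
    · rw [if_neg (by omega), h0]; simp
    · rw [if_pos (by omega), coeff_derivative, leadingCoeff,
        show b₁.natDegree + (2 * n - 1) - 2 * n + 1 = b₁.natDegree by omega, mul_comm]
      congr 1
      have : b₁.natDegree + (2 * n - 1) - 2 * n = b₁.natDegree - 1 := by omega
      rw [this]
      rw [Nat.cast_sub h0]; simp
  rw [h8, h9] at h7
  have h10 : ((b₁.natDegree + n : ℕ) : ℂ) * b₁.leadingCoeff = 0 := by
    push_cast
    rw [leadingCoeff] at *
    linear_combination -h7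
  have h11 : ((b₁.natDegree + n : ℕ) : ℂ) ≠ 0 := by exact_mod_cast (by omega)
  exact (mul_ne_zero h11 (leadingCoeff_ne_zero.2 hb1)) h10

/-- The first order equation satisfied by `√(1-x^{2n}) ∫₀ˣ s^i/√(1-s^{2n}) ds` has no rational
solution. -/
theorem polynomial_ode {n i : ℕ} (hn : 2 ≤ n) (hi : i ≤ n - 2) {k : ℂ} (hk : k ≠ 0)
    {α b : ℂ[X]} (hα : α ≠ 0)
    (h : (1 - X ^ (2 * n)) * (α * derivative b - derivative α * b)
      + C (n : ℂ) * X ^ (2 * n - 1) * α * b = C k * X ^ i * (1 - X ^ (2 * n)) * α ^ 2) :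
    False := by
  obtain ⟨g, α₁, b₁, hg, h1, h2, hc⟩ : ∃ g α₁ b₁ : ℂ[X], g ≠ 0 ∧ α = g * α₁ ∧ b = g * b₁ ∧
      IsCoprime α₁ b₁ := by
    have hg : EuclideanDomain.gcd α b ≠ 0 := fun h0 => hα (EuclideanDomain.gcd_eq_zero_iff.1 h0).1
    have hb := EuclideanDomain.gcd_eq_gcd_ab α b
    obtain ⟨u, hu⟩ := EuclideanDomain.gcd_dvd_left α b
    obtain ⟨v, hv⟩ := EuclideanDomain.gcd_dvd_right α b
    refine ⟨_, u, v, hg, hu, hv, EuclideanDomain.gcdA α b, EuclideanDomain.gcdB α b, ?_⟩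
    generalize EuclideanDomain.gcd α b = g at *
    generalize EuclideanDomain.gcdA α b = x at *
    generalize EuclideanDomain.gcdB α b = y at *
    apply mul_left_cancel₀ hg
    rw [hu, hv] at hb
    linear_combination -hb
  subst h1 h2
  refine polynomial_ode_coprime hn hi hk (right_ne_zero_of_mul hα) hc ?_
  apply mul_left_cancel₀ (pow_ne_zero 2 hg)
  simp only [derivative_mul] at h
  linear_combination h

end CoprimeSolutions

/-! ### Elimination between an auxiliary polynomial and its derivatives -/

section Elimination

open Polynomial

/-- The action of `(1 - x^{2n}) d/dx` on `∑ₖ fₖ(x) wᵏ`, where `w` is `q` times a solution of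
`(1 - x^{2n}) w' = -n x^{2n-1} w + x^i (1 - x^{2n})`, in terms of the coefficients `fₖ`. -/
noncomputable def coeffDeriv (n i : ℕ) (q : ℂ) (f : ℕ → ℂ[X]) (k : ℕ) : ℂ[X] :=
  (1 - X ^ (2 * n)) * derivative (f k) + C ((k + 1) * q) * X ^ i * (1 - X ^ (2 * n)) * f (k + 1)
    - C (k * n : ℂ) * X ^ (2 * n - 1) * f k

variable {n i : ℕ} {q : ℂ}

theorem coeffDeriv_add (f g : ℕ → ℂ[X]) :
    coeffDeriv n i q (f + g) = coeffDeriv n i q f + coeffDeriv n i q g := by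
  ext1 k
  simp only [coeffDeriv, Pi.add_apply, derivative_add]
  ring

theorem coeffDeriv_smul (c : ℂ[X]) (f : ℕ → ℂ[X]) :
    coeffDeriv n i q (c • f)
      = ((1 - X ^ (2 * n)) * derivative c) • f + c • coeffDeriv n i q f := by
  ext1 k
  simp only [coeffDeriv, Pi.add_apply, Pi.smul_apply, smul_eq_mul, derivative_mul]
  ring

/-- The span of the first `k + 1` iterated derivatives. -/
noncomputable def derivSpan (n i : ℕ) (q : ℂ) (f : ℕ → ℂ[X]) (k : ℕ) :
    Submodule ℂ[X] (ℕ → ℂ[X]) :=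
  Submodule.span ℂ[X] ((fun a => (coeffDeriv n i q)^[a] f) '' Set.Iic k)

theorem derivSpan_mono (f : ℕ → ℂ[X]) {k l : ℕ} (h : k ≤ l) :
    derivSpan n i q f k ≤ derivSpan n i q f l :=
  Submodule.span_mono (Set.image_mono (Set.Iic_subset_Iic.2 h))

theorem coeffDeriv_mem_derivSpan {f g : ℕ → ℂ[X]} {k : ℕ} (hg : g ∈ derivSpan n i q f k) :
    coeffDeriv n i q g ∈ derivSpan n i q f (k + 1) := by
  induction hg using Submodule.span_induction with
  | mem x hx =>
    obtain ⟨a, ha, rfl⟩ := hx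
    refine Submodule.subset_span ⟨a + 1, ?_, Function.iterate_succ_apply' _ _ _⟩
    simpa using ha
  | zero =>
    have : coeffDeriv n i q 0 = 0 := by ext1 k; simp [coeffDeriv]
    rw [this]; exact zero_mem _
  | add x y _ _ hx hy => rw [coeffDeriv_add]; exact add_mem hx hy
  | smul c x hx' hx =>
    rw [coeffDeriv_smul]
    exact add_mem (Submodule.smul_mem _ _ (derivSpan_mono f (Nat.le_succ k) hx'))
      (Submodule.smul_mem _ _ hx)

theorem exists_mem_derivSpan_degree (hn : 2 ≤ n) (hi : i ≤ n - 2) (hq : q ≠ 0)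
    {f : ℕ → ℂ[X]} {l : ℕ} (hl : f l ≠ 0) (hf : ∀ k, l < k → f k = 0) (k : ℕ) (hk : k ≤ l) :
    ∃ g ∈ derivSpan n i q f k, g (l - k) ≠ 0 ∧ ∀ j, l - k < j → g j = 0 := by
  induction k with
  | zero => exact ⟨f, Submodule.subset_span ⟨0, by simp, rfl⟩, by simpa using hl, by simpa using hf⟩
  | succ k ih =>
    obtain ⟨g, hg, hg0, hgj⟩ := ih (by omega)
    obtain ⟨e, he⟩ : ∃ e, l - k = e + 1 := ⟨l - (k + 1), by omega⟩
    have he' : l - (k + 1) = e := by omega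
    rw [he] at hg0 hgj
    rw [he']
    set β : ℂ[X] := (1 - X ^ (2 * n)) * derivative (g (e + 1))
      - C ((e + 1 : ℂ) * n) * X ^ (2 * n - 1) * g (e + 1) with hβ
    refine ⟨g (e + 1) • coeffDeriv n i q g - β • g, sub_mem (Submodule.smul_mem _ _
      (coeffDeriv_mem_derivSpan hg)) (Submodule.smul_mem _ _ (derivSpan_mono f k.le_succ hg)),
      ?_, ?_⟩
    · intro h0
      have hek : -((e + 1 : ℂ) * q) ≠ 0 :=
        neg_ne_zero.2 (mul_ne_zero (by exact_mod_cast e.succ_ne_zero) hq)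
      refine polynomial_ode hn hi hek (α := g (e + 1)) (b := g e) hg0 ?_
      simp only [Pi.sub_apply, Pi.smul_apply, smul_eq_mul, coeffDeriv, hβ, C_mul, C_add, C_neg,
        C_1] at h0 ⊢
      linear_combination h0
    · intro j hj
      rcases Nat.lt_or_ge (e + 1) j with h | h
      · simp [coeffDeriv, hgj j h, hgj (j + 1) (by omega)]
      · obtain rfl : j = e + 1 := by omega
        simp only [Pi.sub_apply, Pi.smul_apply, smul_eq_mul, coeffDeriv, hβ,
          hgj (e + 1 + 1) (by omega)]
        push_cast
        ring

theorem natDegree_coeffDeriv_iterate_le (hi : i ≤ n) {f : ℕ → ℂ[X]} {d : ℕ}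
    (hf : ∀ k, (f k).natDegree ≤ d) (a k : ℕ) :
    ((coeffDeriv n i q)^[a] f k).natDegree ≤ d + 3 * n * a := by
  induction a generalizing k with
  | zero => simpa using hf k
  | succ a ih =>
    rw [Function.iterate_succ_apply']
    set g := (coeffDeriv n i q)^[a] f
    have hs : (1 - X ^ (2 * n) : ℂ[X]).natDegree ≤ 2 * n := by compute_degree
    have h3 : d + 3 * n * (a + 1) = d + 3 * n * a + 3 * n := by ring
    have h1 : ((1 - X ^ (2 * n)) * derivative (g k)).natDegree ≤ d + 3 * n * (a + 1) := by
      refine natDegree_mul_le.trans ?_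
      have := natDegree_derivative_le (g k)
      have := ih k
      omega
    have h2 : (C ((k + 1) * q) * X ^ i * (1 - X ^ (2 * n)) * g (k + 1)).natDegree
        ≤ d + 3 * n * (a + 1) := by
      refine natDegree_mul_le.trans ?_
      have := ih (k + 1)
      have h4 : (C ((k + 1) * q) * X ^ i * (1 - X ^ (2 * n)) : ℂ[X]).natDegree ≤ i + 2 * n :=
        natDegree_mul_le.trans (add_le_add (natDegree_C_mul_X_pow_le _ _) hs)
      omega
    have h5 : (C (k * n : ℂ) * X ^ (2 * n - 1) * g k).natDegree ≤ d + 3 * n * (a + 1) := by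
      refine natDegree_mul_le.trans ?_
      have := ih k
      have h4 := natDegree_C_mul_X_pow_le (k * n : ℂ) (2 * n - 1)
      omega
    exact (natDegree_sub_le _ _).trans (max_le ((natDegree_add_le _ _).trans (max_le h1 h2)) h5)

/-- Eliminating the powers of `w` between the first derivatives of `∑ₖ fₖ wᵏ`. -/
theorem exists_elimination (hn : 2 ≤ n) (hi : i ≤ n - 2) (hq : q ≠ 0)
    {f : ℕ → ℂ[X]} {l d : ℕ} (hl : f l ≠ 0) (hf : ∀ k, l < k → f k = 0)
    (hd : ∀ k, (f k).natDegree ≤ d) :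
    ∃ (u : Fin (l + 1) → ℂ[X]) (p : ℂ[X]), p ≠ 0 ∧ p.natDegree ≤ (l + 1) * (d + 3 * n * l) ∧
      ∀ k : Fin (l + 1), ∑ a : Fin (l + 1), u a * (coeffDeriv n i q)^[a] f k
        = if k = 0 then p else 0 := by
  classical
  let M : Matrix (Fin (l + 1)) (Fin (l + 1)) ℂ[X] :=
    Matrix.of fun a c => (coeffDeriv n i q)^[a] f c
  have hdet : M.det ≠ 0 := by
    intro h0
    obtain ⟨v, hv, hMv⟩ := Matrix.exists_mulVec_eq_zero_iff.2 h0
    let φ : (ℕ → ℂ[X]) →ₗ[ℂ[X]] ℂ[X] :=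
      ∑ c : Fin (l + 1), v c • (LinearMap.proj (c : ℕ))
    have hφ : ∀ g, φ g = ∑ c : Fin (l + 1), v c * g c := fun g => by
      simp [φ, LinearMap.sum_apply]
    have hspan : derivSpan n i q f l ≤ LinearMap.ker φ := by
      rw [derivSpan, Submodule.span_le]
      rintro _ ⟨a, ha, rfl⟩
      have := congrFun hMv ⟨a, by simpa using Nat.lt_succ_of_le ha⟩
      simp only [Matrix.mulVec, dotProduct, Pi.zero_apply, M, Matrix.of_apply] at this
      simp only [SetLike.mem_coe, LinearMap.mem_ker, hφ]
      rw [← this]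
      exact Finset.sum_congr rfl fun c _ => mul_comm _ _
    apply hv
    have hall : ∀ j, ∀ hj : j < l + 1, v ⟨j, hj⟩ = 0 := by
      intro j
      induction j using Nat.strong_induction_on with
      | _ j ih =>
        intro hj
        obtain ⟨g, hg, hg0, hgj⟩ := exists_mem_derivSpan_degree hn hi hq hl hf (l - j) (by omega)
        rw [show l - (l - j) = j by omega] at hg0 hgj
        have h1 : φ g = 0 := hspan (derivSpan_mono f (by omega) hg)
        rw [hφ, Finset.sum_eq_single ⟨j, hj⟩] at h1
        · exact (mul_eq_zero.1 h1).resolve_right hg0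
        · intro c _ hc
          rcases lt_trichotomy (c : ℕ) j with h | h | h
          · rw [ih c h c.2, zero_mul]
          · exact (hc (Fin.ext h)).elim
          · rw [hgj _ h, mul_zero]
        · simp
    ext1 c
    exact hall c c.2
  refine ⟨fun a => M.adjugate 0 a, M.det, hdet, ?_, fun k => ?_⟩
  · have := Matrix.det_apply M
    rw [this]
    refine natDegree_sum_le_of_forall_le _ _ fun σ _ => ?_
    refine (natDegree_smul_le _ _).trans ?_
    refine (natDegree_prod_le _ _).trans ?_
    refine (Finset.sum_le_card_nsmul _ _ (d + 3 * n * l) fun a _ => ?_).trans (by simp)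
    refine (natDegree_coeffDeriv_iterate_le (by omega) hd _ _).trans ?_
    have := (σ a).2
    gcongr
    omega
  · have := congrFun (congrFun (Matrix.adjugate_mul M) 0) k
    rw [Matrix.mul_apply] at this
    refine Eq.trans ?_ (this.trans ?_)
    · rfl
    simp [Matrix.smul_apply, Matrix.one_apply, eq_comm]

end Elimination

/-! ### Orders of vanishing and the zero estimate -/

section Vanishing

open Polynomial Metric Set

/-- The derivation `(1 - x^{2n}) d/dx`. -/
noncomputable def diffOp (n : ℕ) (F : ℂ → ℂ) (x : ℂ) : ℂ := (1 - x ^ (2 * n)) * deriv F x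

/-- `F` is `x^t` times a holomorphic function on the unit disc. -/
def VanishesTo (t : ℕ) (F : ℂ → ℂ) : Prop :=
  ∃ G, DifferentiableOn ℂ G (ball 0 1) ∧ ∀ x ∈ ball (0 : ℂ) 1, F x = x ^ t * G x

variable {n i : ℕ} {q : ℂ}

theorem deriv_congr_ball {F G : ℂ → ℂ} (h : EqOn F G (ball 0 1)) :
    EqOn (deriv F) (deriv G) (ball 0 1) := fun _ hx =>
  (h.eventuallyEq_of_mem (isOpen_ball.mem_nhds hx)).deriv_eq

theorem diffOp_congr {F G : ℂ → ℂ} (h : EqOn F G (ball 0 1)) :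
    EqOn (diffOp n F) (diffOp n G) (ball 0 1) := fun x hx => by
  simp only [diffOp, deriv_congr_ball h hx]

theorem diffOp_iterate_congr {F G : ℂ → ℂ} (h : EqOn F G (ball 0 1)) (t : ℕ) :
    EqOn ((diffOp n)^[t] F) ((diffOp n)^[t] G) (ball 0 1) := by
  induction t generalizing F G with
  | zero => exact h
  | succ t ih => exact ih (diffOp_congr h)

theorem differentiableOn_diffOp {F : ℂ → ℂ} (hF : DifferentiableOn ℂ F (ball 0 1)) :
    DifferentiableOn ℂ (diffOp n F) (ball 0 1) := by
  have := hF.deriv isOpen_ball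
  unfold diffOp
  fun_prop

theorem differentiableOn_diffOp_iterate {F : ℂ → ℂ} (hF : DifferentiableOn ℂ F (ball 0 1))
    (t : ℕ) : DifferentiableOn ℂ ((diffOp n)^[t] F) (ball 0 1) := by
  induction t generalizing F with
  | zero => exact hF
  | succ t ih => exact ih (differentiableOn_diffOp hF)

theorem diffOp_pow_succ_mul (hn : n ≠ 0) {F G : ℂ → ℂ} {t : ℕ}
    (hG : DifferentiableOn ℂ G (ball 0 1)) (hF : ∀ x ∈ ball (0 : ℂ) 1, F x = x ^ (t + 1) * G x) :
    ∃ G₁, DifferentiableOn ℂ G₁ (ball 0 1) ∧ G₁ 0 = (t + 1) * G 0 ∧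
      ∀ x ∈ ball (0 : ℂ) 1, diffOp n F x = x ^ t * G₁ x := by
  refine ⟨fun x => (1 - x ^ (2 * n)) * ((t + 1) * G x + x * deriv G x), ?_, ?_, ?_⟩
  · have := hG.deriv isOpen_ball
    fun_prop
  · simp [hn]
  · intro x hx
    have h1 : HasDerivAt (fun x => x ^ (t + 1) * G x) _ x := (hasDerivAt_pow (t + 1) x).mul
      ((hG x hx).differentiableAt (isOpen_ball.mem_nhds hx)).hasDerivAt
    rw [diffOp, deriv_congr_ball hF hx, h1.deriv]
    push_cast
    ring

theorem VanishesTo.diffOp_iterate (hn : n ≠ 0) {F : ℂ → ℂ} {t : ℕ} (a : ℕ)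
    (hF : VanishesTo (t + a) F) : VanishesTo t ((diffOp n)^[a] F) := by
  induction a generalizing F with
  | zero => exact hF
  | succ a ih =>
    obtain ⟨G, hG, hFG⟩ := hF
    obtain ⟨G₁, hG₁, -, h⟩ := diffOp_pow_succ_mul hn hG hFG
    exact ih ⟨G₁, hG₁, h⟩

theorem diffOp_iterate_zero (hn : n ≠ 0) {F G : ℂ → ℂ} {t : ℕ}
    (hG : DifferentiableOn ℂ G (ball 0 1)) (hF : ∀ x ∈ ball (0 : ℂ) 1, F x = x ^ t * G x) :
    (diffOp n)^[t] F 0 = t.factorial * G 0 := by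
  induction t generalizing F G with
  | zero => simpa using hF 0 (by simp)
  | succ t ih =>
    obtain ⟨G₁, hG₁, h0, h⟩ := diffOp_pow_succ_mul hn hG hF
    rw [Function.iterate_succ_apply, ih hG₁ h, h0, Nat.factorial_succ]
    push_cast
    ring

theorem VanishesTo.mono {F : ℂ → ℂ} {s t : ℕ} (h : s ≤ t) (hF : VanishesTo t F) :
    VanishesTo s F := by
  obtain ⟨G, hG, hFG⟩ := hF
  refine ⟨fun x => x ^ (t - s) * G x, by fun_prop, fun x hx => ?_⟩
  rw [hFG x hx, ← mul_assoc, ← pow_add, Nat.add_sub_cancel' h]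

theorem vanishesTo_succ {F G : ℂ → ℂ} {t : ℕ}
    (hG : DifferentiableOn ℂ G (ball 0 1)) (hF : ∀ x ∈ ball (0 : ℂ) 1, F x = x ^ t * G x)
    (h0 : G 0 = 0) : VanishesTo (t + 1) F := by
  refine ⟨dslope G 0, (Complex.differentiableOn_dslope (ball_mem_nhds _ one_pos)).2 hG,
    fun x hx => ?_⟩
  have := sub_smul_dslope G 0 x
  rw [h0] at this
  simp only [sub_zero, smul_eq_mul] at this
  rw [hF x hx, ← this]
  ring

theorem vanishesTo_of_diffOp_iterate (hn : n ≠ 0) {F : ℂ → ℂ}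
    (hF : DifferentiableOn ℂ F (ball 0 1)) (t : ℕ) (h : ∀ s < t, (diffOp n)^[s] F 0 = 0) :
    VanishesTo t F := by
  induction t with
  | zero => exact ⟨F, hF, by simp⟩
  | succ t ih =>
    obtain ⟨G, hG, hFG⟩ := ih fun s hs => h s (by omega)
    have := diffOp_iterate_zero hn hG hFG
    rw [h t (by omega)] at this
    exact vanishesTo_succ hG hFG
      ((mul_eq_zero.1 this.symm).resolve_left (by exact_mod_cast t.factorial_ne_zero))

theorem VanishesTo.add {F G : ℂ → ℂ} {t : ℕ} (hF : VanishesTo t F) (hG : VanishesTo t G) :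
    VanishesTo t (F + G) := by
  obtain ⟨F₁, hF₁, hF⟩ := hF
  obtain ⟨G₁, hG₁, hG⟩ := hG
  exact ⟨F₁ + G₁, hF₁.add hG₁, fun x hx => by simp [hF x hx, hG x hx, mul_add]⟩

theorem VanishesTo.sum {ι : Type*} {s : Finset ι} {F : ι → ℂ → ℂ} {t : ℕ}
    (h : ∀ a ∈ s, VanishesTo t (F a)) : VanishesTo t (fun x => ∑ a ∈ s, F a x) := by
  choose! G hG hFG using h
  exact ⟨fun x => ∑ a ∈ s, G a x, DifferentiableOn.fun_sum hG, fun x hx => by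
    rw [Finset.mul_sum]; exact Finset.sum_congr rfl fun a ha => hFG a ha x hx⟩

theorem VanishesTo.polynomial_mul {F : ℂ → ℂ} {t : ℕ} (hF : VanishesTo t F) (u : ℂ[X]) :
    VanishesTo t (fun x => u.eval x * F x) := by
  obtain ⟨F₁, hF₁, hF⟩ := hF
  refine ⟨fun x => u.eval x * F₁ x, u.differentiable.differentiableOn.mul hF₁, fun x hx => ?_⟩
  simp only [hF x hx]
  ring

theorem VanishesTo.le_natDegree {p : ℂ[X]} (hp : p ≠ 0) {t : ℕ}
    (h : VanishesTo t (fun x => p.eval x)) : t ≤ p.natDegree := by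
  obtain ⟨G, hG, h⟩ := h
  obtain ⟨p₁, hp₁, hnd⟩ := exists_eq_pow_rootMultiplicity_mul_and_not_dvd p hp 0
  set k := p.rootMultiplicity 0
  rw [C_0, sub_zero] at hp₁ hnd
  by_contra! hlt
  have hk : k ≤ p.natDegree := by
    have hp1 : p₁ ≠ 0 := by rintro rfl; simp at hnd
    rw [hp₁, natDegree_mul (pow_ne_zero _ X_ne_zero) hp1]
    simp
  have h1 : ∀ x ∈ ball (0 : ℂ) 1, x ≠ 0 → p₁.eval x = x ^ (t - k) * G x := by
    intro x hx hx0
    have := h x hx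
    simp only [hp₁] at this
    simp only [eval_mul, eval_pow, eval_X] at this
    apply mul_left_cancel₀ (pow_ne_zero k hx0)
    rw [this, ← mul_assoc, ← pow_add, Nat.add_sub_cancel' (by omega)]
  have h2 : Filter.Tendsto (fun x => p₁.eval x) (nhdsWithin 0 {0}ᶜ) (nhds (p₁.eval 0)) :=
    p₁.continuous.continuousAt.tendsto.mono_left nhdsWithin_le_nhds
  have hGc : ContinuousAt G 0 := (hG.differentiableAt (ball_mem_nhds _ one_pos)).continuousAt
  have h3 : Filter.Tendsto (fun x => x ^ (t - k) * G x) (nhdsWithin 0 {0}ᶜ)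
      (nhds ((0 : ℂ) ^ (t - k) * G 0)) :=
    ((continuousAt_id.pow _).mul hGc).tendsto.mono_left nhdsWithin_le_nhds
  have h4 : (fun x => p₁.eval x) =ᶠ[nhdsWithin 0 {0}ᶜ] fun x => x ^ (t - k) * G x := by
    filter_upwards [self_mem_nhdsWithin, nhdsWithin_le_nhds (ball_mem_nhds (0 : ℂ) one_pos)]
      with x hx hx' using h1 x hx' hx
  have h5 := tendsto_nhds_unique (h2.congr' h4) h3
  rw [zero_pow (by omega), zero_mul] at h5
  exact hnd (X_dvd_iff.2 (by rwa [coeff_zero_eq_eval_zero]))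

/-- The function `∑ₖ fₖ(x) w(x)ᵏ`. -/
noncomputable def evalSum (l : ℕ) (w : ℂ → ℂ) (f : ℕ → ℂ[X]) (x : ℂ) : ℂ :=
  ∑ k : Fin (l + 1), (f k).eval x * w x ^ (k : ℕ)

theorem diffOp_evalSum {w : ℂ → ℂ} (hw : DifferentiableOn ℂ w (ball 0 1))
    (hode : ∀ x ∈ ball (0 : ℂ) 1,
      diffOp n w x = -(n * x ^ (2 * n - 1) * w x) + q * x ^ i * (1 - x ^ (2 * n)))
    {l : ℕ} {f : ℕ → ℂ[X]} (hf : f (l + 1) = 0) :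
    EqOn (diffOp n (evalSum l w f)) (evalSum l w (coeffDeriv n i q f)) (ball 0 1) := by
  intro x hx
  have hwx := ((hw x hx).differentiableAt (isOpen_ball.mem_nhds hx)).hasDerivAt
  have hd : HasDerivAt (evalSum l w f) (∑ k : Fin (l + 1),
      ((derivative (f k)).eval x * w x ^ (k : ℕ)
        + (f k).eval x * (k * w x ^ ((k : ℕ) - 1) * deriv w x))) x := by
    unfold evalSum
    exact HasDerivAt.fun_sum fun k _ => ((f k).hasDerivAt x).mul (hwx.pow k)
  have hode' := hode x hx
  rw [diffOp] at hode'
  rw [diffOp, hd.deriv, evalSum, Finset.mul_sum]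
  rw [Fin.sum_univ_eq_sum_range (fun k => (1 - x ^ (2 * n)) *
      ((derivative (f k)).eval x * w x ^ (k : ℕ)
        + (f k).eval x * (k * w x ^ ((k : ℕ) - 1) * deriv w x))),
    Fin.sum_univ_eq_sum_range (fun k => (coeffDeriv n i q f k).eval x * w x ^ k)]
  have h1 : ∀ k ∈ Finset.range (l + 1), (1 - x ^ (2 * n)) *
      ((derivative (f k)).eval x * w x ^ (k : ℕ)
        + (f k).eval x * (k * w x ^ ((k : ℕ) - 1) * deriv w x))
      = (coeffDeriv n i q f k).eval x * w x ^ k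
        + (((k : ℕ) * ((f k).eval x) * q * x ^ i * (1 - x ^ (2 * n)) * w x ^ (k - 1))
          - (((k + 1 : ℕ) : ℂ) * ((f (k + 1)).eval x) * q * x ^ i * (1 - x ^ (2 * n))
            * w x ^ (k + 1 - 1))) := by
    intro k _
    simp only [coeffDeriv, eval_sub, eval_add, eval_mul, eval_C, eval_pow, eval_X, eval_one,
      Nat.add_sub_cancel]
    have h2 : (k : ℂ) * w x ^ k = k * (w x ^ (k - 1) * w x) := by
      rcases k with _ | k
      · simp
      · rw [Nat.add_sub_cancel, pow_succ]
    push_cast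
    linear_combination (f k).eval x * k * w x ^ (k - 1) * hode'
      + n * x ^ (2 * n - 1) * (f k).eval x * h2
  rw [Finset.sum_congr rfl h1, Finset.sum_add_distrib, Finset.sum_range_sub'
    (fun k => ((k : ℕ) : ℂ) * ((f k).eval x) * q * x ^ i * (1 - x ^ (2 * n)) * w x ^ (k - 1))]
  simp [hf]

theorem coeffDeriv_iterate_eq_zero {f : ℕ → ℂ[X]} {l : ℕ} (hf : ∀ k, l < k → f k = 0) (a : ℕ) :
    ∀ k, l < k → (coeffDeriv n i q)^[a] f k = 0 := by
  induction a with
  | zero => exact hf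
  | succ a ih =>
    intro k hk
    rw [Function.iterate_succ_apply', coeffDeriv, ih k hk, ih (k + 1) (by omega)]
    simp

theorem diffOp_iterate_evalSum {w : ℂ → ℂ} (hw : DifferentiableOn ℂ w (ball 0 1))
    (hode : ∀ x ∈ ball (0 : ℂ) 1,
      diffOp n w x = -(n * x ^ (2 * n - 1) * w x) + q * x ^ i * (1 - x ^ (2 * n)))
    {l : ℕ} {f : ℕ → ℂ[X]} (hf : ∀ k, l < k → f k = 0) (a : ℕ) :
    EqOn ((diffOp n)^[a] (evalSum l w f)) (evalSum l w ((coeffDeriv n i q)^[a] f))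
      (ball 0 1) := by
  induction a with
  | zero => exact fun _ _ => rfl
  | succ a ih =>
    rw [Function.iterate_succ_apply', Function.iterate_succ_apply']
    exact (diffOp_congr ih).trans
      (diffOp_evalSum hw hode (coeffDeriv_iterate_eq_zero hf a _ l.lt_succ_self))

/-- Zero estimate at the origin, uniform in the initial value of `w`. -/
theorem vanishesTo_evalSum_le (hn : 2 ≤ n) (hi : i ≤ n - 2) (hq : q ≠ 0) {w : ℂ → ℂ}
    (hw : DifferentiableOn ℂ w (ball 0 1))
    (hode : ∀ x ∈ ball (0 : ℂ) 1,
      diffOp n w x = -(n * x ^ (2 * n - 1) * w x) + q * x ^ i * (1 - x ^ (2 * n)))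
    {l d : ℕ} {f : ℕ → ℂ[X]} (hl : f l ≠ 0) (hf : ∀ k, l < k → f k = 0)
    (hd : ∀ k, (f k).natDegree ≤ d) {t : ℕ} (h : VanishesTo t (evalSum l w f)) :
    t ≤ l + (l + 1) * (d + 3 * n * l) := by
  obtain ⟨u, p, hp, hpd, hup⟩ := exists_elimination hn hi hq hl hf hd
  rcases Nat.lt_or_ge t l with htl | htl
  · omega
  have h1 : VanishesTo (t - l) (fun x => ∑ a : Fin (l + 1),
      (u a).eval x * (diffOp n)^[a] (evalSum l w f) x) := by
    refine VanishesTo.sum fun a _ => VanishesTo.polynomial_mul ?_ _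
    refine VanishesTo.diffOp_iterate (by omega) a (h.mono ?_)
    omega
  have h2 : VanishesTo (t - l) (fun x => p.eval x) := by
    obtain ⟨G, hG, h1⟩ := h1
    refine ⟨G, hG, fun x hx => ?_⟩
    rw [← h1 x hx]
    have h3 : ∀ a : Fin (l + 1), (u a).eval x * (diffOp n)^[a] (evalSum l w f) x
        = ∑ k : Fin (l + 1), (u a * (coeffDeriv n i q)^[a] f k).eval x * w x ^ (k : ℕ) := by
      intro a
      rw [diffOp_iterate_evalSum hw hode hf a hx, evalSum, Finset.mul_sum]
      exact Finset.sum_congr rfl fun k _ => by rw [eval_mul, mul_assoc]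
    simp_rw [h3]
    rw [Finset.sum_comm]
    simp_rw [← Finset.sum_mul, ← eval_finsetSum, hup]
    simp [apply_ite (eval x)]
  have := (h2.le_natDegree hp).trans hpd
  omega

end Vanishing

/-! ### The Abelian integrals near the origin -/

section AbelianIntegrals

open Metric Set MeasureTheory intervalIntegral

/-- The primitive of `f` obtained by integrating along segments from the origin. -/
noncomputable def segPrim (f : ℂ → ℂ) (x : ℂ) : ℂ := ∫ s in (0 : ℝ)..1, x * f (s * x)

theorem segPrim_zero (f : ℂ → ℂ) : segPrim f 0 = 0 := by simp [segPrim]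

theorem hasDerivAt_segPrim {f : ℂ → ℂ} {U : Set ℂ} (hU : IsOpen U) (hst : StarConvex ℝ 0 U)
    (hf : DifferentiableOn ℂ f U) {x : ℂ} (hx : x ∈ U) : HasDerivAt (segPrim f) (f x) x := by
  have hseg : segment ℝ 0 x ⊆ U := hst.segment_subset hx
  have hcomp : IsCompact (segment ℝ (0 : ℂ) x) := by
    rw [segment_eq_image]
    exact isCompact_Icc.image (by fun_prop)
  obtain ⟨δ, hδ, hsub⟩ := hcomp.exists_thickening_subset_open hU hseg
  set N := thickening δ (segment ℝ (0 : ℂ) x)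
  have hNo : IsOpen N := isOpen_thickening
  have hNc : Convex ℝ N := (convex_segment _ _).thickening δ
  have hNs : segment ℝ (0 : ℂ) x ⊆ N := self_subset_thickening hδ _
  have h0 : (0 : ℂ) ∈ N := hNs (left_mem_segment ℝ _ _)
  have hxN : x ∈ N := hNs (right_mem_segment ℝ _ _)
  obtain ⟨P, hP⟩ := hNc.exists_forall_hasDerivWithinAt (hf.mono hsub)
  have hP' : ∀ a ∈ N, HasDerivAt P (f a) a := fun a ha => (hP a ha).hasDerivAt (hNo.mem_nhds ha)
  have heq : ∀ z ∈ N, segPrim f z = P z - P 0 := by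
    intro z hz
    have hmem : ∀ s ∈ uIcc (0 : ℝ) 1, (s : ℂ) * z ∈ N := by
      intro s hs
      rw [uIcc_of_le zero_le_one] at hs
      have := (hNc.starConvex h0) hz (sub_nonneg.2 hs.2) hs.1 (by ring)
      simpa using this
    have hd : ∀ s ∈ uIcc (0 : ℝ) 1, HasDerivAt (fun s : ℝ => P (s * z)) (z * f (s * z)) s := by
      intro s hs
      have h1 : HasDerivAt (fun s : ℝ => (s : ℂ) * z) z s := by
        simpa using (Complex.ofRealCLM.hasDerivAt (x := s)).mul_const z
      have := (hP' _ (hmem s hs)).scomp s h1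
      simpa [Function.comp_def] using this
    have := integral_eq_sub_of_hasDerivAt hd ?_
    · simpa [segPrim] using this
    · apply ContinuousOn.intervalIntegrable
      refine continuousOn_const.mul ?_
      refine (hf.mono hsub).continuousOn.comp (by fun_prop) hmem
  have h2 : segPrim f =ᶠ[nhds x] fun z => P z - P 0 := by
    filter_upwards [hNo.mem_nhds hxN] with z hz using heq z hz
  exact ((hP' x hxN).sub_const _).congr_of_eventuallyEq h2

variable {n : ℕ}

/-- The plane slit along the rays from the `2n`-th roots of unity to infinity. -/
def slit (n : ℕ) : Set ℂ := {x | 1 - x ^ (2 * n) ∈ Complex.slitPlane}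

/-- The branch of `√(1 - x^{2n})` with positive real part. -/
noncomputable def root (n : ℕ) (x : ℂ) : ℂ := (1 - x ^ (2 * n)) ^ (1 / 2 : ℂ)

/-- The integral `∫₀ˣ s^j / √(1 - s^{2n}) ds` on the slit plane. -/
noncomputable def abelInt (n j : ℕ) : ℂ → ℂ := segPrim fun x => x ^ j / root n x

theorem isOpen_slit : IsOpen (slit n) :=
  Complex.isOpen_slitPlane.preimage (by fun_prop)

theorem starConvex_one_slitPlane {z : ℂ} (hz : z ∈ Complex.slitPlane) {u : ℝ} (h0 : 0 ≤ u)
    (h1 : u ≤ 1) : (1 - u) + u * z ∈ Complex.slitPlane := by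
  rcases h0.eq_or_lt with rfl | h0
  · simp
  rw [Complex.mem_slitPlane_iff] at *
  simp only [Complex.add_re, Complex.sub_re, Complex.one_re, Complex.ofReal_re, Complex.mul_re,
    Complex.ofReal_im, zero_mul, sub_zero, Complex.add_im, Complex.sub_im, Complex.one_im,
    Complex.mul_im, add_zero, sub_self, zero_add]
  rcases hz with hz | hz
  · left; nlinarith
  · right; exact mul_ne_zero h0.ne' hz

theorem smul_mem_slit {x : ℂ} (hx : x ∈ slit n) {s : ℝ} (h0 : 0 ≤ s) (h1 : s ≤ 1) :
    (s : ℂ) * x ∈ slit n := by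
  have := starConvex_one_slitPlane hx (u := s ^ (2 * n)) (by positivity) (pow_le_one₀ h0 h1)
  rw [slit, mem_ofPred_eq]
  convert this using 1
  push_cast
  ring

theorem starConvex_of_mul_mem {U : Set ℂ}
    (h : ∀ x ∈ U, ∀ s : ℝ, 0 ≤ s → s ≤ 1 → (s : ℂ) * x ∈ U) : StarConvex ℝ 0 U := by
  intro x hx a b ha hb hab
  have := h x hx b hb (by linarith)
  simpa using this

theorem starConvex_slit : StarConvex ℝ 0 (slit n) :=
  starConvex_of_mul_mem fun _ hx _ h0 h1 => smul_mem_slit hx h0 h1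

theorem mem_slit_of_re_lt {x : ℂ} (hx : (x ^ (2 * n)).re < 1) : x ∈ slit n := by
  left; simpa using hx

theorem ball_subset_slit (hn : n ≠ 0) : ball (0 : ℂ) 1 ⊆ slit n := by
  intro x hx
  apply mem_slit_of_re_lt
  have : ‖x‖ < 1 := by simpa using hx
  calc (x ^ (2 * n)).re ≤ ‖x ^ (2 * n)‖ := Complex.re_le_norm _
    _ = ‖x‖ ^ (2 * n) := norm_pow _ _
    _ < 1 := pow_lt_one₀ (norm_nonneg _) this (by omega)

theorem cpow_half_sq (z : ℂ) : (z ^ (1 / 2 : ℂ)) ^ 2 = z := by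
  rw [← Complex.cpow_nat_mul]; norm_num

theorem root_sq (x : ℂ) : root n x ^ 2 = 1 - x ^ (2 * n) := cpow_half_sq _

theorem cpow_half_re_pos {z : ℂ} (hz : z ∈ Complex.slitPlane) : 0 < (z ^ (1 / 2 : ℂ)).re := by
  have hz0 := Complex.slitPlane_ne_zero hz
  rw [Complex.cpow_def_of_ne_zero hz0, Complex.exp_re]
  refine mul_pos (Real.exp_pos _) (Real.cos_pos_of_mem_Ioo ?_)
  have h1 := Complex.neg_pi_lt_arg z
  have h2 := (Complex.arg_le_pi z).lt_of_ne (Complex.mem_slitPlane_iff_arg.1 hz).1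
  have h3 : (Complex.log z * (1 / 2 : ℂ)).im = z.arg / 2 := by
    have : (1 / 2 : ℂ) = ((1 / 2 : ℝ) : ℂ) := by norm_num
    rw [this, Complex.im_mul_ofReal, Complex.log_im]
    ring
  rw [h3]
  constructor <;> linarith

theorem root_re_pos {x : ℂ} (hx : x ∈ slit n) : 0 < (root n x).re := cpow_half_re_pos hx

theorem root_ne_zero {x : ℂ} (hx : x ∈ slit n) : root n x ≠ 0 := fun h => by
  simpa [h] using root_re_pos hx

theorem eq_of_sq_eq_of_re_pos {a b : ℂ} (h : a ^ 2 = b ^ 2) (ha : 0 < a.re) (hb : 0 < b.re) :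
    a = b := by
  rcases sq_eq_sq_iff_eq_or_eq_neg.1 h with h | h
  · exact h
  · have := congrArg Complex.re h
    simp at this
    linarith

theorem hasDerivAt_root {x : ℂ} (hx : x ∈ slit n) :
    HasDerivAt (root n) (-(n * x ^ (2 * n - 1)) / root n x) x := by
  have h1 : HasDerivAt (fun x : ℂ => 1 - x ^ (2 * n)) (-((2 * n : ℕ) * x ^ (2 * n - 1))) x :=
    (hasDerivAt_pow _ x).const_sub 1
  have h2 := h1.cpow_const (c := 1 / 2) hx
  refine h2.congr_deriv ?_
  have hr := root_ne_zero hx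
  have h3 : (1 - x ^ (2 * n) : ℂ) ≠ 0 := Complex.slitPlane_ne_zero hx
  rw [Complex.cpow_sub _ _ h3, Complex.cpow_one]
  change 1 / 2 * (root n x / (1 - x ^ (2 * n))) * _ = _
  rw [← root_sq]
  field_simp
  push_cast
  ring

theorem differentiableOn_root : DifferentiableOn ℂ (root n) (slit n) := fun _ hx =>
  (hasDerivAt_root hx).differentiableAt.differentiableWithinAt

theorem hasDerivAt_abelInt (j : ℕ) {x : ℂ} (hx : x ∈ slit n) :
    HasDerivAt (abelInt n j) (x ^ j / root n x) x :=
  hasDerivAt_segPrim isOpen_slit starConvex_slit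
    ((differentiableOn_pow j).div differentiableOn_root fun _ => root_ne_zero) hx

theorem abelInt_zero (j : ℕ) : abelInt n j 0 = 0 := segPrim_zero _

theorem root_mul_of_pow_eq_one {ω : ℂ} (hω : ω ^ (2 * n) = 1) (x : ℂ) :
    root n (ω * x) = root n x := by
  rw [root, mul_pow, hω, one_mul, root]

theorem mul_mem_slit {ω : ℂ} (hω : ω ^ (2 * n) = 1) {x : ℂ} : ω * x ∈ slit n ↔ x ∈ slit n := by
  rw [slit, mem_ofPred_eq, mul_pow, hω, one_mul, mem_ofPred_eq]

theorem abelInt_mul_of_pow_eq_one {ω : ℂ} (hω : ω ^ (2 * n) = 1) (j : ℕ) (x : ℂ) :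
    abelInt n j (ω * x) = ω ^ (j + 1) * abelInt n j x := by
  rw [abelInt, segPrim, segPrim, ← intervalIntegral.integral_const_mul]
  congr 1
  ext s
  rw [show (s : ℂ) * (ω * x) = ω * (s * x) by ring, root_mul_of_pow_eq_one hω]
  ring

/-- The `y`-plane slit along the real rays from `±1` to infinity. -/
def coslit : Set ℂ := {y | 1 - y ^ 2 ∈ Complex.slitPlane}

/-- The principal branch of `(1 - y^2)^{1/(2n)}`. -/
noncomputable def coroot (n : ℕ) (y : ℂ) : ℂ := (1 - y ^ 2) ^ (((2 * n : ℕ) : ℂ)⁻¹)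

/-- The real integral `∫₀¹ s^j / √(1 - s^{2n}) ds`. -/
noncomputable def realInt (n j : ℕ) : ℝ := ∫ s in (0 : ℝ)..1, s ^ j / √(1 - s ^ (2 * n))

/-- The analytic continuation of `abelInt n j ∘ coroot n` from the right half plane. -/
noncomputable def coabelInt (n j : ℕ) (y : ℂ) : ℂ :=
  realInt n j - segPrim (fun y => coroot n y ^ j / (n * coroot n y ^ (2 * n - 1))) y

theorem isOpen_coslit : IsOpen coslit := Complex.isOpen_slitPlane.preimage (by fun_prop)

theorem starConvex_coslit : StarConvex ℝ 0 coslit :=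
  starConvex_of_mul_mem fun x hx s h0 h1 => by
    have := starConvex_one_slitPlane hx (u := s ^ 2) (by positivity) (pow_le_one₀ h0 h1)
    rw [coslit, mem_ofPred_eq]
    convert this using 1
    push_cast
    ring

theorem coroot_pow (hn : n ≠ 0) (y : ℂ) : coroot n y ^ (2 * n) = 1 - y ^ 2 :=
  Complex.cpow_nat_inv_pow _ (by omega)

theorem coroot_ne_zero (hn : n ≠ 0) {y : ℂ} (hy : y ∈ coslit) : coroot n y ≠ 0 := by
  intro h
  have := coroot_pow hn y
  rw [h, zero_pow (by omega)] at this
  exact Complex.slitPlane_ne_zero hy this.symm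

theorem hasDerivAt_coroot (hn : n ≠ 0) {y : ℂ} (hy : y ∈ coslit) :
    HasDerivAt (coroot n) (-y / (n * coroot n y ^ (2 * n - 1))) y := by
  have h1 : HasDerivAt (fun y : ℂ => 1 - y ^ 2) (-((2 : ℕ) * y ^ (2 - 1))) y :=
    (hasDerivAt_pow _ y).const_sub 1
  have h2 := h1.cpow_const (c := ((2 * n : ℕ) : ℂ)⁻¹) hy
  refine h2.congr_deriv ?_
  have hr := coroot_ne_zero hn hy
  have h3 : (1 - y ^ 2 : ℂ) ≠ 0 := Complex.slitPlane_ne_zero hy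
  rw [Complex.cpow_sub _ _ h3, Complex.cpow_one]
  change _ * (coroot n y / (1 - y ^ 2)) * _ = _
  have hn' : (n : ℂ) ≠ 0 := by exact_mod_cast hn
  have h4 : coroot n y ^ (2 * n - 1) * coroot n y = 1 - y ^ 2 := by
    rw [← coroot_pow hn, ← pow_succ]; congr 1; omega
  have h5 : coroot n y / (1 - y ^ 2) = 1 / coroot n y ^ (2 * n - 1) := by
    rw [← h4]; field_simp
  rw [h5]
  push_cast
  field_simp

theorem differentiableOn_coroot (hn : n ≠ 0) : DifferentiableOn ℂ (coroot n) coslit := fun _ hx =>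
  (hasDerivAt_coroot hn hx).differentiableAt.differentiableWithinAt

theorem hasDerivAt_coabelInt (hn : n ≠ 0) (j : ℕ) {y : ℂ} (hy : y ∈ coslit) :
    HasDerivAt (coabelInt n j) (-(coroot n y ^ j / (n * coroot n y ^ (2 * n - 1)))) y := by
  have hn' : (n : ℂ) ≠ 0 := by exact_mod_cast hn
  refine HasDerivAt.const_sub _ (hasDerivAt_segPrim isOpen_coslit starConvex_coslit ?_ hy)
  exact ((differentiableOn_coroot hn).pow j).div
    (((differentiableOn_coroot hn).pow _).const_mul _)
    fun y hy => mul_ne_zero hn' (pow_ne_zero _ (coroot_ne_zero hn hy))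

theorem coroot_neg (y : ℂ) : coroot n (-y) = coroot n y := by rw [coroot, neg_sq, coroot]

theorem coabelInt_neg (j : ℕ) (y : ℂ) :
    coabelInt n j (-y) = 2 * realInt n j - coabelInt n j y := by
  have : segPrim (fun y => coroot n y ^ j / (n * coroot n y ^ (2 * n - 1))) (-y)
      = - segPrim (fun y => coroot n y ^ j / (n * coroot n y ^ (2 * n - 1))) y := by
    rw [segPrim, segPrim, ← intervalIntegral.integral_neg]
    congr 1
    ext s
    rw [mul_neg, coroot_neg]
    ring
  rw [coabelInt, coabelInt, this]
  ring

theorem coroot_mem_slit (hn : n ≠ 0) {y : ℂ} (hre : 0 < y.re) : coroot n y ∈ slit n := by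
  rw [slit, mem_ofPred_eq, coroot_pow hn, sub_sub_cancel, Complex.mem_slitPlane_iff]
  simp only [sq, Complex.mul_re, Complex.mul_im]
  by_cases h : y.im = 0
  · left; rw [h]; nlinarith
  · right
    have : y.re * y.im + y.im * y.re = 2 * (y.re * y.im) := by ring
    rw [this]
    exact mul_ne_zero two_ne_zero (mul_ne_zero hre.ne' h)

theorem root_coroot (hn : n ≠ 0) {y : ℂ} (hre : 0 < y.re) : root n (coroot n y) = y := by
  refine eq_of_sq_eq_of_re_pos ?_ (root_re_pos (coroot_mem_slit hn hre)) hre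
  rw [root_sq, coroot_pow hn, sub_sub_cancel]

theorem mem_coslit_of_re_pos {y : ℂ} (hre : 0 < y.re) :
    y ∈ coslit ↔ y.im ≠ 0 ∨ y.re < 1 := by
  rw [coslit, mem_ofPred_eq, Complex.mem_slitPlane_iff]
  simp only [sq, Complex.mul_re, Complex.mul_im, Complex.sub_re, Complex.sub_im, Complex.one_re,
    Complex.one_im]
  by_cases h : y.im = 0
  · simp only [h, ne_eq, not_true_eq_false, false_or]
    constructor
    · rintro (h1 | h1)
      · nlinarith
      · simp at h1
    · intro h1; left; nlinarith
  · simp only [ne_eq, h, not_false_eq_true, true_or, iff_true]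
    right
    have : 0 - (y.re * y.im + y.im * y.re) = -2 * (y.re * y.im) := by ring
    rw [this]
    exact mul_ne_zero (by norm_num) (mul_ne_zero hre.ne' h)

theorem isPreconnected_coslit_inter : IsPreconnected (coslit ∩ {y | 0 < y.re}) := by
  have h : StarConvex ℝ (1 / 2 : ℂ) (coslit ∩ {y | 0 < y.re}) := by
    rintro y ⟨hy, hre⟩ a b ha hb hab
    have hre' : 0 < y.re := hre
    rw [mem_coslit_of_re_pos hre] at hy
    have h1 : (a • (1 / 2 : ℂ) + b • y).re = a / 2 + b * y.re := by simp; ring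
    have h2 : (a • (1 / 2 : ℂ) + b • y).im = b * y.im := by simp
    have hpos : 0 < (a • (1 / 2 : ℂ) + b • y).re := by
      rw [h1]
      rcases hb.eq_or_lt with rfl | hb
      · have : a = 1 := by linarith
        subst this; norm_num
      · have := mul_pos hb hre'
        linarith
    refine ⟨(mem_coslit_of_re_pos hpos).2 ?_, hpos⟩
    rw [h1, h2]
    rcases hb.eq_or_lt with rfl | hb
    · right; linarith
    · rcases hy with hy | hy
      · left; exact mul_ne_zero hb.ne' hy
      · right; nlinarith
  have hmem : (1 / 2 : ℂ) ∈ coslit ∩ {y | 0 < y.re} := by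
    have : (0 : ℝ) < (1 / 2 : ℂ).re := by norm_num
    exact ⟨(mem_coslit_of_re_pos this).2 (Or.inr (by norm_num)), this⟩
  exact (h.isPathConnected hmem).isConnected.isPreconnected

theorem intervalIntegrable_realInt (hn : n ≠ 0) (j : ℕ) :
    IntervalIntegrable (fun s : ℝ => s ^ j / √(1 - s ^ (2 * n))) volume 0 1 := by
  have h1 : IntervalIntegrable (fun s : ℝ => (1 - s) ^ (-(1 / 2) : ℝ)) volume 0 1 := by
    have := (intervalIntegrable_rpow' (a := 0) (b := 1) (r := -(1 / 2)) (by norm_num)).comp_sub_left 1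
    simpa using this.symm
  refine h1.mono_fun ?_ ?_
  · apply Measurable.aestronglyMeasurable
    fun_prop
  · rw [uIoc_of_le zero_le_one]
    filter_upwards [ae_restrict_mem measurableSet_Ioc] with s hs
    rw [Real.norm_of_nonneg (by have := hs.1.le; positivity),
      Real.norm_of_nonneg (Real.rpow_nonneg (by linarith [hs.2]) _),
      Real.rpow_neg (by linarith [hs.2]), ← Real.sqrt_eq_rpow]
    rcases hs.2.eq_or_lt with h | h
    · simp [h]
    have h2 : s ^ (2 * n) ≤ s := pow_le_of_le_one hs.1.le hs.2 (by omega)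
    have h3 : 0 < √(1 - s) := Real.sqrt_pos.2 (by linarith)
    rw [div_eq_mul_inv]
    calc s ^ j * (√(1 - s ^ (2 * n)))⁻¹ ≤ 1 * (√(1 - s))⁻¹ := by
          gcongr
          exact pow_le_one₀ hs.1.le hs.2
      _ = _ := one_mul _

theorem realInt_pos (hn : n ≠ 0) (j : ℕ) : 0 < realInt n j := by
  refine intervalIntegral_pos_of_pos_on (intervalIntegrable_realInt hn j) (fun s hs => ?_)
    zero_lt_one
  have : s ^ (2 * n) < 1 := pow_lt_one₀ hs.1.le hs.2 (by omega)
  have h3 : 0 < √(1 - s ^ (2 * n)) := Real.sqrt_pos.2 (by linarith)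
  have := hs.1
  positivity

theorem abelInt_ofReal (j : ℕ) {x : ℝ} (h0 : 0 ≤ x) (h1 : x ≤ 1) :
    abelInt n j x = (∫ s in (0 : ℝ)..x, s ^ j / √(1 - s ^ (2 * n)) : ℝ) := by
  have h2 : (∫ s in (0 : ℝ)..x, s ^ j / √(1 - s ^ (2 * n)))
      = ∫ s in (0 : ℝ)..1, x * ((s * x) ^ j / √(1 - (s * x) ^ (2 * n))) := by
    have := mul_integral_comp_mul_right (a := 0) (b := 1) x
      (f := fun s : ℝ => s ^ j / √(1 - s ^ (2 * n)))
    rw [intervalIntegral.integral_const_mul, this]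
    simp
  rw [h2, ← intervalIntegral.integral_ofReal, abelInt, segPrim]
  refine integral_congr fun s hs => ?_
  rw [uIcc_of_le zero_le_one] at hs
  have h3 : (0 : ℝ) ≤ 1 - (s * x) ^ (2 * n) := by
    have : s * x ≤ 1 := mul_le_one₀ hs.2 h0 h1
    have := pow_le_one₀ (n := 2 * n) (mul_nonneg hs.1 h0) this
    linarith
  have h4 : root n ((s : ℂ) * x) = (√(1 - (s * x) ^ (2 * n)) : ℝ) := by
    rw [Real.sqrt_eq_rpow, Complex.ofReal_cpow h3, root]
    push_cast
    rfl
  simp only [h4]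
  push_cast
  rfl

theorem abelInt_coroot (hn : n ≠ 0) (j : ℕ) {y : ℂ} (hy : y ∈ coslit) (hre : 0 < y.re) :
    abelInt n j (coroot n y) = coabelInt n j y := by
  have hopen : IsOpen (coslit ∩ {y : ℂ | 0 < y.re}) :=
    isOpen_coslit.inter (isOpen_lt continuous_const Complex.continuous_re)
  have hd1 : ∀ y ∈ coslit ∩ {y : ℂ | 0 < y.re}, HasDerivAt (fun y => abelInt n j (coroot n y))
      (-(coroot n y ^ j / (n * coroot n y ^ (2 * n - 1)))) y := by
    rintro y ⟨hy, hre⟩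
    have h := (hasDerivAt_abelInt j (coroot_mem_slit hn hre)).comp y (hasDerivAt_coroot hn hy)
    refine h.congr_deriv ?_
    rw [root_coroot hn hre]
    have : y ≠ 0 := by rintro rfl; simp at hre
    have := coroot_ne_zero hn hy
    have hn' : (n : ℂ) ≠ 0 := by exact_mod_cast hn
    field_simp
  have hd2 : ∀ y ∈ coslit ∩ {y : ℂ | 0 < y.re}, HasDerivAt (coabelInt n j)
      (-(coroot n y ^ j / (n * coroot n y ^ (2 * n - 1)))) y :=
    fun y hy => hasDerivAt_coabelInt hn j hy.1
  obtain ⟨c, hc⟩ := hopen.exists_eq_add_of_deriv_eq isPreconnected_coslit_inter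
    (fun y hy => (hd1 y hy).differentiableAt.differentiableWithinAt)
    (fun y hy => (hd2 y hy).differentiableAt.differentiableWithinAt)
    (fun y hy => by rw [(hd1 y hy).deriv, (hd2 y hy).deriv])
  have h0 : (0 : ℂ) ∈ coslit := by simp [coslit]
  have hlim1 : Filter.Tendsto (fun y : ℝ => coabelInt n j y + c) (nhdsWithin 0 (Ioi 0))
      (nhds (realInt n j + c)) := by
    have h1 : ContinuousAt (coabelInt n j) ((0 : ℝ) : ℂ) := by
      simpa using (hasDerivAt_coabelInt hn j h0).continuousAt
    have h2 := (h1.comp Complex.continuous_ofReal.continuousAt).tendsto.add_const c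
    have h3 : coabelInt n j 0 = realInt n j := by simp [coabelInt, segPrim_zero]
    simp only [Function.comp_apply, Complex.ofReal_zero, h3] at h2
    exact h2.mono_left nhdsWithin_le_nhds
  let ξ : ℝ → ℝ := fun y => (1 - y ^ 2) ^ (((2 * n : ℕ) : ℝ)⁻¹)
  have hξ : ∀ y ∈ Ioo (0 : ℝ) 1, ξ y ∈ Icc (0 : ℝ) 1 ∧ coroot n y = ξ y := by
    intro y hy
    have h1 : (0 : ℝ) ≤ 1 - y ^ 2 := by nlinarith [hy.1, hy.2]
    refine ⟨⟨Real.rpow_nonneg h1 _, Real.rpow_le_one h1 (by nlinarith [sq_nonneg y])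
      (by positivity)⟩, ?_⟩
    rw [Complex.ofReal_cpow h1, coroot]
    push_cast
    rfl
  have hev : Ioo (0 : ℝ) 1 ∈ nhdsWithin (0 : ℝ) (Ioi 0) := Ioo_mem_nhdsGT zero_lt_one
  have hξ1 : Filter.Tendsto ξ (nhdsWithin 0 (Ioi 0)) (nhdsWithin 1 (Icc 0 1)) := by
    rw [tendsto_nhdsWithin_iff]
    constructor
    · have h1 : ContinuousAt ξ 0 := by
        refine ContinuousAt.rpow_const (by fun_prop) (Or.inl (by norm_num))
      have h2 : ξ 0 = 1 := by simp [ξ]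
      have := h1.tendsto
      rw [h2] at this
      exact this.mono_left nhdsWithin_le_nhds
    · filter_upwards [hev] with y hy using (hξ y hy).1
  have hprim := continuousOn_primitive_interval
    (((intervalIntegrable_iff' (by simp)).1 (intervalIntegrable_realInt hn j)))
  rw [uIcc_of_le zero_le_one] at hprim
  have hlim2 : Filter.Tendsto (fun y : ℝ => abelInt n j (coroot n y)) (nhdsWithin 0 (Ioi 0))
      (nhds (realInt n j)) := by
    have h1 := (hprim 1 (right_mem_Icc.2 zero_le_one)).tendsto.comp hξ1
    have h2 := (Complex.continuous_ofReal.tendsto _).comp h1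
    refine h2.congr' ?_
    filter_upwards [hev] with y hy
    rw [(hξ y hy).2, abelInt_ofReal j (hξ y hy).1.1 (hξ y hy).1.2]
    rfl
  have heq : (fun y : ℝ => abelInt n j (coroot n y)) =ᶠ[nhdsWithin 0 (Ioi 0)]
      fun y : ℝ => coabelInt n j y + c := by
    filter_upwards [hev] with y hy
    have hy0 : (0 : ℝ) < (y : ℂ).re := by simpa using hy.1
    exact hc ⟨(mem_coslit_of_re_pos hy0).2 (Or.inr (by simpa using hy.2)), hy0⟩
  have hfin := tendsto_nhds_unique (hlim2.congr' heq) hlim1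
  have hc0 : c = 0 := by linear_combination -hfin
  simpa [hc0] using hc ⟨hy, hre⟩

end AbelianIntegrals

/-! ### Comparison of metrics and local charts -/

section SphericalMetric

open Metric Set Filter Topology

/-- The vector of monomials `(1, x, …, x^{n-2})`. -/
noncomputable def mon (n : ℕ) (x : ℂ) : EuclideanSpace ℂ (Fin (n - 1)) :=
  WithLp.toLp 2 fun j => x ^ (j : ℕ)

theorem norm_mon_sq_le {n : ℕ} (hn : 2 ≤ n) (x : ℂ) {B : ℝ} (hB : 1 ≤ B) (h : ‖x‖ ^ 2 ≤ B) :
    ‖mon n x‖ ^ 2 ≤ n * B ^ (n - 2) := by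
  rw [EuclideanSpace.norm_sq_eq]
  calc ∑ j : Fin (n - 1), ‖mon n x j‖ ^ 2 ≤ ∑ _j : Fin (n - 1), B ^ (n - 2) := by
        refine Finset.sum_le_sum fun j _ => ?_
        have : ‖mon n x j‖ ^ 2 = (‖x‖ ^ 2) ^ (j : ℕ) := by
          simp only [mon, norm_pow]; ring
        rw [this]
        exact (pow_le_pow_left₀ (by positivity) h _).trans (pow_le_pow_right₀ hB (by omega))
    _ = ((n - 1 : ℕ) : ℝ) * B ^ (n - 2) := by simp
    _ ≤ n * B ^ (n - 2) := by gcongr; omega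

/-- The invariant differentials are dominated by the pullbacks of the spherical metric. -/
theorem exists_metric_bound {n : ℕ} (hn : 2 ≤ n) : ∃ c : ℝ, 0 < c ∧ ∀ x y : ℂ,
    y ^ 2 = 1 - x ^ (2 * n) → c * ‖mon n x‖ ^ 2
      < ‖y‖ ^ 2 / (1 + ‖x‖ ^ 2) ^ 2 + (n * ‖x‖ ^ (2 * n - 1)) ^ 2 / (1 + ‖y‖ ^ 2) ^ 2 := by
  have hn1 : (1 : ℝ) ≤ n := by exact_mod_cast (by omega : 1 ≤ n)
  have h4n : (1 : ℝ) ≤ 4 ^ n := one_le_pow₀ (by norm_num)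
  have h2n : (1 : ℝ) ≤ 2 ^ n := one_le_pow₀ (by norm_num)
  refine ⟨1 / (16 * n * 2 ^ n * 4 ^ n * (2 + 2 ^ n) ^ 2), by positivity, fun x y hxy => ?_⟩
  set c : ℝ := 1 / (16 * n * 2 ^ n * 4 ^ n * (2 + 2 ^ n) ^ 2) with hc
  set u := ‖x‖ ^ 2 with hu
  have hu0 : 0 ≤ u := by positivity
  have hy : ‖y‖ ^ 2 = ‖1 - x ^ (2 * n)‖ := by rw [← hxy, norm_pow]
  have hxn : ‖x ^ (2 * n)‖ = u ^ n := by rw [norm_pow, pow_mul]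
  have hyu : ‖y‖ ^ 2 ≤ 1 + u ^ n := by
    rw [hy, ← hxn]; simpa using norm_sub_le (1 : ℂ) (x ^ (2 * n))
  have hyl1 : 1 - u ^ n ≤ ‖y‖ ^ 2 := by
    rw [hy, ← hxn]; simpa using norm_sub_norm_le (1 : ℂ) (x ^ (2 * n))
  have hyl2 : u ^ n - 1 ≤ ‖y‖ ^ 2 := by
    rw [hy, ← hxn, norm_sub_rev]; simpa using norm_sub_norm_le (x ^ (2 * n)) (1 : ℂ)
  have hT2 : 0 ≤ (n * ‖x‖ ^ (2 * n - 1)) ^ 2 / (1 + ‖y‖ ^ 2) ^ 2 := by positivity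
  have hT1 : 0 ≤ ‖y‖ ^ 2 / (1 + u) ^ 2 := by positivity
  have hcn : c * n ≤ 1 / 16 := by
    rw [hc, div_mul_eq_mul_div, one_mul, div_le_div_iff₀ (by positivity) (by norm_num)]
    have : (1 : ℝ) ≤ 2 ^ n * 4 ^ n * (2 + 2 ^ n) ^ 2 :=
      one_le_mul_of_one_le_of_one_le (one_le_mul_of_one_le_of_one_le h2n h4n)
        (one_le_pow₀ (by linarith))
    nlinarith
  have hc0 : 0 < c := by positivity
  rcases le_or_gt u (1 / 2) with h1 | h1
  · have hm := norm_mon_sq_le hn x le_rfl (h1.trans (by norm_num))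
    rw [one_pow, mul_one] at hm
    have hun : u ^ n ≤ 1 / 2 := (pow_le_of_le_one hu0 (by linarith) (by omega)).trans h1
    have : 2 / 9 ≤ ‖y‖ ^ 2 / (1 + u) ^ 2 := by
      rw [div_le_div_iff₀ (by norm_num) (by positivity)]
      nlinarith
    have := mul_le_mul_of_nonneg_left hm hc0.le
    linarith
  rcases le_or_gt 2 u with h2 | h2
  · have hm := norm_mon_sq_le hn x (by linarith) (le_refl u)
    have hun : 2 ≤ u ^ n := h2.trans (le_self_pow₀ (by linarith) (by omega))
    have hun2 : u ^ n = u ^ (n - 2) * u ^ 2 := by rw [← pow_add]; congr 1; omega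
    have hp : 0 < u ^ (n - 2) := by positivity
    have : 2 / 9 * u ^ (n - 2) ≤ ‖y‖ ^ 2 / (1 + u) ^ 2 := by
      rw [le_div_iff₀ (by positivity)]
      have h3 : (1 + u) ^ 2 ≤ 9 / 4 * u ^ 2 := by nlinarith
      have := mul_le_mul_of_nonneg_left h3 hp.le
      nlinarith
    have := mul_le_mul_of_nonneg_left hm hc0.le
    nlinarith
  · have hm := norm_mon_sq_le hn x (by norm_num) h2.le
    have h3 : u ^ n ≤ 2 ^ n := pow_le_pow_left₀ hu0 h2.le n
    have h4 : (n * ‖x‖ ^ (2 * n - 1)) ^ 2 = n ^ 2 * u ^ (2 * n - 1) := by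
      rw [hu, mul_pow, ← pow_mul, ← pow_mul, mul_comm (2 * n - 1) 2]
    have h5 : 1 / 4 ^ n ≤ u ^ (2 * n - 1) := by
      calc (1 : ℝ) / 4 ^ n = (1 / 2) ^ (2 * n) := by
            rw [pow_mul, ← one_div_pow]; norm_num
        _ ≤ (1 / 2) ^ (2 * n - 1) := pow_le_pow_of_le_one (by norm_num) (by norm_num) (by omega)
        _ ≤ _ := pow_le_pow_left₀ (by norm_num) h1.le _
    have h6 : 1 / 4 ^ n / (2 + 2 ^ n) ^ 2
        ≤ (n * ‖x‖ ^ (2 * n - 1)) ^ 2 / (1 + ‖y‖ ^ 2) ^ 2 := by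
      rw [h4]
      have h10 : 1 + ‖y‖ ^ 2 ≤ 2 + 2 ^ n := by linarith
      have h11 : (1 : ℝ) ≤ n ^ 2 := one_le_pow₀ hn1
      exact div_le_div₀ (by positivity) (by nlinarith [pow_nonneg hu0 (2 * n - 1)])
        (by positivity) (pow_le_pow_left₀ (by positivity) h10 2)
    have h7 : c * ‖mon n x‖ ^ 2 ≤ 1 / 16 * (1 / 4 ^ n / (2 + 2 ^ n) ^ 2) := by
      refine (mul_le_mul_of_nonneg_left hm hc0.le).trans ?_
      have h8 : (2 : ℝ) ^ (n - 2) ≤ 2 ^ n := pow_le_pow_right₀ (by norm_num) (by omega)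
      calc c * (n * 2 ^ (n - 2)) ≤ c * (n * 2 ^ n) := by gcongr
        _ = _ := by rw [hc]; field_simp
    have h9 : 0 < 1 / 4 ^ n / (2 + 2 ^ n : ℝ) ^ 2 := by positivity
    linarith

/-- The squared chordal distance on the Riemann sphere. -/
noncomputable def chord (z w : ℂ) : ℝ := ‖z - w‖ ^ 2 / ((1 + ‖z‖ ^ 2) * (1 + ‖w‖ ^ 2))

theorem norm_one_add_mul_conj_sq (z w : ℂ) : ‖1 + z * (starRingEnd ℂ) w‖ ^ 2
    = (1 + ‖z‖ ^ 2) * (1 + ‖w‖ ^ 2) * (1 - chord z w) := by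
  have h : (1 + ‖z‖ ^ 2) * (1 + ‖w‖ ^ 2) ≠ 0 := by positivity
  rw [chord, mul_sub, mul_one, mul_div_cancel₀ _ h]
  simp only [Complex.sq_norm, Complex.normSq_apply, Complex.add_re, Complex.add_im, Complex.mul_re,
    Complex.mul_im, Complex.conj_re, Complex.conj_im, Complex.sub_re, Complex.sub_im,
    Complex.one_re, Complex.one_im]
  ring

theorem norm_one_add_mul_conj_sq_le (z w : ℂ) : ‖1 + z * (starRingEnd ℂ) w‖ ^ 2
    ≤ (1 + ‖z‖ ^ 2) * (1 + ‖w‖ ^ 2) * Real.exp (-chord z w) := by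
  rw [norm_one_add_mul_conj_sq]
  gcongr
  linarith [Real.add_one_le_exp (-chord z w)]

theorem continuous_chord : Continuous fun p : ℂ × ℂ => chord p.1 p.2 := by
  unfold chord
  refine Continuous.div (by fun_prop) (by fun_prop) fun p => by positivity

/-- A holomorphic chart of the curve `y² = 1 - x^{2n}` together with the primitives `v` of the
differentials `x^j dx / y`. -/
structure Chart (n : ℕ) where
  dom : Set ℂ
  x : ℂ → ℂ
  y : ℂ → ℂ
  v : ℂ → EuclideanSpace ℂ (Fin (n - 1))
  τ : ℂ → ℂ
  isOpen_dom : IsOpen dom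
  curve : ∀ t ∈ dom, y t ^ 2 = 1 - x t ^ (2 * n)
  hasDerivAt_x : ∀ t ∈ dom, HasDerivAt x (y t * τ t) t
  hasDerivAt_y : ∀ t ∈ dom, HasDerivAt y (-(n * x t ^ (2 * n - 1) * τ t)) t
  hasDerivAt_v : ∀ t ∈ dom, HasDerivAt v (τ t • mon n (x t)) t
  τ_ne_zero : ∀ t ∈ dom, τ t ≠ 0

theorem tendsto_norm_slope_sq {E : Type*} [NormedAddCommGroup E] [NormedSpace ℂ E] {f : ℂ → E}
    {f' : E} {a : ℂ} (h : HasDerivAt f f' a) :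
    Tendsto (fun t => ‖f t - f a‖ ^ 2 / ‖t - a‖ ^ 2) (𝓝[≠] a) (𝓝 (‖f'‖ ^ 2)) := by
  have := ((hasDerivAt_iff_tendsto_slope.1 h).norm).pow 2
  refine this.congr fun t => ?_
  rw [slope_def_module, norm_smul, norm_inv, mul_pow, inv_pow]
  field_simp

namespace Chart

variable {n : ℕ} (c : Chart n)

/-- The excess of the chordal distances over the Euclidean distance. -/
noncomputable def excess (κ : ℝ) (t t₀ : ℂ) : ℝ :=
  chord (c.x t) (c.x t₀) + chord (c.y t) (c.y t₀) - κ * ‖c.v t - c.v t₀‖ ^ 2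

variable {c}

theorem eventually_excess_pos {κ : ℝ} (hκ : ∀ x y : ℂ, y ^ 2 = 1 - x ^ (2 * n) →
      κ * ‖mon n x‖ ^ 2
        < ‖y‖ ^ 2 / (1 + ‖x‖ ^ 2) ^ 2 + (n * ‖x‖ ^ (2 * n - 1)) ^ 2 / (1 + ‖y‖ ^ 2) ^ 2)
    {a : ℂ} (ha : a ∈ c.dom) : ∀ᶠ t in 𝓝[≠] a, 0 < c.excess κ t a := by
  have hx := tendsto_norm_slope_sq (c.hasDerivAt_x a ha)
  have hy := tendsto_norm_slope_sq (c.hasDerivAt_y a ha)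
  have hv := tendsto_norm_slope_sq (c.hasDerivAt_v a ha)
  have hN : ∀ {g : ℂ → ℂ}, ContinuousAt g a → Tendsto (fun t => (1 + ‖g t‖ ^ 2) * (1 + ‖g a‖ ^ 2))
      (𝓝[≠] a) (𝓝 ((1 + ‖g a‖ ^ 2) * (1 + ‖g a‖ ^ 2))) := fun hg =>
    (((hg.norm.pow 2).const_add 1).mul_const _).tendsto.mono_left nhdsWithin_le_nhds
  have hlim := ((hx.div (hN (c.hasDerivAt_x a ha).continuousAt) (by positivity)).add
    (hy.div (hN (c.hasDerivAt_y a ha).continuousAt) (by positivity))).sub (hv.const_mul κ)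
  have hpos : 0 < ‖c.y a * c.τ a‖ ^ 2 / ((1 + ‖c.x a‖ ^ 2) * (1 + ‖c.x a‖ ^ 2))
      + ‖-(n * c.x a ^ (2 * n - 1) * c.τ a)‖ ^ 2 / ((1 + ‖c.y a‖ ^ 2) * (1 + ‖c.y a‖ ^ 2))
      - κ * ‖c.τ a • mon n (c.x a)‖ ^ 2 := by
    have hτ : 0 < ‖c.τ a‖ ^ 2 := by have := norm_pos_iff.2 (c.τ_ne_zero a ha); positivity
    have := mul_lt_mul_of_pos_left (hκ _ _ (c.curve a ha)) hτ
    rw [← sub_pos] at this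
    refine this.trans_eq ?_
    simp only [norm_neg, norm_mul, norm_smul, norm_pow, Complex.norm_natCast]
    ring
  filter_upwards [hlim.eventually_const_lt hpos, self_mem_nhdsWithin] with t ht hta
  have h0 := norm_pos_iff.2 (sub_ne_zero.2 hta)
  have h1 : 0 < ‖t - a‖ ^ 2 := by positivity
  have := mul_pos ht h1
  refine this.trans_eq ?_
  unfold excess chord
  rw [Pi.div_apply, Pi.div_apply]
  field_simp

theorem eventually_x_ne_zero (hn : n ≠ 0) {a : ℂ} (ha : a ∈ c.dom) :
    ∀ᶠ t in 𝓝[≠] a, c.x t ≠ 0 := by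
  by_cases h0 : c.x a = 0
  · have hy : c.y a ≠ 0 := by
      intro hy
      have := c.curve a ha
      rw [hy, h0] at this
      simp [hn] at this
    have := (c.hasDerivAt_x a ha).eventually_ne (c := 0) (mul_ne_zero hy (c.τ_ne_zero a ha))
    exact this
  · exact ((c.hasDerivAt_x a ha).continuousAt.eventually_ne h0).filter_mono nhdsWithin_le_nhds

/-- A disc around `a` that is comparable to a disc around every point close to `a`. -/
theorem exists_disc (hn : n ≠ 0) {κ : ℝ} (hκ : ∀ x y : ℂ, y ^ 2 = 1 - x ^ (2 * n) →
      κ * ‖mon n x‖ ^ 2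
        < ‖y‖ ^ 2 / (1 + ‖x‖ ^ 2) ^ 2 + (n * ‖x‖ ^ (2 * n - 1)) ^ 2 / (1 + ‖y‖ ^ 2) ^ 2)
    {a : ℂ} (ha : a ∈ c.dom) {ρ₀ : ℝ} (hρ₀ : 0 < ρ₀) :
    ∃ ρ ∈ Ioo 0 ρ₀, closedBall a ρ ⊆ c.dom ∧ ∃ η > 0, ∀ᶠ t₀ in 𝓝 a, t₀ ∈ ball a ρ ∧
      ∀ t ∈ sphere a ρ, c.x t ≠ 0 ∧ ‖c.v t - c.v t₀‖ ≤ 1 ∧ η ≤ c.excess κ t t₀ := by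
  have hcont : ∀ t ∈ c.dom, ContinuousAt c.x t ∧ ContinuousAt c.y t ∧ ContinuousAt c.v t :=
    fun t ht => ⟨(c.hasDerivAt_x t ht).continuousAt, (c.hasDerivAt_y t ht).continuousAt,
      (c.hasDerivAt_v t ht).continuousAt⟩
  have hev : ∀ᶠ t in 𝓝[≠] a, 0 < c.excess κ t a ∧ c.x t ≠ 0 ∧ ‖c.v t - c.v a‖ < 1 ∧ t ∈ c.dom := by
    refine (eventually_excess_pos hκ ha).and ((eventually_x_ne_zero hn ha).and ?_)
    refine Filter.Eventually.filter_mono nhdsWithin_le_nhds ?_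
    refine Filter.Eventually.and ?_ (c.isOpen_dom.mem_nhds ha)
    have := ((hcont a ha).2.2.sub (continuousAt_const : ContinuousAt (fun _ => c.v a) a)).norm
    have h := this.tendsto.eventually_lt_const (u := 1) (by simp)
    exact h
  rw [eventually_nhdsWithin_iff, Metric.eventually_nhds_iff] at hev
  obtain ⟨ε, hε, hball⟩ := hev
  set ρ := min ε ρ₀ / 2 with hρ
  have hmin : 0 < min ε ρ₀ := lt_min hε hρ₀
  have hρ0 : 0 < ρ := by positivity
  have hρε : ρ < ε := by have := min_le_left ε ρ₀; linarith
  have hρρ : ρ < ρ₀ := by have := min_le_right ε ρ₀; linarith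
  have hsph : ∀ t ∈ sphere a ρ, 0 < c.excess κ t a ∧ c.x t ≠ 0 ∧ ‖c.v t - c.v a‖ < 1 ∧ t ∈ c.dom := by
    intro t ht
    have ht' : dist t a = ρ := ht
    refine hball (by rw [ht']; exact hρε) ?_
    rintro rfl
    simp at ht'
    linarith
  have hcb : closedBall a ρ ⊆ c.dom := by
    intro t ht
    by_cases h : t = a
    · rw [h]; exact ha
    · exact (hball (lt_of_le_of_lt ht hρε) h).2.2.2
  have hjoint : ∀ t ∈ sphere a ρ, ContinuousAt (fun z : ℂ × ℂ => c.excess κ z.2 z.1) (a, t) ∧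
      ContinuousAt (fun z : ℂ × ℂ => ‖c.v z.2 - c.v z.1‖) (a, t) := by
    intro t ht
    obtain ⟨h1, h2, h3⟩ := hcont a ha
    obtain ⟨h4, h5, h6⟩ := hcont t (hsph t ht).2.2.2
    have f : ∀ {E : Type} [TopologicalSpace E] {g : ℂ → E}, ContinuousAt g a →
        ContinuousAt (fun z : ℂ × ℂ => g z.1) (a, t) := fun hg =>
      ContinuousAt.comp (f := Prod.fst) (x := (a, t)) hg continuousAt_fst
    have s : ∀ {E : Type} [TopologicalSpace E] {g : ℂ → E}, ContinuousAt g t →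
        ContinuousAt (fun z : ℂ × ℂ => g z.2) (a, t) := fun hg =>
      ContinuousAt.comp (f := Prod.snd) (x := (a, t)) hg continuousAt_snd
    have hn3 := ((s h6).sub (f h3)).norm
    refine ⟨?_, hn3⟩
    have hx := continuous_chord.continuousAt.comp (x := (a, t)) ((s h4).prodMk (f h1))
    have hy := continuous_chord.continuousAt.comp (x := (a, t)) ((s h5).prodMk (f h2))
    exact (hx.add hy).sub ((hn3.pow 2).const_mul κ)
  have hsc : IsCompact (sphere a ρ) := isCompact_sphere a ρ
  have hcexc : ContinuousOn (fun t => c.excess κ t a) (sphere a ρ) := by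
    intro t ht
    have := (hjoint t ht).1.comp (f := fun t => (a, t)) (x := t) (by fun_prop)
    exact this.continuousWithinAt
  obtain ⟨η, hη, hηle⟩ : ∃ η > 0, ∀ t ∈ sphere a ρ, η < c.excess κ t a := by
    obtain ⟨m, hm, hmin⟩ := hsc.exists_isMinOn (NormedSpace.sphere_nonempty.2 hρ0.le) hcexc
    have := (hsph m hm).1
    exact ⟨_, half_pos this, fun t ht => (half_lt_self this).trans_le (hmin ht)⟩
  refine ⟨ρ, ⟨hρ0, hρρ⟩, hcb, η, hη, Filter.Eventually.and (ball_mem_nhds a hρ0) ?_⟩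
  refine hsc.eventually_forall_of_forall_eventually fun t ht => ?_
  obtain ⟨h1, h2⟩ := hjoint t ht
  have h3 := h1.tendsto.eventually_const_lt (hηle t ht)
  have h4 := h2.tendsto.eventually_lt_const (hsph t ht).2.2.1
  have h5 : ∀ᶠ z : ℂ × ℂ in 𝓝 (a, t), c.x z.2 ≠ 0 := by
    have := (hcont t (hsph t ht).2.2.2).1.comp (f := Prod.snd) (x := (a, t)) continuousAt_snd
    exact this.eventually_ne (hsph t ht).2.1
  filter_upwards [h3, h4, h5] with z z3 z4 z5 using ⟨z5, z4.le, z3.le⟩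

end Chart

end SphericalMetric

/-! ### Charts of the curve and its periods -/

section Surface

open Metric Set Filter Topology

theorem hasDerivAt_toLp {m : ℕ} {f : ℂ → Fin m → ℂ} {f' : Fin m → ℂ} {a : ℂ}
    (h : ∀ j, HasDerivAt (fun t => f t j) (f' j) a) :
    HasDerivAt (fun t => (WithLp.toLp 2 (f t) : EuclideanSpace ℂ (Fin m))) (WithLp.toLp 2 f') a :=
  ((PiLp.hasFDerivAt_toLp (𝕜 := ℂ) 2 (f a)).comp_hasDerivAt a (hasDerivAt_pi.2 h) :)

variable {n : ℕ}

/-- The vector of the integrals `∫ x^j dx / y`. -/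
noncomputable def abelVec (n : ℕ) (x : ℂ) : EuclideanSpace ℂ (Fin (n - 1)) :=
  WithLp.toLp 2 fun j => abelInt n j x

theorem unit_sq (ε : ℤˣ) : (((ε : ℤ) : ℂ)) ^ 2 = 1 := by
  rcases Int.units_eq_one_or ε with rfl | rfl <;> simp

theorem unit_ne_zero (ε : ℤˣ) : ((ε : ℤ) : ℂ) ≠ 0 := fun h => by
  have := unit_sq ε
  simp [h] at this

theorem norm_unit (ε : ℤˣ) : ‖((ε : ℤ) : ℂ)‖ = 1 := by
  rcases Int.units_eq_one_or ε with rfl | rfl <;> simp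

/-- The sheet over the slit plane. -/
noncomputable def sheet (n : ℕ) (ε : ℤˣ) : Chart n where
  dom := slit n
  x t := t
  y t := (ε : ℤ) * root n t
  v t := ((ε : ℤ) : ℂ) • abelVec n t
  τ t := (ε : ℤ) / root n t
  isOpen_dom := isOpen_slit
  curve t _ := by rw [mul_pow, unit_sq, one_mul, root_sq]
  hasDerivAt_x t ht := by
    refine (hasDerivAt_id t).congr_deriv ?_
    have := root_ne_zero ht
    field_simp
    exact (unit_sq ε).symm
  hasDerivAt_y t ht := by
    refine ((hasDerivAt_root ht).const_mul ((ε : ℤ) : ℂ)).congr_deriv ?_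
    ring
  hasDerivAt_v t ht := by
    have h : HasDerivAt (abelVec n) _ t := hasDerivAt_toLp fun j => hasDerivAt_abelInt j ht
    refine (h.const_smul ((ε : ℤ) : ℂ)).congr_deriv ?_
    ext j
    simp [mon]
    ring
  τ_ne_zero t ht := div_ne_zero (unit_ne_zero ε) (root_ne_zero ht)

/-- The standard primitive `2n`-th root of unity. -/
noncomputable def zeta (n : ℕ) : ℂ := Complex.exp (2 * Real.pi * Complex.I / (2 * n : ℕ))

theorem isPrimitiveRoot_zeta (hn : n ≠ 0) : IsPrimitiveRoot (zeta n) (2 * n) :=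
  Complex.isPrimitiveRoot_exp _ (by omega)

theorem zeta_pow_pow (hn : n ≠ 0) (k : ℕ) : (zeta n ^ k) ^ (2 * n) = 1 := by
  rw [← pow_mul, mul_comm, pow_mul, (isPrimitiveRoot_zeta hn).pow_eq_one, one_pow]

/-- The vector of integrals on the branch over the `y`-plane near a root of unity. -/
noncomputable def coabelVec (n k : ℕ) (y : ℂ) : EuclideanSpace ℂ (Fin (n - 1)) :=
  WithLp.toLp 2 fun j => zeta n ^ (k * (j + 1)) * coabelInt n j y

/-- The branch over the `y`-plane containing the `k`-th root of unity. -/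
noncomputable def branch (hn : n ≠ 0) (k : ℕ) : Chart n where
  dom := coslit
  x t := zeta n ^ k * coroot n t
  y t := t
  v t := coabelVec n k t
  τ t := -(zeta n ^ k / (n * coroot n t ^ (2 * n - 1)))
  isOpen_dom := isOpen_coslit
  curve t _ := by rw [mul_pow, zeta_pow_pow hn, one_mul, coroot_pow hn]; ring
  hasDerivAt_x t ht := by
    refine ((hasDerivAt_coroot hn ht).const_mul (zeta n ^ k)).congr_deriv ?_
    ring
  hasDerivAt_y t ht := by
    refine (hasDerivAt_id t).congr_deriv ?_
    have h1 := coroot_ne_zero hn ht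
    have h2 : (n : ℂ) ≠ 0 := Nat.cast_ne_zero.2 hn
    have h3 : (zeta n ^ k) ^ (2 * n - 1) * zeta n ^ k = 1 := by
      rw [← pow_succ, Nat.sub_add_cancel (by omega), zeta_pow_pow hn]
    rw [mul_pow]
    field_simp
    linear_combination -h3
  hasDerivAt_v t ht := by
    refine HasDerivAt.congr_deriv (hasDerivAt_toLp
      fun j => (hasDerivAt_coabelInt hn j ht).const_mul _) ?_
    ext j
    simp [mon]
    ring
  τ_ne_zero t ht := by
    have h1 := coroot_ne_zero hn ht
    have h2 : zeta n ≠ 0 := (isPrimitiveRoot_zeta hn).ne_zero (by omega)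
    have h3 : (n : ℂ) ≠ 0 := Nat.cast_ne_zero.2 hn
    simp [h1, h2, h3]

/-- The period vector attached to an integral combination of the slits. -/
noncomputable def period (n : ℕ) (m : Fin (2 * n) → ℤ) : EuclideanSpace ℂ (Fin (n - 1)) :=
  WithLp.toLp 2 fun j => 2 * realInt n j * ∑ k, m k * zeta n ^ ((k : ℕ) * (j + 1))

theorem period_add (m m' : Fin (2 * n) → ℤ) : period n (m + m') = period n m + period n m' := by
  ext j
  simp [period, ← mul_add, ← Finset.sum_add_distrib, add_mul]

theorem period_single (k : Fin (2 * n)) (j : Fin (n - 1)) :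
    period n (Pi.single k 1) j = 2 * realInt n j * zeta n ^ ((k : ℕ) * (j + 1)) := by
  simp only [period]
  rw [Finset.sum_eq_single k] <;> simp +contextual

/-- A point of the surface described by a chart, translated by the vector `l`. -/
def Chart.pt (c : Chart n) (l : EuclideanSpace ℂ (Fin (n - 1))) (t : ℂ) :
    ℂ × ℂ × EuclideanSpace ℂ (Fin (n - 1)) := (c.x t, c.y t, c.v t + l)

theorem branch_pt_of_re_pos (hn : n ≠ 0) (k : ℕ) (l : EuclideanSpace ℂ (Fin (n - 1))) {y : ℂ}
    (hy : y ∈ coslit) (hre : 0 < y.re) : zeta n ^ k * coroot n y ∈ slit n ∧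
      (branch hn k).pt l y = (sheet n 1).pt l (zeta n ^ k * coroot n y) := by
  refine ⟨(mul_mem_slit (zeta_pow_pow hn k)).2 (coroot_mem_slit hn hre), ?_⟩
  refine Prod.ext rfl (Prod.ext ?_ ?_)
  · simp [Chart.pt, branch, sheet, root_mul_of_pow_eq_one (zeta_pow_pow hn k), root_coroot hn hre]
  · simp only [Chart.pt, branch, sheet, add_left_inj]
    ext j
    simp [coabelVec, abelVec, abelInt_mul_of_pow_eq_one (zeta_pow_pow hn k),
      abelInt_coroot hn _ hy hre, pow_mul]

theorem neg_mem_coslit {y : ℂ} : -y ∈ coslit ↔ y ∈ coslit := by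
  simp [coslit]

theorem branch_pt_of_re_neg (hn : n ≠ 0) (k : Fin (2 * n)) (l : EuclideanSpace ℂ (Fin (n - 1)))
    {y : ℂ} (hy : y ∈ coslit) (hre : y.re < 0) : zeta n ^ (k : ℕ) * coroot n y ∈ slit n ∧
      (branch hn k).pt l y
        = (sheet n (-1)).pt (l + period n (Pi.single k 1)) (zeta n ^ (k : ℕ) * coroot n y) := by
  have hre' : 0 < (-y).re := by simpa using hre
  have hy' := neg_mem_coslit.2 hy
  have h1 := coroot_mem_slit hn hre'
  have h2 := root_coroot hn hre'
  have h3 := fun j => abelInt_coroot hn j hy' hre'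
  rw [coroot_neg] at h1 h2 h3
  refine ⟨(mul_mem_slit (zeta_pow_pow hn k)).2 h1, ?_⟩
  refine Prod.ext rfl (Prod.ext ?_ ?_)
  · simp [Chart.pt, branch, sheet, root_mul_of_pow_eq_one (zeta_pow_pow hn k), h2]
  · simp only [Chart.pt, branch, sheet]
    ext j
    simp only [PiLp.add_apply, period_single]
    simp [coabelVec, abelVec, abelInt_mul_of_pow_eq_one (zeta_pow_pow hn k), h3, coabelInt_neg,
      pow_mul]
    ring

theorem exists_eq_zeta_mul_coroot (hn : n ≠ 0) {x : ℂ} (hx : 0 < (x ^ (2 * n)).re) {y : ℂ}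
    (hy : y ^ 2 = 1 - x ^ (2 * n)) : y ∈ coslit ∧ ∃ k : Fin (2 * n),
      x = zeta n ^ (k : ℕ) * coroot n y := by
  have h1 : 1 - y ^ 2 = x ^ (2 * n) := by rw [hy]; ring
  have hmem : y ∈ coslit := by
    show 1 - y ^ 2 ∈ Complex.slitPlane
    rw [h1]; exact Or.inl hx
  refine ⟨hmem, ?_⟩
  have h0 := coroot_ne_zero hn hmem
  have h2 : (x / coroot n y) ^ (2 * n) = 1 := by
    rw [div_pow, coroot_pow hn, h1, div_self]
    intro h; rw [h] at hx; simp at hx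
  have : NeZero (2 * n) := ⟨by omega⟩
  obtain ⟨k, hk, hk'⟩ := (isPrimitiveRoot_zeta hn).eq_pow_of_pow_eq_one h2
  exact ⟨⟨k, hk⟩, by rw [hk']; field_simp⟩

/-- The surface swept out by the translates of the charts. -/
def surface (hn : n ≠ 0) : Set (ℂ × ℂ × EuclideanSpace ℂ (Fin (n - 1))) :=
  {p | (∃ ε m, ∃ t ∈ slit n, p = (sheet n ε).pt (period n m) t) ∨
    ∃ (k : Fin (2 * n)) (m : _), ∃ t ∈ coslit, p = (branch hn k).pt (period n m) t}

theorem exists_normal_form (hn : n ≠ 0) {p : ℂ × ℂ × EuclideanSpace ℂ (Fin (n - 1))}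
    (hp : p ∈ surface hn) :
    (∃ ε m, ∃ t, (t ^ (2 * n)).re ≤ 1 / 2 ∧ p = (sheet n ε).pt (period n m) t) ∨
    ∃ (k : Fin (2 * n)) (m : _), ∃ t : ℂ, 1 / 2 ≤ (1 - t ^ 2).re ∧
      p = (branch hn k).pt (period n m) t := by
  rcases hp with ⟨ε, m, t, ht, rfl⟩ | ⟨k, m, t, ht, rfl⟩
  · rcases le_or_gt (t ^ (2 * n)).re (1 / 2) with h | h
    · exact Or.inl ⟨ε, m, t, h, rfl⟩
    right
    obtain ⟨hc, k, hk⟩ := exists_eq_zeta_mul_coroot hn (x := t) (by linarith) (root_sq t)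
    have hre := root_re_pos ht
    have hle : 1 / 2 ≤ (1 - root n t ^ 2).re := by rw [root_sq, sub_sub_cancel]; exact h.le
    rcases Int.units_eq_one_or ε with rfl | rfl
    · refine ⟨k, m, root n t, hle, ?_⟩
      rw [(branch_pt_of_re_pos hn k (period n m) hc hre).2, ← hk]
    · refine ⟨k, m - Pi.single k 1, -root n t, by rwa [neg_sq], ?_⟩
      rw [(branch_pt_of_re_neg hn k _ (neg_mem_coslit.2 hc) (by simpa using hre)).2, ← period_add,
        coroot_neg, ← hk, sub_add_cancel]
  · rcases le_or_gt (1 / 2) (1 - t ^ 2).re with h | h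
    · exact Or.inr ⟨k, m, t, h, rfl⟩
    left
    have hx : ((zeta n ^ (k : ℕ) * coroot n t) ^ (2 * n)).re ≤ 1 / 2 := by
      rw [mul_pow, zeta_pow_pow hn, one_mul, coroot_pow hn]; exact h.le
    have hre : t.re ≠ 0 := by
      intro h0
      have : (t ^ 2).re = t.re ^ 2 - t.im ^ 2 := by simp [sq]
      rw [Complex.sub_re, this, h0, Complex.one_re] at h
      nlinarith [sq_nonneg t.im]
    rcases lt_or_gt_of_ne hre with h0 | h0
    · exact ⟨-1, m + Pi.single k 1, _, hx, by rw [(branch_pt_of_re_neg hn k _ ht h0).2, period_add]⟩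
    · exact ⟨1, m, _, hx, (branch_pt_of_re_pos hn k _ ht h0).2⟩

theorem pow_re_lt_half (hn : n ≠ 0) {x : ℂ} (hx : ‖x‖ ≤ 1 / 2) : (x ^ (2 * n)).re < 1 / 2 := by
  refine (Complex.re_le_norm _).trans_lt ?_
  rw [norm_pow]
  calc ‖x‖ ^ (2 * n) ≤ (1 / 2) ^ (2 * n) := by gcongr
    _ ≤ (1 / 2) ^ 2 := pow_le_pow_of_le_one (by norm_num) (by norm_num) (by omega)
    _ < 1 / 2 := by norm_num

theorem exists_sheet_of_norm_le (hn : n ≠ 0) {p : ℂ × ℂ × EuclideanSpace ℂ (Fin (n - 1))}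
    (hp : p ∈ surface hn) (h : ‖p.1‖ ≤ 1 / 2) :
    ∃ ε m, p = (sheet n ε).pt (period n m) p.1 := by
  rcases exists_normal_form hn hp with ⟨ε, m, t, ht, rfl⟩ | ⟨k, m, t, ht, rfl⟩
  · exact ⟨ε, m, rfl⟩
  · exfalso
    have := pow_re_lt_half hn h
    have hx : ((zeta n ^ (k : ℕ) * coroot n t) ^ (2 * n)) = 1 - t ^ 2 := by
      rw [mul_pow, zeta_pow_pow hn, one_mul, coroot_pow hn]
    change ((zeta n ^ (k : ℕ) * coroot n t) ^ (2 * n)).re < 1 / 2 at this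
    rw [hx] at this
    linarith

/-- A point is the centre of a disc, in the sense of subharmonicity, on whose boundary the chordal
distances exceed the Euclidean distance by `η`. -/
def Chart.Good (c : Chart n) (κ η : ℝ) (t₀ : ℂ) : Prop :=
  ∃ a ρ, 0 < ρ ∧ t₀ ∈ ball a ρ ∧ closedBall a ρ ⊆ c.dom ∧
    ((∀ t ∈ closedBall a ρ, c.x t ≠ 0) ∨ ∀ t ∈ closedBall a ρ, ‖c.x t‖ < 1 / 2) ∧
    ∀ t ∈ sphere a ρ, c.x t ≠ 0 ∧ ‖c.v t - c.v t₀‖ ≤ 1 ∧ η ≤ c.excess κ t t₀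

theorem Chart.Good.mono {c : Chart n} {κ η η' : ℝ} {t₀ : ℂ} (h : c.Good κ η t₀) (hη : η' ≤ η) :
    c.Good κ η' t₀ := by
  obtain ⟨a, ρ, h0, h1, h2, h3, h4⟩ := h
  exact ⟨a, ρ, h0, h1, h2, h3, fun t ht => ⟨(h4 t ht).1, (h4 t ht).2.1, hη.trans (h4 t ht).2.2⟩⟩

theorem Chart.eventually_good (hn : n ≠ 0) {c : Chart n} {κ : ℝ}
    (hκ : ∀ x y : ℂ, y ^ 2 = 1 - x ^ (2 * n) → κ * ‖mon n x‖ ^ 2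
        < ‖y‖ ^ 2 / (1 + ‖x‖ ^ 2) ^ 2 + (n * ‖x‖ ^ (2 * n - 1)) ^ 2 / (1 + ‖y‖ ^ 2) ^ 2)
    {a : ℂ} (ha : a ∈ c.dom) : ∃ η > 0, ∀ᶠ t₀ in 𝓝 a, c.Good κ η t₀ := by
  have hc := (c.hasDerivAt_x a ha).continuousAt
  obtain ⟨ρ₀, hρ₀, h⟩ : ∃ ρ₀ > 0, (∀ t ∈ ball a ρ₀, c.x t ≠ 0) ∨ ∀ t ∈ ball a ρ₀, ‖c.x t‖ < 1 / 2 := by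
    by_cases h0 : c.x a = 0
    · have : ∀ᶠ t in 𝓝 a, ‖c.x t‖ < 1 / 2 :=
        hc.norm.tendsto.eventually_lt_const (by simp [h0])
      obtain ⟨ρ, h1, h2⟩ := Metric.eventually_nhds_iff_ball.1 this
      exact ⟨ρ, h1, Or.inr h2⟩
    · obtain ⟨ρ, h1, h2⟩ := Metric.eventually_nhds_iff_ball.1 (hc.eventually_ne h0)
      exact ⟨ρ, h1, Or.inl h2⟩
  obtain ⟨ρ, ⟨h1, h2⟩, h3, η, hη, h4⟩ := Chart.exists_disc hn hκ ha hρ₀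
  have hs := closedBall_subset_ball (x := a) h2
  refine ⟨η, hη, h4.mono fun t₀ ht₀ => ⟨a, ρ, h1, ht₀.1, h3, ?_, ht₀.2⟩⟩
  exact h.imp (fun h t ht => h t (hs ht)) fun h t ht => h t (hs ht)

theorem Chart.exists_good_of_isCompact (hn : n ≠ 0) {c : Chart n} {κ : ℝ}
    (hκ : ∀ x y : ℂ, y ^ 2 = 1 - x ^ (2 * n) → κ * ‖mon n x‖ ^ 2
        < ‖y‖ ^ 2 / (1 + ‖x‖ ^ 2) ^ 2 + (n * ‖x‖ ^ (2 * n - 1)) ^ 2 / (1 + ‖y‖ ^ 2) ^ 2)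
    {s : Set ℂ} (hs : IsCompact s) (hsub : s ⊆ c.dom) : ∃ η > 0, ∀ t ∈ s, c.Good κ η t := by
  refine hs.induction_on (p := fun s => ∃ η > 0, ∀ t ∈ s, c.Good κ η t) ⟨1, one_pos, by simp⟩ ?_ ?_ ?_
  · rintro s t hst ⟨η, h0, h⟩
    exact ⟨η, h0, fun x hx => h x (hst hx)⟩
  · rintro s t ⟨η, h0, h⟩ ⟨η', h0', h'⟩
    refine ⟨min η η', lt_min h0 h0', fun x hx => ?_⟩
    rcases hx with hx | hx
    · exact (h x hx).mono (min_le_left _ _)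
    · exact (h' x hx).mono (min_le_right _ _)
  · intro x hx
    obtain ⟨η, h0, h⟩ := Chart.eventually_good hn hκ (hsub hx)
    exact ⟨_, mem_nhdsWithin_of_mem_nhds h, η, h0, fun t ht => ht⟩

theorem Chart.exists_good_family (hn : n ≠ 0) {ι : Type} [Finite ι] {c : ι → Chart n} {κ : ℝ}
    (hκ : ∀ x y : ℂ, y ^ 2 = 1 - x ^ (2 * n) → κ * ‖mon n x‖ ^ 2
        < ‖y‖ ^ 2 / (1 + ‖x‖ ^ 2) ^ 2 + (n * ‖x‖ ^ (2 * n - 1)) ^ 2 / (1 + ‖y‖ ^ 2) ^ 2)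
    {s : Set ℂ} (hs : IsCompact s) (hsub : ∀ i, s ⊆ (c i).dom) :
    ∃ η > 0, ∀ i, ∀ t ∈ s, (c i).Good κ η t := by
  choose η h0 h using fun i => Chart.exists_good_of_isCompact hn hκ hs (hsub i)
  rcases isEmpty_or_nonempty ι with hι | hι
  · exact ⟨1, one_pos, fun i => isEmptyElim i⟩
  obtain ⟨i₀, hi₀⟩ := Finite.exists_min η
  exact ⟨η i₀, h0 i₀, fun i t ht => (h i t ht).mono (hi₀ i)⟩

theorem exists_uniform_good (hn : n ≠ 0) {κ : ℝ}
    (hκ : ∀ x y : ℂ, y ^ 2 = 1 - x ^ (2 * n) → κ * ‖mon n x‖ ^ 2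
        < ‖y‖ ^ 2 / (1 + ‖x‖ ^ 2) ^ 2 + (n * ‖x‖ ^ (2 * n - 1)) ^ 2 / (1 + ‖y‖ ^ 2) ^ 2) (A : ℝ) :
    ∃ η > 0, ∀ p ∈ surface hn, ‖p.1‖ ≤ A → ∃ (c : Chart n) (m : _) (t : ℂ),
      ((∃ ε, c = sheet n ε) ∨ ∃ k : Fin (2 * n), c = branch hn k) ∧
      p = c.pt (period n m) t ∧ c.Good κ η t := by
  have hKU : IsCompact {t : ℂ | ‖t‖ ≤ A ∧ (t ^ (2 * n)).re ≤ 1 / 2} := by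
    refine isCompact_of_isClosed_isBounded ?_ ?_
    · exact (isClosed_le (f := fun t : ℂ => ‖t‖) (by fun_prop) continuous_const).inter
        (isClosed_le (Complex.continuous_re.comp (continuous_pow (2 * n))) continuous_const)
    · exact isBounded_iff_forall_norm_le.2 ⟨A, fun t ht => ht.1⟩
  have hKY : IsCompact {t : ℂ | ‖1 - t ^ 2‖ ≤ A ^ (2 * n) ∧ 1 / 2 ≤ (1 - t ^ 2).re} := by
    refine isCompact_of_isClosed_isBounded ?_ ?_
    · have hc : Continuous fun t : ℂ => 1 - t ^ 2 := by fun_prop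
      exact (isClosed_le hc.norm continuous_const).inter
        (isClosed_le continuous_const (Complex.continuous_re.comp hc))
    · refine isBounded_iff_forall_norm_le.2 ⟨2 + A ^ (2 * n), fun t ht => ?_⟩
      have h1 := norm_sub_norm_le (t ^ 2) 1
      rw [norm_sub_rev, norm_one, norm_pow] at h1
      nlinarith [ht.1, sq_nonneg (‖t‖ - 1), norm_nonneg t]
  obtain ⟨η, h0, h⟩ := Chart.exists_good_family hn (c := sheet n) hκ hKU fun ε t ht =>
    mem_slit_of_re_lt (ht.2.trans_lt (by norm_num))
  obtain ⟨η', h0', h'⟩ := Chart.exists_good_family hn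
    (c := fun k : Fin (2 * n) => branch hn k) hκ hKY fun k t ht => Or.inl (by linarith [ht.2])
  refine ⟨min η η', lt_min h0 h0', fun p hp hA => ?_⟩
  rcases exists_normal_form hn hp with ⟨ε, m, t, ht, rfl⟩ | ⟨k, m, t, ht, rfl⟩
  · exact ⟨_, m, t, Or.inl ⟨ε, rfl⟩, rfl, (h ε t ⟨hA, ht⟩).mono (min_le_left _ _)⟩
  · refine ⟨_, m, t, Or.inr ⟨k, rfl⟩, rfl, (h' k t ⟨?_, ht⟩).mono (min_le_right _ _)⟩
    have hx : ((zeta n ^ (k : ℕ) * coroot n t) ^ (2 * n)) = 1 - t ^ 2 := by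
      rw [mul_pow, zeta_pow_pow hn, one_mul, coroot_pow hn]
    rw [← hx, norm_pow]
    exact pow_le_pow_left₀ (norm_nonneg _) hA _

end Surface

/-! ### Subharmonicity on the charts -/

section Subharmonicity

open Metric Set Filter Topology

variable {n : ℕ}

/-- The value of `F(x, y v_i)` at a point `(x, y, v)`. -/
def val (F : ℂ → ℂ → ℂ) (i : Fin (n - 1)) (p : ℂ × ℂ × EuclideanSpace ℂ (Fin (n - 1))) : ℂ :=
  F p.1 (p.2.1 * p.2.2 i)

/-- The conformal factor of the product of two spherical metrics. -/
noncomputable def sph (p : ℂ × ℂ × EuclideanSpace ℂ (Fin (n - 1))) : ℝ :=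
  (1 + ‖p.1‖ ^ 2) * (1 + ‖p.2.1‖ ^ 2)

/-- The weighted absolute value of `F(x, y v_i) / x^T`. -/
noncomputable def wt (F : ℂ → ℂ → ℂ) (i : Fin (n - 1)) (S T : ℕ) (κ : ℝ)
    (l₀ : EuclideanSpace ℂ (Fin (n - 1))) (p : ℂ × ℂ × EuclideanSpace ℂ (Fin (n - 1))) : ℝ :=
  ‖val F i p‖ / ‖p.1‖ ^ T * sph p ^ S * Real.exp (-(κ * ‖p.2.2 - l₀‖ ^ 2))

theorem sph_pos (p : ℂ × ℂ × EuclideanSpace ℂ (Fin (n - 1))) : 0 < sph p := by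
  unfold sph; positivity

theorem norm_one_add_mul_conj_self (z : ℂ) : ‖1 + z * (starRingEnd ℂ) z‖ = 1 + ‖z‖ ^ 2 := by
  rw [Complex.mul_conj, Complex.normSq_eq_norm_sq]
  have : (1 : ℂ) + ((‖z‖ ^ 2 : ℝ) : ℂ) = ((1 + ‖z‖ ^ 2 : ℝ) : ℂ) := by push_cast; rfl
  rw [this, Complex.norm_real, Real.norm_of_nonneg (by positivity)]

theorem differentiableOn_val {F : ℂ → ℂ → ℂ} (hF : Differentiable ℂ fun p : ℂ × ℂ => F p.1 p.2)
    (c : Chart n) (l : EuclideanSpace ℂ (Fin (n - 1))) (i : Fin (n - 1)) :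
    DifferentiableOn ℂ (fun t => val F i (c.pt l t)) c.dom := by
  intro t ht
  refine DifferentiableAt.differentiableWithinAt ?_
  have h1 : DifferentiableAt ℂ (fun t => (c.v t + l) i) t :=
    differentiableAt_piLp 2 |>.1 ((c.hasDerivAt_v t ht).differentiableAt.add_const l) i
  have h2 := (c.hasDerivAt_x t ht).differentiableAt.prodMk
    ((c.hasDerivAt_y t ht).differentiableAt.mul h1)
  exact (hF.differentiableAt (x := _)).comp t h2

theorem exists_wt_le {F : ℂ → ℂ → ℂ} (hF : Differentiable ℂ fun p : ℂ × ℂ => F p.1 p.2)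
    (c : Chart n) {κ η : ℝ} {t₀ : ℂ} (hgood : c.Good κ η t₀)
    (l l₀ : EuclideanSpace ℂ (Fin (n - 1))) (i : Fin (n - 1)) (S T : ℕ) (hx₀ : c.x t₀ ≠ 0)
    (hdiv : ‖c.x t₀‖ < 1 / 2 → ∃ G : ℂ → ℂ, DifferentiableOn ℂ G (c.dom ∩ {t | ‖c.x t‖ < 1 / 2}) ∧
      ∀ t ∈ c.dom ∩ {t | ‖c.x t‖ < 1 / 2}, val F i (c.pt l t) = c.x t ^ T * G t) :
    ∃ t ∈ c.dom, c.x t ≠ 0 ∧ ‖c.v t - c.v t₀‖ ≤ 1 ∧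
      wt F i S T (κ * S) l₀ (c.pt l t₀)
        ≤ Real.exp (-(η * S)) * wt F i S T (κ * S) l₀ (c.pt l t) := by
  obtain ⟨a, ρ, hρ, ht₀, hsub, hx, hsph⟩ := hgood
  obtain ⟨G, U, hU, hG, hGe⟩ : ∃ (G : ℂ → ℂ) (U : Set ℂ), closedBall a ρ ⊆ U ∩ c.dom ∧
      DifferentiableOn ℂ G U ∧ ∀ t ∈ U, c.x t ≠ 0 → ‖G t‖ = ‖val F i (c.pt l t)‖ / ‖c.x t‖ ^ T := by
    rcases hx with hx | hx
    · refine ⟨fun t => val F i (c.pt l t) / c.x t ^ T, closedBall a ρ, fun t ht => ⟨ht, hsub ht⟩,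
        ?_, fun t _ _ => by rw [norm_div, norm_pow]⟩
      refine ((differentiableOn_val hF c l i).mono hsub).div ?_ fun t ht => pow_ne_zero _ (hx t ht)
      exact DifferentiableOn.pow (fun t ht =>
        (c.hasDerivAt_x t (hsub ht)).differentiableAt.differentiableWithinAt) _
    · obtain ⟨G, hG, hGe⟩ := hdiv (hx t₀ (ball_subset_closedBall ht₀))
      refine ⟨G, c.dom ∩ {t | ‖c.x t‖ < 1 / 2}, fun t ht => ⟨⟨hsub ht, hx t ht⟩, hsub ht⟩, hG, fun t ht h0 => ?_⟩
      rw [hGe t ht, norm_mul, norm_pow]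
      have := norm_pos_iff.2 h0
      field_simp
  have hUs : closedBall a ρ ⊆ U := fun t ht => (hU ht).1
  set u₀ := c.v t₀ + l - l₀ with hu₀
  let H : ℂ → ℂ := fun t => G t * (1 + c.x t * (starRingEnd ℂ) (c.x t₀)) ^ (2 * S)
    * (1 + c.y t * (starRingEnd ℂ) (c.y t₀)) ^ (2 * S)
    * Complex.exp (-(2 * (κ * S : ℝ)) * inner ℂ u₀ (c.v t - c.v t₀))
  have hH : DifferentiableOn ℂ H (closedBall a ρ) := by
    have h1 : DifferentiableOn ℂ c.x (closedBall a ρ) := fun t ht =>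
      (c.hasDerivAt_x t (hsub ht)).differentiableAt.differentiableWithinAt
    have h2 : DifferentiableOn ℂ c.y (closedBall a ρ) := fun t ht =>
      (c.hasDerivAt_y t (hsub ht)).differentiableAt.differentiableWithinAt
    have h3 : DifferentiableOn ℂ c.v (closedBall a ρ) := fun t ht =>
      (c.hasDerivAt_v t (hsub ht)).differentiableAt.differentiableWithinAt
    have h4 : DifferentiableOn ℂ (fun t => inner ℂ u₀ (c.v t - c.v t₀)) (closedBall a ρ) :=
      ((innerSL ℂ u₀).differentiable.comp_differentiableOn (h3.sub_const (c.v t₀)) :)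
    exact (((hG.mono hUs).mul (((h1.mul_const _).const_add _).pow _)).mul
      (((h2.mul_const _).const_add _).pow _)).mul ((h4.const_mul _).cexp)
  have hcl : closure (ball a ρ) = closedBall a ρ := closure_ball a hρ.ne'
  obtain ⟨z, hz, hmax⟩ := Complex.exists_mem_frontier_isMaxOn_norm (isBounded_ball)
    (nonempty_ball.2 hρ) (DifferentiableOn.diffContOnCl (hcl ▸ hH))
  rw [frontier_ball a hρ.ne'] at hz
  obtain ⟨hxz, hvz, hηz⟩ := hsph z hz
  have hzc : z ∈ closedBall a ρ := sphere_subset_closedBall hz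
  have ht₀c : t₀ ∈ closedBall a ρ := ball_subset_closedBall ht₀
  refine ⟨z, hsub hzc, hxz, hvz, ?_⟩
  have hle : ‖H t₀‖ ≤ ‖H z‖ := hmax (hcl ▸ ht₀c)
  set N₀ := sph (c.pt l t₀) with hN₀
  set N := sph (c.pt l z) with hN
  have hN₀pos : 0 < N₀ := sph_pos _
  have hNpos : 0 < N := sph_pos _
  have e₀ : ‖H t₀‖ = ‖G t₀‖ * N₀ ^ S * N₀ ^ S := by
    simp only [H, norm_mul, norm_pow, norm_one_add_mul_conj_self, sub_self, inner_zero_right,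
      mul_zero, Complex.exp_zero, mul_one, hN₀, sph, Chart.pt]
    generalize 1 + ‖c.x t₀‖ ^ 2 = P
    generalize 1 + ‖c.y t₀‖ ^ 2 = Q
    ring
  have e₁ : ‖H z‖ ≤ ‖G z‖ * N ^ S * N₀ ^ S * (Real.exp (-(S * (chord (c.x z) (c.x t₀)
      + chord (c.y z) (c.y t₀)))) * Real.exp (-(2 * (κ * S) * (inner ℂ u₀ (c.v z - c.v t₀)).re))) := by
    have h1 := pow_le_pow_left₀ (by positivity) (norm_one_add_mul_conj_sq_le (c.x z) (c.x t₀)) S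
    have h2 := pow_le_pow_left₀ (by positivity) (norm_one_add_mul_conj_sq_le (c.y z) (c.y t₀)) S
    have h3 : ‖Complex.exp (-(2 * (κ * S : ℝ)) * inner ℂ u₀ (c.v z - c.v t₀))‖
        = Real.exp (-(2 * (κ * S) * (inner ℂ u₀ (c.v z - c.v t₀)).re)) := by
      rw [Complex.norm_exp]
      congr 1
      have : (-(2 * ((κ * S : ℝ) : ℂ))) = ((-(2 * (κ * S)) : ℝ) : ℂ) := by push_cast; rfl
      rw [this, Complex.re_ofReal_mul]
      ring
    simp only [H, norm_mul, norm_pow]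
    rw [h3, pow_mul, pow_mul, mul_assoc ‖G z‖]
    calc _ ≤ ‖G z‖ * (((1 + ‖c.x z‖ ^ 2) * (1 + ‖c.x t₀‖ ^ 2) * Real.exp (-chord (c.x z) (c.x t₀))) ^ S
          * ((1 + ‖c.y z‖ ^ 2) * (1 + ‖c.y t₀‖ ^ 2) * Real.exp (-chord (c.y z) (c.y t₀))) ^ S) * _ := by
          gcongr
      _ = _ := by
          have : Real.exp (-(S * (chord (c.x z) (c.x t₀) + chord (c.y z) (c.y t₀))))
              = Real.exp (-chord (c.x z) (c.x t₀)) ^ S * Real.exp (-chord (c.y z) (c.y t₀)) ^ S := by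
            rw [← Real.exp_nat_mul, ← Real.exp_nat_mul, ← Real.exp_add]
            congr 1; ring
          rw [this]
          simp only [hN, hN₀, sph, Chart.pt]
          generalize 1 + ‖c.x t₀‖ ^ 2 = P
          generalize 1 + ‖c.y t₀‖ ^ 2 = Q
          generalize 1 + ‖c.x z‖ ^ 2 = P'
          generalize 1 + ‖c.y z‖ ^ 2 = Q'
          ring
  have e₂ : ‖G t₀‖ * N₀ ^ S ≤ ‖G z‖ * N ^ S * (Real.exp (-(S * (chord (c.x z) (c.x t₀)
      + chord (c.y z) (c.y t₀)))) * Real.exp (-(2 * (κ * S) * (inner ℂ u₀ (c.v z - c.v t₀)).re))) := by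
    have h := (e₀ ▸ hle).trans e₁
    refine le_of_mul_le_mul_right (a := N₀ ^ S) (h.trans_eq (by ring)) (by positivity)
  have hnorm : ‖c.v z + l - l₀‖ ^ 2
      = ‖u₀‖ ^ 2 + 2 * (inner ℂ u₀ (c.v z - c.v t₀)).re + ‖c.v z - c.v t₀‖ ^ 2 := by
    have := norm_add_sq (𝕜 := ℂ) u₀ (c.v z - c.v t₀)
    rw [← RCLike.re_eq_complex_re, ← this, hu₀]
    congr 2; abel
  have hS : (0 : ℝ) ≤ S := Nat.cast_nonneg S
  have hwt₀ : wt F i S T (κ * S) l₀ (c.pt l t₀)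
      = ‖G t₀‖ * N₀ ^ S * Real.exp (-(κ * S * ‖u₀‖ ^ 2)) := by
    rw [hGe t₀ (hUs ht₀c) hx₀]; rfl
  have hwt : wt F i S T (κ * S) l₀ (c.pt l z)
      = ‖G z‖ * N ^ S * Real.exp (-(κ * S * ‖c.v z + l - l₀‖ ^ 2)) := by
    rw [hGe z (hUs hzc) hxz]; rfl
  rw [hwt₀, hwt]
  refine (mul_le_mul_of_nonneg_right e₂ (Real.exp_pos _).le).trans ?_
  rw [mul_assoc, ← Real.exp_add, ← Real.exp_add, mul_left_comm (Real.exp (-(η * S))),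
    ← Real.exp_add]
  refine mul_le_mul_of_nonneg_left (Real.exp_le_exp.2 ?_) (by positivity)
  have := mul_le_mul_of_nonneg_left hηz hS
  rw [Chart.excess] at this
  rw [hnorm]
  nlinarith

end Subharmonicity

/-! ### The maximum principle with a Gaussian weight -/

section GaussianBound

open Metric Set Filter Topology

variable {n : ℕ}

theorem sheet_mem_surface (hn : n ≠ 0) (ε : ℤˣ) (m : Fin (2 * n) → ℤ) {t : ℂ} (ht : t ∈ slit n) :
    (sheet n ε).pt (period n m) t ∈ surface hn := Or.inl ⟨ε, m, t, ht, rfl⟩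

theorem branch_mem_surface (hn : n ≠ 0) (k : Fin (2 * n)) (m : Fin (2 * n) → ℤ) {t : ℂ}
    (ht : t ∈ coslit) : (branch hn k).pt (period n m) t ∈ surface hn := Or.inr ⟨k, m, t, ht, rfl⟩

theorem surface_curve (hn : n ≠ 0) {p : ℂ × ℂ × EuclideanSpace ℂ (Fin (n - 1))}
    (hp : p ∈ surface hn) : p.2.1 ^ 2 = 1 - p.1 ^ (2 * n) := by
  rcases hp with ⟨ε, m, t, ht, rfl⟩ | ⟨k, m, t, ht, rfl⟩
  · exact (sheet n ε).curve t ht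
  · exact (branch hn k).curve t ht

theorem norm_y_le {x y : ℂ} (h : y ^ 2 = 1 - x ^ (2 * n)) : ‖y‖ ≤ 2 * max 1 ‖x‖ ^ n := by
  have h1 : (1 : ℝ) ≤ max 1 ‖x‖ := le_max_left _ _
  have h2 : ‖y‖ ^ 2 ≤ 1 + ‖x‖ ^ (2 * n) := by
    rw [← norm_pow, h, ← norm_pow]
    simpa using norm_sub_le (1 : ℂ) (x ^ (2 * n))
  have h3 : ‖x‖ ^ (2 * n) ≤ (max 1 ‖x‖ ^ n) ^ 2 := by
    rw [← pow_mul, mul_comm n]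
    exact pow_le_pow_left₀ (norm_nonneg _) (le_max_right _ _) _
  have h4 : 1 ≤ max 1 ‖x‖ ^ n := one_le_pow₀ h1
  refine le_of_sq_le_sq ?_ (by positivity)
  nlinarith

/-- A polynomial growth condition. -/
def PolyBound (F : ℂ → ℂ → ℂ) (C : ℝ) (D L : ℕ) : Prop :=
  ∀ x w, ‖F x w‖ ≤ C * max 1 ‖x‖ ^ D * (1 + ‖w‖) ^ L

theorem norm_val_le (hn : n ≠ 0) {F : ℂ → ℂ → ℂ} {C : ℝ} {D L : ℕ} (hC : 0 ≤ C)
    (hb : PolyBound F C D L) (i : Fin (n - 1)) {p : ℂ × ℂ × EuclideanSpace ℂ (Fin (n - 1))}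
    (hp : p ∈ surface hn) {R : ℝ} (hR : ‖p.2.2‖ ≤ R) :
    ‖val F i p‖ ≤ C * (1 + 2 * R) ^ L * max 1 ‖p.1‖ ^ (D + n * L) := by
  have h1 : (1 : ℝ) ≤ max 1 ‖p.1‖ ^ n := one_le_pow₀ (le_max_left _ _)
  have h2 := norm_y_le (surface_curve hn hp)
  have h3 : ‖p.2.2 i‖ ≤ R := (PiLp.norm_apply_le p.2.2 i).trans hR
  have h0 : 0 ≤ R := (norm_nonneg _).trans hR
  have h4 : 1 + ‖p.2.1 * p.2.2 i‖ ≤ (1 + 2 * R) * max 1 ‖p.1‖ ^ n := by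
    rw [norm_mul]
    have := mul_le_mul h2 h3 (norm_nonneg _) (by positivity)
    nlinarith
  calc ‖val F i p‖ ≤ C * max 1 ‖p.1‖ ^ D * (1 + ‖p.2.1 * p.2.2 i‖) ^ L := hb _ _
    _ ≤ C * max 1 ‖p.1‖ ^ D * ((1 + 2 * R) * max 1 ‖p.1‖ ^ n) ^ L := by gcongr
    _ = _ := by rw [mul_pow, pow_add, pow_mul]; ring

theorem sph_le (hn : n ≠ 0) {p : ℂ × ℂ × EuclideanSpace ℂ (Fin (n - 1))}
    (hp : p ∈ surface hn) : sph p ≤ 10 * max 1 ‖p.1‖ ^ (2 * (n + 1)) := by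
  have h0 : (1 : ℝ) ≤ max 1 ‖p.1‖ := le_max_left _ _
  have h1 : (1 : ℝ) ≤ max 1 ‖p.1‖ ^ n := one_le_pow₀ h0
  have h2 := norm_y_le (surface_curve hn hp)
  have h3 : 1 + ‖p.1‖ ^ 2 ≤ 2 * max 1 ‖p.1‖ ^ 2 := by
    have := pow_le_pow_left₀ (norm_nonneg _) (le_max_right 1 ‖p.1‖) 2
    nlinarith
  have h4 : 1 + ‖p.2.1‖ ^ 2 ≤ 5 * (max 1 ‖p.1‖ ^ n) ^ 2 := by
    have := pow_le_pow_left₀ (norm_nonneg _) h2 2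
    nlinarith
  calc sph p ≤ (2 * max 1 ‖p.1‖ ^ 2) * (5 * (max 1 ‖p.1‖ ^ n) ^ 2) :=
        mul_le_mul h3 h4 (by positivity) (by positivity)
    _ = _ := by ring

/-- Uniform a priori bound for the weighted quotient. -/
theorem wt_le (hn : n ≠ 0) {F : ℂ → ℂ → ℂ} {C : ℝ} {D L : ℕ} (hC : 0 ≤ C)
    (hb : PolyBound F C D L) (i : Fin (n - 1)) {S T : ℕ} (κ : ℝ) (hST : D + n * L + 2 * (n + 1) * S + 1 ≤ T)
    {B : ℝ} (hB : ∀ x : ℂ, ‖x‖ ≤ 1 / 2 → ‖abelVec n x‖ ≤ B)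
    {l₀ : EuclideanSpace ℂ (Fin (n - 1))} {r : ℝ}
    (hvan : ∀ (ε : ℤˣ) (m : Fin (2 * n) → ℤ), ‖period n m - l₀‖ ≤ r + 1 + B →
      VanishesTo T fun x => val F i ((sheet n ε).pt (period n m) x))
    {p : ℂ × ℂ × EuclideanSpace ℂ (Fin (n - 1))} (hp : p ∈ surface hn) (hx : p.1 ≠ 0)
    (hv : ‖p.2.2 - l₀‖ ≤ r + 1) :
    wt F i S T κ l₀ p ≤ C * 20 ^ T * (1 + 2 * (r + 1 + ‖l₀‖ + 2 * B)) ^ L / max 1 ‖p.1‖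
      * Real.exp (-(κ * ‖p.2.2 - l₀‖ ^ 2)) := by
  unfold wt
  refine mul_le_mul_of_nonneg_right ?_ (Real.exp_pos _).le
  set X := max 1 ‖p.1‖ with hX
  set R := r + 1 + ‖l₀‖ + 2 * B with hR
  have hX1 : 1 ≤ X := le_max_left _ _
  have hX0 : 0 < X := by linarith
  have hB0 : 0 ≤ B := (norm_nonneg _).trans (hB 0 (by simp))
  have hvR : ‖p.2.2‖ ≤ r + 1 + ‖l₀‖ := by
    have := norm_sub_norm_le p.2.2 l₀; linarith
  have hR0 : 0 ≤ R := by have := norm_nonneg p.2.2; linarith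
  have hquot : ‖val F i p‖ / ‖p.1‖ ^ T ≤ C * 2 ^ T * (1 + 2 * R) ^ L * X ^ (D + n * L) / X ^ T := by
    rcases le_or_gt (1 / 2) ‖p.1‖ with h | h
    · have hXx : X ≤ 2 * ‖p.1‖ := max_le (by linarith) (by linarith [norm_nonneg p.1])
      have h1 := norm_val_le hn hC hb i hp (R := R) (by linarith)
      have h2 : X ^ T ≤ 2 ^ T * ‖p.1‖ ^ T := by rw [← mul_pow]; gcongr
      have hxp : 0 < ‖p.1‖ ^ T := pow_pos (norm_pos_iff.2 hx) T
      rw [div_le_div_iff₀ hxp (by positivity)]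
      calc ‖val F i p‖ * X ^ T ≤ (C * (1 + 2 * R) ^ L * X ^ (D + n * L)) * (2 ^ T * ‖p.1‖ ^ T) :=
            mul_le_mul h1 h2 (by positivity) (by positivity)
        _ = _ := by ring
    · have hXe : X = 1 := max_eq_left (by linarith)
      obtain ⟨ε, m, hpe⟩ := exists_sheet_of_norm_le hn hp h.le
      have hv2 : p.2.2 = ((ε : ℤ) : ℂ) • abelVec n p.1 + period n m := congrArg (fun q => q.2.2) hpe
      have hm : ‖period n m - l₀‖ ≤ r + 1 + B := by
        have : period n m - l₀ = (p.2.2 - l₀) - ((ε : ℤ) : ℂ) • abelVec n p.1 := by rw [hv2]; abel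
        rw [this]
        refine (norm_sub_le _ _).trans ?_
        rw [norm_smul, norm_unit, one_mul]
        linarith [hB p.1 h.le]
      obtain ⟨G, hG, hGe⟩ := hvan ε m hm
      dsimp only at hGe
      have hGb : ‖G p.1‖ ≤ C * 2 ^ T * (1 + 2 * R) ^ L := by
        have hsub : closedBall (0 : ℂ) (1 / 2) ⊆ ball 0 1 := closedBall_subset_ball (by norm_num)
        refine Complex.norm_le_of_forall_mem_frontier_norm_le (isBounded_ball (x := 0) (r := 1 / 2))
          (hG.diffContOnCl_ball hsub) ?_ (subset_closure (by simpa using h))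
        intro z hz
        rw [frontier_ball _ (by norm_num)] at hz
        have hz' : ‖z‖ = 1 / 2 := by simpa using hz
        have hz1 : z ∈ ball (0 : ℂ) 1 := hsub (sphere_subset_closedBall hz)
        have hmem := sheet_mem_surface hn ε m (ball_subset_slit hn hz1)
        have hnv : ‖((sheet n ε).pt (period n m) z).2.2‖ ≤ R := by
          refine (norm_add_le _ _).trans ?_
          have h1 : ‖((ε : ℤ) : ℂ) • abelVec n z‖ ≤ B := by
            rw [norm_smul, norm_unit, one_mul]; exact hB z hz'.le
          have h2 := norm_sub_norm_le (period n m) l₀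
          have h3 : ‖(sheet n ε).v z‖ ≤ B := h1
          linarith
        have h1 := norm_val_le hn hC hb i hmem hnv
        have h2 : max 1 ‖((sheet n ε).pt (period n m) z).1‖ = 1 := by
          refine max_eq_left ?_
          change ‖z‖ ≤ 1
          linarith
        rw [h2, one_pow, mul_one, hGe z hz1, norm_mul, norm_pow, hz'] at h1
        have h3 : (2 : ℝ) ^ T * (1 / 2) ^ T = 1 := by rw [← mul_pow]; norm_num
        calc ‖G z‖ = 2 ^ T * ((1 / 2) ^ T * ‖G z‖) := by rw [← mul_assoc, h3, one_mul]
          _ ≤ 2 ^ T * (C * (1 + 2 * R) ^ L) := by gcongr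
          _ = _ := by ring
      have hval : ‖val F i p‖ = ‖p.1‖ ^ T * ‖G p.1‖ := by
        rw [← norm_pow, ← norm_mul, ← hGe p.1 (by simp; linarith), ← hpe]
      rw [hval, hXe, mul_div_cancel_left₀ _ (pow_ne_zero _ (norm_ne_zero_iff.2 hx))]
      simpa using hGb
  have hsph : sph p ^ S ≤ 10 ^ T * X ^ (2 * (n + 1) * S) := by
    calc sph p ^ S ≤ (10 * X ^ (2 * (n + 1))) ^ S := pow_le_pow_left₀ (sph_pos p).le (sph_le hn hp) S
      _ = 10 ^ S * X ^ (2 * (n + 1) * S) := by rw [mul_pow, ← pow_mul]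
      _ ≤ _ := by
        gcongr
        · norm_num
        · nlinarith
  have hXT : X ^ (D + n * L) * X ^ (2 * (n + 1) * S) * X ≤ X ^ T := by
    rw [← pow_add, ← pow_succ]
    exact pow_le_pow_right₀ hX1 hST
  calc _ ≤ C * 2 ^ T * (1 + 2 * R) ^ L * X ^ (D + n * L) / X ^ T
        * (10 ^ T * X ^ (2 * (n + 1) * S)) := mul_le_mul hquot hsph (pow_nonneg (sph_pos p).le _)
          (by positivity)
    _ = C * 20 ^ T * (1 + 2 * R) ^ L * (X ^ (D + n * L) * X ^ (2 * (n + 1) * S) / X ^ T) := by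
      rw [show (20 : ℝ) = 2 * 10 by norm_num, mul_pow]; ring
    _ ≤ C * 20 ^ T * (1 + 2 * R) ^ L * (1 / X) := by
      refine mul_le_mul_of_nonneg_left ?_ (by positivity)
      rw [div_le_div_iff₀ (by positivity) hX0, one_mul]
      exact hXT
    _ = _ := by ring

theorem val_quotient (hn : n ≠ 0) {F : ℂ → ℂ → ℂ}
    (hF : Differentiable ℂ fun p : ℂ × ℂ => F p.1 p.2)
    (i : Fin (n - 1)) {T : ℕ} {B : ℝ} (hB : ∀ x : ℂ, ‖x‖ ≤ 1 / 2 → ‖abelVec n x‖ ≤ B)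
    {l₀ : EuclideanSpace ℂ (Fin (n - 1))} {r : ℝ}
    (hvan : ∀ (ε : ℤˣ) (m : Fin (2 * n) → ℤ), ‖period n m - l₀‖ ≤ r + 1 + B →
      VanishesTo T fun x => val F i ((sheet n ε).pt (period n m) x))
    {c : Chart n} (hc : (∃ ε, c = sheet n ε) ∨ ∃ k : Fin (2 * n), c = branch hn k)
    {m : Fin (2 * n) → ℤ} {t₀ : ℂ} (hv : ‖c.v t₀ + period n m - l₀‖ ≤ r + 1)
    (ht₀ : ‖c.x t₀‖ < 1 / 2) :
    ∃ G : ℂ → ℂ, DifferentiableOn ℂ G (c.dom ∩ {t | ‖c.x t‖ < 1 / 2}) ∧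
      ∀ t ∈ c.dom ∩ {t | ‖c.x t‖ < 1 / 2}, val F i (c.pt (period n m) t) = c.x t ^ T * G t := by
  rcases hc with ⟨ε, rfl⟩ | ⟨k, rfl⟩
  · have hm : ‖period n m - l₀‖ ≤ r + 1 + B := by
      have : period n m - l₀ = ((sheet n ε).v t₀ + period n m - l₀)
          - ((ε : ℤ) : ℂ) • abelVec n t₀ := by
        rw [show (sheet n ε).v t₀ = ((ε : ℤ) : ℂ) • abelVec n t₀ from rfl]; abel
      rw [this]
      refine (norm_sub_le _ _).trans ?_
      rw [norm_smul, norm_unit, one_mul]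
      linarith [hB t₀ ht₀.le]
    obtain ⟨G, hG, hGe⟩ := hvan ε m hm
    have hsub : ∀ t ∈ (sheet n ε).dom ∩ {t | ‖(sheet n ε).x t‖ < 1 / 2}, t ∈ ball (0 : ℂ) 1 := by
      intro t ht
      have : ‖t‖ < 1 / 2 := ht.2
      simp; linarith
    exact ⟨G, hG.mono hsub, fun t ht => hGe t (hsub t ht)⟩
  · have h0 : ∀ t ∈ (branch hn k).dom, (branch hn k).x t ≠ 0 := fun t ht =>
      mul_ne_zero (pow_ne_zero _ ((isPrimitiveRoot_zeta hn).ne_zero (by omega)))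
        (coroot_ne_zero hn ht)
    refine ⟨fun t => val F i ((branch hn k).pt (period n m) t) / (branch hn k).x t ^ T, ?_,
      fun t ht => by rw [mul_div_cancel₀ _ (pow_ne_zero _ (h0 t ht.1))]⟩
    refine (((differentiableOn_val hF _ _ i)).div ?_ fun t ht => pow_ne_zero _ (h0 t ht)).mono
      inter_subset_left
    exact DifferentiableOn.pow (fun t ht =>
      ((branch hn k).hasDerivAt_x t ht).differentiableAt.differentiableWithinAt) _

/-- A Schwarz lemma on the surface: gaussian gain from zeros at all nearby periods. -/
theorem wt_le_gaussian (hn : n ≠ 0) {κ : ℝ}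
    (hκ : ∀ x y : ℂ, y ^ 2 = 1 - x ^ (2 * n) → κ * ‖mon n x‖ ^ 2
        < ‖y‖ ^ 2 / (1 + ‖x‖ ^ 2) ^ 2 + (n * ‖x‖ ^ (2 * n - 1)) ^ 2 / (1 + ‖y‖ ^ 2) ^ 2)
    (hκ0 : 0 ≤ κ) {F : ℂ → ℂ → ℂ} {C : ℝ} {D L : ℕ} (hC : 0 < C)
    (hb : PolyBound F C D L) (hF : Differentiable ℂ fun p : ℂ × ℂ => F p.1 p.2)
    (i : Fin (n - 1)) {S T : ℕ} (hS : 0 < S) (hST : D + n * L + 2 * (n + 1) * S + 1 ≤ T)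
    {B : ℝ} (hB : ∀ x : ℂ, ‖x‖ ≤ 1 / 2 → ‖abelVec n x‖ ≤ B)
    {l₀ : EuclideanSpace ℂ (Fin (n - 1))} {r : ℝ} (hr : 0 ≤ r)
    (hvan : ∀ (ε : ℤˣ) (m : Fin (2 * n) → ℤ), ‖period n m - l₀‖ ≤ r + 1 + B →
      VanishesTo T fun x => val F i ((sheet n ε).pt (period n m) x))
    {p : ℂ × ℂ × EuclideanSpace ℂ (Fin (n - 1))} (hp : p ∈ surface hn) (hx : p.1 ≠ 0)
    (hv : ‖p.2.2 - l₀‖ ≤ r) :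
    wt F i S T (κ * S) l₀ p ≤ C * 20 ^ T * (1 + 2 * (r + 1 + ‖l₀‖ + 2 * B)) ^ L
      * Real.exp (-(κ * S * r ^ 2)) := by
  have hB0 : 0 ≤ B := (norm_nonneg _).trans (hB 0 (by simp))
  set Bd := C * 20 ^ T * (1 + 2 * (r + 1 + ‖l₀‖ + 2 * B)) ^ L with hBd
  have hBd0 : 0 < Bd := by positivity
  set A := Real.exp (κ * S * r ^ 2) with hA
  have hA0 : 0 < A := Real.exp_pos _
  rw [Real.exp_neg, ← hA]
  have hk : 0 ≤ κ * S := by positivity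
  have hclaim := fun {q : ℂ × ℂ × EuclideanSpace ℂ (Fin (n - 1))} (hq : q ∈ surface hn)
    (hqx : q.1 ≠ 0) (hqv : ‖q.2.2 - l₀‖ ≤ r + 1) =>
      wt_le hn hC.le hb i (κ * S) hST hB hvan hq hqx hqv
  have hexp1 : ∀ q : ℂ × ℂ × EuclideanSpace ℂ (Fin (n - 1)),
      Real.exp (-(κ * S * ‖q.2.2 - l₀‖ ^ 2)) ≤ 1 := fun q =>
    Real.exp_le_one_iff.2 (by have := sq_nonneg ‖q.2.2 - l₀‖; nlinarith)
  let W : Set ℝ := wt F i S T (κ * S) l₀ '' {q | q ∈ surface hn ∧ q.1 ≠ 0 ∧ ‖q.2.2 - l₀‖ ≤ r}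
  have hdiv : ∀ q : ℂ × ℂ × EuclideanSpace ℂ (Fin (n - 1)), Bd / max 1 ‖q.1‖ ≤ Bd := fun q =>
    div_le_self hBd0.le (le_max_left _ _)
  have hbdd : BddAbove W := by
    refine ⟨Bd, ?_⟩
    rintro _ ⟨q, ⟨hq, hqx, hqv⟩, rfl⟩
    refine (hclaim hq hqx (by linarith)).trans ?_
    calc _ ≤ Bd * 1 := mul_le_mul (hdiv q) (hexp1 q) (Real.exp_pos _).le hBd0.le
      _ = Bd := mul_one _
  have hne : W.Nonempty := ⟨_, p, ⟨hp, hx, hv⟩, rfl⟩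
  have hpW : wt F i S T (κ * S) l₀ p ≤ sSup W := le_csSup hbdd ⟨p, ⟨hp, hx, hv⟩, rfl⟩
  by_contra! hcon
  have hs : Bd * A⁻¹ < sSup W := hcon.trans_le hpW
  have hs0 : 0 < sSup W := lt_trans (by positivity) hs
  obtain ⟨η, hη, hgood⟩ := exists_uniform_good hn hκ A
  have hq1 : Real.exp (-(η * S)) < 1 := by
    rw [Real.exp_lt_one_iff]
    have : (0 : ℝ) < S := Nat.cast_pos.2 hS
    nlinarith
  have hle : sSup W ≤ max (Bd * A⁻¹) (Real.exp (-(η * S)) * sSup W) := by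
    refine csSup_le hne ?_
    rintro _ ⟨q, ⟨hq, hqx, hqv⟩, rfl⟩
    rcases le_or_gt ‖q.1‖ A with hqA | hqA
    · obtain ⟨c, m, t₀, hc, rfl, hg⟩ := hgood q hq hqA
      obtain ⟨t, ht, hxt, hvt, hwt⟩ := exists_wt_le hF c hg (period n m) l₀ i S T hqx
        fun h => val_quotient hn hF i hB hvan hc (hqv.trans (by linarith)) h
      have hmem : c.pt (period n m) t ∈ surface hn := by
        rcases hc with ⟨ε, rfl⟩ | ⟨k, rfl⟩
        · exact sheet_mem_surface hn ε m ht
        · exact branch_mem_surface hn k m ht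
      have hv1 : ‖(c.pt (period n m) t).2.2 - l₀‖ ≤ r + 1 := by
        have e : (c.pt (period n m) t).2.2 - l₀
            = (c.v t - c.v t₀) + ((c.pt (period n m) t₀).2.2 - l₀) := by
          simp only [Chart.pt]; abel
        rw [e]
        exact (norm_add_le _ _).trans (by linarith)
      rcases le_or_gt ‖(c.pt (period n m) t).2.2 - l₀‖ r with h | h
      · refine le_max_of_le_right (hwt.trans ?_)
        gcongr
        exact le_csSup hbdd ⟨_, ⟨hmem, hxt, h⟩, rfl⟩
      · refine le_max_of_le_left (hwt.trans ?_)
        have h1 := hclaim hmem hxt hv1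
        have h2 : Real.exp (-(κ * S * ‖(c.pt (period n m) t).2.2 - l₀‖ ^ 2)) ≤ A⁻¹ := by
          rw [hA, ← Real.exp_neg]
          refine Real.exp_le_exp.2 (neg_le_neg ?_)
          gcongr
        have h3 := h1.trans (mul_le_mul (hdiv _) h2 (Real.exp_pos _).le hBd0.le)
        have h4 := (Real.exp_pos (-(η * S))).le
        have h5 : 0 ≤ Bd * A⁻¹ := by positivity
        nlinarith
    · refine le_max_of_le_left ((hclaim hq hqx (by linarith)).trans ?_)
      calc _ ≤ Bd / max 1 ‖q.1‖ * 1 := mul_le_mul_of_nonneg_left (hexp1 q) (by positivity)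
        _ ≤ Bd / A := by
          rw [mul_one]
          exact div_le_div_of_nonneg_left hBd0.le hA0 (hqA.le.trans (le_max_right _ _))
        _ = _ := div_eq_mul_inv _ _
  rcases le_max_iff.1 hle with h | h
  · linarith
  · nlinarith

end GaussianBound

/-! ### Upper bound for the leading coefficient -/

section LeadingCoefficient

open Metric Set Filter Topology

variable {n : ℕ}

theorem one_le_sph (p : ℂ × ℂ × EuclideanSpace ℂ (Fin (n - 1))) : 1 ≤ sph p :=
  one_le_mul_of_one_le_of_one_le (by have := sq_nonneg ‖p.1‖; linarith)
    (by have := sq_nonneg ‖p.2.1‖; linarith)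

/-- Smallness of the leading coefficient at a period all of whose neighbours are zeros of high
order. -/
theorem norm_leading_le (hn : n ≠ 0) {κ : ℝ}
    (hκ : ∀ x y : ℂ, y ^ 2 = 1 - x ^ (2 * n) → κ * ‖mon n x‖ ^ 2
        < ‖y‖ ^ 2 / (1 + ‖x‖ ^ 2) ^ 2 + (n * ‖x‖ ^ (2 * n - 1)) ^ 2 / (1 + ‖y‖ ^ 2) ^ 2)
    (hκ0 : 0 ≤ κ) {F : ℂ → ℂ → ℂ} {C : ℝ} {D L : ℕ} (hC : 0 < C)
    (hb : PolyBound F C D L) (hF : Differentiable ℂ fun p : ℂ × ℂ => F p.1 p.2)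
    (i : Fin (n - 1)) {S T : ℕ} (hS : 0 < S) (hST : D + n * L + 2 * (n + 1) * S + 1 ≤ T)
    {B : ℝ} (hB : ∀ x : ℂ, ‖x‖ ≤ 1 / 2 → ‖abelVec n x‖ ≤ B) {r : ℝ} (hr : B ≤ r)
    {ε₀ : ℤˣ} {m₀ : Fin (2 * n) → ℤ}
    (hvan : ∀ (ε : ℤˣ) (m : Fin (2 * n) → ℤ), ‖period n m - period n m₀‖ ≤ r + 1 + B →
      VanishesTo T fun x => val F i ((sheet n ε).pt (period n m) x))
    {T₀ : ℕ} {G : ℂ → ℂ} (hG : DifferentiableOn ℂ G (ball 0 1))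
    (hGe : ∀ x ∈ ball (0 : ℂ) 1, val F i ((sheet n ε₀).pt (period n m₀) x) = x ^ T₀ * G x) :
    ‖G 0‖ ≤ 2 ^ T₀ * (C * 20 ^ T * (1 + 2 * (r + 1 + ‖period n m₀‖ + 2 * B)) ^ L
      * Real.exp (-(κ * S * (r ^ 2 - B ^ 2)))) := by
  have hB0 : 0 ≤ B := (norm_nonneg _).trans (hB 0 (by simp))
  have hsub : closedBall (0 : ℂ) (1 / 2) ⊆ ball 0 1 := closedBall_subset_ball (by norm_num)
  refine Complex.norm_le_of_forall_mem_frontier_norm_le (isBounded_ball (x := 0) (r := 1 / 2))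
    (hG.diffContOnCl_ball hsub) ?_ (subset_closure (by simp))
  intro z hz
  rw [frontier_ball _ (by norm_num)] at hz
  have hz' : ‖z‖ = 1 / 2 := by simpa using hz
  have hz0 : z ≠ 0 := by rintro rfl; norm_num at hz'
  have hz1 : z ∈ ball (0 : ℂ) 1 := hsub (sphere_subset_closedBall hz)
  have hmem := sheet_mem_surface hn ε₀ m₀ (ball_subset_slit hn hz1)
  have hv : ‖((sheet n ε₀).pt (period n m₀) z).2.2 - period n m₀‖ ≤ B := by
    have e : ((sheet n ε₀).pt (period n m₀) z).2.2 - period n m₀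
        = ((ε₀ : ℤ) : ℂ) • abelVec n z := add_sub_cancel_right _ _
    rw [e, norm_smul, norm_unit, one_mul]
    exact hB z hz'.le
  have h := wt_le_gaussian hn hκ hκ0 hC hb hF i hS hST hB (hB0.trans hr) hvan hmem hz0 (hv.trans hr)
  set M := C * 20 ^ T * (1 + 2 * (r + 1 + ‖period n m₀‖ + 2 * B)) ^ L with hM
  set p := (sheet n ε₀).pt (period n m₀) z with hp
  have hp1 : ‖p.1‖ = 1 / 2 := hz'
  have hk : 0 ≤ κ * S := by positivity
  have hlow : ‖val F i p‖ * Real.exp (-(κ * S * B ^ 2)) ≤ wt F i S T (κ * S) (period n m₀) p := by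
    unfold wt
    have h1 : ‖val F i p‖ ≤ ‖val F i p‖ / ‖p.1‖ ^ T := by
      refine le_div_self (norm_nonneg _) (by rw [hp1]; positivity) ?_
      rw [hp1]
      exact pow_le_one₀ (by norm_num) (by norm_num)
    have h2 : ‖val F i p‖ ≤ ‖val F i p‖ / ‖p.1‖ ^ T * sph p ^ S :=
      h1.trans (le_mul_of_one_le_right ((norm_nonneg _).trans h1) (one_le_pow₀ (one_le_sph p)))
    refine mul_le_mul h2 (Real.exp_le_exp.2 (neg_le_neg ?_)) (Real.exp_pos _).le
      ((norm_nonneg _).trans h2)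
    gcongr
  have h3 := hlow.trans h
  have h4 : ‖val F i p‖ ≤ M * Real.exp (-(κ * S * (r ^ 2 - B ^ 2))) := by
    have e : Real.exp (-(κ * S * r ^ 2))
        = Real.exp (-(κ * S * (r ^ 2 - B ^ 2))) * Real.exp (-(κ * S * B ^ 2)) := by
      rw [← Real.exp_add]; congr 1; ring
    rw [e, ← mul_assoc] at h3
    exact le_of_mul_le_mul_right h3 (Real.exp_pos _)
  have h5 : ‖G z‖ = 2 ^ T₀ * ‖val F i p‖ := by
    rw [hp, hGe z hz1, norm_mul, norm_pow, hz', ← mul_assoc, ← mul_pow]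
    norm_num
  rw [h5]
  gcongr

end LeadingCoefficient

/-! ### Periods of bounded size -/

section BoundedPeriods

open Metric Set Filter Topology

variable {n : ℕ}

theorem sum_zeta_pow_mul (hn : n ≠ 0) {s : ℕ} (hs : ¬ 2 * n ∣ s) :
    ∑ k : Fin (2 * n), zeta n ^ ((k : ℕ) * s) = 0 := by
  have hz := isPrimitiveRoot_zeta hn
  have h1 : zeta n ^ s ≠ 1 := fun h => hs (hz.dvd_of_pow_eq_one s h)
  have h2 : (zeta n ^ s) ^ (2 * n) = 1 := by rw [← pow_mul, mul_comm, pow_mul, hz.pow_eq_one, one_pow]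
  rw [Fin.sum_univ_eq_sum_range (fun k => zeta n ^ (k * s))]
  have h3 := mul_geom_sum (zeta n ^ s) (2 * n)
  rw [h2, sub_self] at h3
  rw [← (mul_eq_zero.1 h3).resolve_left (sub_ne_zero.2 h1)]
  exact Finset.sum_congr rfl fun k _ => by rw [← pow_mul, mul_comm]

/-- Values at roots of unity of the polynomial with coefficients `m`. -/
noncomputable def fourier (n : ℕ) (m : Fin (2 * n) → ℤ) (s : ℕ) : ℂ :=
  ∑ k, m k * zeta n ^ ((k : ℕ) * s)

theorem zeta_pow_half (hn : n ≠ 0) : zeta n ^ n = -1 := by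
  have hz := isPrimitiveRoot_zeta hn
  have h1 : zeta n ^ n * zeta n ^ n = 1 := by rw [← pow_add, ← two_mul, hz.pow_eq_one]
  refine (mul_self_eq_one_iff.1 h1).resolve_left ?_
  exact hz.pow_ne_one_of_pos_of_lt (by omega) (by omega)

theorem fourier_inversion (hn : n ≠ 0) (m : Fin (2 * n) → ℤ) (k₀ : Fin (2 * n)) :
    ∑ s : Fin (2 * n), fourier n m s * zeta n ^ ((s : ℕ) * (2 * n - k₀)) = 2 * n * m k₀ := by
  have hz := isPrimitiveRoot_zeta hn
  have h0 := k₀.2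
  have h : ∀ k : Fin (2 * n), ∑ s : Fin (2 * n), zeta n ^ ((k : ℕ) * s)
      * zeta n ^ ((s : ℕ) * (2 * n - k₀)) = if k = k₀ then (2 * n : ℂ) else 0 := by
    intro k
    have e : ∀ s : Fin (2 * n), zeta n ^ ((k : ℕ) * s) * zeta n ^ ((s : ℕ) * (2 * n - k₀))
        = zeta n ^ ((s : ℕ) * (k + (2 * n - k₀))) := fun s => by
      rw [← pow_add]; congr 1; ring
    simp only [e]
    split_ifs with hk
    · subst hk
      have : (k : ℕ) + (2 * n - k) = 2 * n := by omega
      simp [this, mul_comm _ (2 * n), pow_mul, hz.pow_eq_one]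
    · refine sum_zeta_pow_mul hn ?_
      rintro ⟨c, hc⟩
      have h1 := k.2
      have h2 : (k : ℕ) ≠ k₀ := fun h => hk (Fin.ext h)
      have h3 : c < 2 := by
        by_contra! h
        have := Nat.mul_le_mul_left (2 * n) h
        omega
      interval_cases c <;> omega
  simp only [fourier, Finset.sum_mul]
  rw [Finset.sum_comm]
  simp only [mul_assoc (m _ : ℂ), ← Finset.mul_sum, h]
  simp [mul_comm]

theorem norm_zeta (hn : n ≠ 0) : ‖zeta n‖ = 1 :=
  (isPrimitiveRoot_zeta hn).norm'_eq_one (by omega)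

theorem norm_fourier_reflect (hn : n ≠ 0) (m : Fin (2 * n) → ℤ) {s : ℕ} (hs : s ≤ 2 * n) :
    ‖fourier n m (2 * n - s)‖ = ‖fourier n m s‖ := by
  rw [← RCLike.norm_conj]
  congr 1
  simp only [fourier, map_sum, map_mul, map_pow, map_intCast]
  refine Finset.sum_congr rfl fun k _ => ?_
  congr 1
  have h0 : zeta n ≠ 0 := (isPrimitiveRoot_zeta hn).ne_zero (by omega)
  rw [← Complex.inv_eq_conj (norm_zeta hn), inv_pow]
  refine inv_eq_of_mul_eq_one_left ?_
  rw [← pow_add, ← mul_add, Nat.add_sub_cancel' hs, mul_comm, pow_mul,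
    (isPrimitiveRoot_zeta hn).pow_eq_one, one_pow]

theorem period_apply (m : Fin (2 * n) → ℤ) (j : Fin (n - 1)) :
    period n m j = 2 * realInt n j * fourier n m (j + 1) := rfl

/-- Periods of bounded size have coordinates which are bounded integral combinations of the basic
ones. -/
theorem exists_bounded_coeff (hn : n ≠ 0) : ∃ C : ℝ, 0 < C ∧ ∀ (m : Fin (2 * n) → ℤ) (R : ℝ),
    ‖period n m‖ ≤ R → ∃ b : Fin (2 * n) → ℤ, (∀ k, |(b k : ℝ)| ≤ C * R) ∧
      ∀ i : Fin (n - 1), period n m i = realInt n i / n * ∑ k, b k * zeta n ^ ((k : ℕ) * (i + 1)) := by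
  have hz := isPrimitiveRoot_zeta hn
  set c : ℝ := ∑ j : Fin (n - 1), 1 / (2 * realInt n j) with hc
  have hc0 : 0 ≤ c := Finset.sum_nonneg fun j _ => by have := realInt_pos hn j; positivity
  refine ⟨2 * n * c + 1, by positivity, fun m R hR => ?_⟩
  have hR0 : 0 ≤ R := (norm_nonneg _).trans hR
  have hsmall : ∀ s, 0 < s → s < n → ‖fourier n m s‖ ≤ c * R := by
    intro s h1 h2
    have hj := (PiLp.norm_apply_le (period n m) ⟨s - 1, by omega⟩).trans hR
    have hI := realInt_pos hn (s - 1)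
    rw [period_apply, norm_mul, norm_mul, Complex.norm_ofNat, Complex.norm_real,
      Real.norm_of_nonneg hI.le] at hj
    have hs : (⟨s - 1, by omega⟩ : Fin (n - 1)).1 + 1 = s := by simp; omega
    rw [hs] at hj
    have hle : 1 / (2 * realInt n (s - 1)) ≤ c :=
      Finset.single_le_sum (f := fun j : Fin (n - 1) => 1 / (2 * realInt n j))
        (fun j _ => by have := realInt_pos hn j; positivity)
        (Finset.mem_univ ⟨s - 1, by omega⟩)
    calc ‖fourier n m s‖ = 1 / (2 * realInt n (s - 1)) * (2 * realInt n (s - 1) * ‖fourier n m s‖) := by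
          field_simp
      _ ≤ c * R := mul_le_mul hle hj (by positivity) hc0
  have hbig : ∀ s : Fin (2 * n), (s : ℕ) ≠ 0 → (s : ℕ) ≠ n → ‖fourier n m s‖ ≤ c * R := by
    intro s h1 h2
    rcases lt_or_gt_of_ne h2 with h | h
    · exact hsmall s (by omega) h
    · rw [← norm_fourier_reflect hn m s.2.le]
      exact hsmall _ (by omega) (by omega)
  have hn2 : n < 2 * n := by omega
  let z0 : Fin (2 * n) := ⟨0, by omega⟩
  let zn : Fin (2 * n) := ⟨n, hn2⟩
  have h0n : z0 ≠ zn := fun h => hn (congrArg Fin.val h).symm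
  have hf0 : fourier n m 0 = ((∑ k, m k : ℤ) : ℂ) := by simp [fourier]
  have hfn : fourier n m n = ((∑ k : Fin (2 * n), m k * (-1) ^ (k : ℕ) : ℤ) : ℂ) := by
    simp [fourier, mul_comm _ n, pow_mul, zeta_pow_half hn]
  let b : Fin (2 * n) → ℤ := fun k => 2 * n * m k - ∑ j, m j
    - (-1) ^ (k : ℕ) * ∑ j : Fin (2 * n), m j * (-1) ^ (j : ℕ)
  have hb : ∀ k, (b k : ℂ) = ∑ s ∈ (Finset.univ.erase z0).erase zn,
      fourier n m s * zeta n ^ ((s : ℕ) * (2 * n - k)) := by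
    intro k
    have h := fourier_inversion hn m k
    rw [← Finset.add_sum_erase _ _ (Finset.mem_univ z0), ← Finset.add_sum_erase _ _
      (Finset.mem_erase.2 ⟨h0n.symm, Finset.mem_univ zn⟩)] at h
    have hk : zeta n ^ (n * (2 * n - k)) = (-1) ^ (k : ℕ) := by
      rw [pow_mul, zeta_pow_half hn]
      have : ((-1 : ℂ)) ^ (2 * n - (k : ℕ)) * (-1) ^ (k : ℕ) = 1 := by
        rw [← pow_add, Nat.sub_add_cancel k.2.le, pow_mul]; simp
      have h2 : ((-1 : ℂ) ^ (k : ℕ)) * (-1) ^ (k : ℕ) = 1 := by rw [← mul_pow]; simp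
      exact mul_right_cancel₀ (pow_ne_zero _ (by norm_num)) (this.trans h2.symm)
    have e0 : (z0 : ℕ) = 0 := rfl
    have en : (zn : ℕ) = n := rfl
    rw [e0, en, hk, hf0, hfn, zero_mul, pow_zero, mul_one] at h
    have hbk : (b k : ℂ) = 2 * n * m k - ((∑ k, m k : ℤ) : ℂ)
        - (-1) ^ (k : ℕ) * ((∑ k : Fin (2 * n), m k * (-1) ^ (k : ℕ) : ℤ) : ℂ) := by
      simp only [b]; push_cast; ring
    rw [hbk, ← h]
    ring
  refine ⟨b, fun k => ?_, fun i => ?_⟩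
  · have h1 : |(b k : ℝ)| = ‖(b k : ℂ)‖ := by rw [Complex.norm_intCast]
    rw [h1, hb]
    refine (norm_sum_le _ _).trans ?_
    calc _ ≤ ∑ s ∈ (Finset.univ.erase z0).erase zn, c * R := by
          refine Finset.sum_le_sum fun s hs => ?_
          rw [norm_mul, norm_pow, norm_zeta hn, one_pow, mul_one]
          simp only [Finset.mem_erase, Finset.mem_univ, and_true] at hs
          exact hbig s (fun h => hs.2 (Fin.ext h)) (fun h => hs.1 (Fin.ext h))
      _ ≤ ∑ s : Fin (2 * n), c * R := Finset.sum_le_sum_of_subset_of_nonneg (Finset.subset_univ _)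
          fun _ _ _ => by positivity
      _ ≤ _ := by
        simp
        nlinarith
  · have hi := i.2
    have s1 := sum_zeta_pow_mul hn (s := i + 1) fun h => by
      have := Nat.le_of_dvd (by omega) h; omega
    have s2 := sum_zeta_pow_mul hn (s := n + (i + 1)) fun h => by
      obtain ⟨c, hc⟩ := h
      rcases Nat.lt_or_ge c 1 with h | h
      · interval_cases c; omega
      · have := Nat.mul_le_mul_left (2 * n) h; omega
    have e : ∑ k, (b k : ℂ) * zeta n ^ ((k : ℕ) * (i + 1))
        = 2 * n * fourier n m (i + 1) := by
      have : ∀ k : Fin (2 * n), (b k : ℂ) * zeta n ^ ((k : ℕ) * (i + 1))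
          = 2 * n * (m k * zeta n ^ ((k : ℕ) * (i + 1)))
            - ((∑ j, m j : ℤ) : ℂ) * zeta n ^ ((k : ℕ) * (i + 1))
            - ((∑ j : Fin (2 * n), m j * (-1) ^ (j : ℕ) : ℤ) : ℂ)
              * zeta n ^ ((k : ℕ) * (n + (i + 1))) := by
        intro k
        rw [mul_add (k : ℕ) n, pow_add, mul_comm (k : ℕ) n, pow_mul _ n, zeta_pow_half hn]
        simp only [b]; push_cast; ring
      simp only [this, Finset.sum_sub_distrib, ← Finset.mul_sum, s1, s2, fourier]
      ring
    rw [e, period_apply]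
    have : (n : ℂ) ≠ 0 := Nat.cast_ne_zero.2 hn
    field_simp

end BoundedPeriods

/-! ### Taylor coefficients and their houses -/

section TaylorCoefficients

open Metric Set NumberField

/-- The value at `0` of `((1 - x^{2n}) d/dx)^t (x^a w^c)`, where `w 0 = μ` and
`(1 - x^{2n}) w' = -n x^{2n-1} w + q x^i (1 - x^{2n})`. -/
def taylorCoeff {R : Type*} [CommRing R] (n i q : ℕ) (μ : R) : ℕ → ℕ → ℕ → R
  | 0, a, c => if a = 0 then μ ^ c else 0
  | t + 1, a, c => a * taylorCoeff n i q μ t (a - 1) c - a * taylorCoeff n i q μ t (a - 1 + 2 * n) c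
      + c * q * taylorCoeff n i q μ t (a + i) (c - 1)
      - c * q * taylorCoeff n i q μ t (a + i + 2 * n) (c - 1)
      - c * n * taylorCoeff n i q μ t (a + (2 * n - 1)) c

variable {n i q : ℕ}

theorem map_taylorCoeff {R S : Type*} [CommRing R] [CommRing S] (f : R →+* S) (μ : R) (t a c : ℕ) :
    f (taylorCoeff n i q μ t a c) = taylorCoeff n i q (f μ) t a c := by
  induction t generalizing a c with
  | zero => simp only [taylorCoeff]; split_ifs <;> simp
  | succ t ih => simp [taylorCoeff, ih]

theorem diffOp_sum {ι : Type*} (s : Finset ι) (u : ι → ℂ) {f : ι → ℂ → ℂ}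
    (hf : ∀ j ∈ s, DifferentiableOn ℂ (f j) (ball 0 1)) :
    EqOn (diffOp n fun x => ∑ j ∈ s, u j * f j x) (fun x => ∑ j ∈ s, u j * diffOp n (f j) x)
      (ball 0 1) := by
  intro x hx
  have h : ∀ j ∈ s, HasDerivAt (fun y => u j * f j y) (u j * deriv (f j) x) x := fun j hj =>
    (((hf j hj).differentiableAt (isOpen_ball.mem_nhds hx)).hasDerivAt).const_mul _
  simp only [diffOp, (HasDerivAt.fun_sum h).deriv, Finset.mul_sum]
  exact Finset.sum_congr rfl fun j _ => by ring

theorem diffOp_iterate_sum {ι : Type*} (s : Finset ι) (u : ι → ℂ) {f : ι → ℂ → ℂ}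
    (hf : ∀ j ∈ s, DifferentiableOn ℂ (f j) (ball 0 1)) (t : ℕ) :
    EqOn ((diffOp n)^[t] fun x => ∑ j ∈ s, u j * f j x)
      (fun x => ∑ j ∈ s, u j * (diffOp n)^[t] (f j) x) (ball 0 1) := by
  induction t with
  | zero => exact fun x _ => rfl
  | succ t ih =>
    simp only [Function.iterate_succ_apply']
    exact (diffOp_congr ih).trans
      (diffOp_sum s u fun j hj => differentiableOn_diffOp_iterate (hf j hj) t)

theorem diffOp_iterate_monomial {w : ℂ → ℂ} (hw : DifferentiableOn ℂ w (ball 0 1))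
    (hode : ∀ x ∈ ball (0 : ℂ) 1,
      diffOp n w x = -(n * x ^ (2 * n - 1) * w x) + q * x ^ i * (1 - x ^ (2 * n))) (t a c : ℕ) :
    (diffOp n)^[t] (fun x => x ^ a * w x ^ c) 0 = taylorCoeff n i q (w 0) t a c := by
  induction t generalizing a c with
  | zero => rcases eq_or_ne a 0 with rfl | ha <;> simp [taylorCoeff, *]
  | succ t ih =>
    let u : Fin 5 → ℂ := ![a, -a, c * q, -(c * q), -(c * n)]
    let α : Fin 5 → ℕ := ![a - 1, a - 1 + 2 * n, a + i, a + i + 2 * n, a + (2 * n - 1)]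
    let γ : Fin 5 → ℕ := ![c, c, c - 1, c - 1, c]
    have hd : ∀ j ∈ (Finset.univ : Finset (Fin 5)),
        DifferentiableOn ℂ (fun x => x ^ α j * w x ^ γ j) (ball 0 1) := fun j _ =>
      (differentiableOn_id.pow _).mul (hw.pow _)
    have h : EqOn (diffOp n fun x => x ^ a * w x ^ c)
        (fun x => ∑ j, u j * (x ^ α j * w x ^ γ j)) (ball 0 1) := by
      intro x hx
      have hwx := (hw.differentiableAt (isOpen_ball.mem_nhds hx)).hasDerivAt
      have := ((hasDerivAt_pow a x).mul (hwx.pow c)).deriv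
      have ho := hode x hx
      simp only [diffOp] at ho ⊢
      have e : deriv (fun x => x ^ a * w x ^ c) x
        = a * x ^ (a - 1) * w x ^ c + x ^ a * (c * w x ^ (c - 1) * deriv w x) := this
      have hc : (c : ℂ) * w x ^ (c - 1) * w x = c * w x ^ c := by
        rcases c with _ | c
        · simp
        · rw [Nat.add_sub_cancel, pow_succ]; ring
      rw [e]
      simp only [Fin.sum_univ_five, u, α, γ]
      simp [pow_add]
      linear_combination (x ^ a * c * w x ^ (c - 1)) * ho - n * x ^ a * x ^ (2 * n - 1) * hc
    rw [Function.iterate_succ_apply, diffOp_iterate_congr h t (mem_ball_self one_pos),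
      diffOp_iterate_sum _ u hd t (mem_ball_self one_pos)]
    simp only [ih]
    simp [Fin.sum_univ_five, u, α, γ, taylorCoeff]
    ring

section House
variable {K : Type*} [Field K] [NumberField K]

theorem house_sub_le (α β : K) : house (α - β) ≤ house α + house β := by
  simp only [house, map_sub]; exact norm_sub_le _ _

theorem house_natCast_mul_le (k : ℕ) {α : K} {x : ℝ} (h : house α ≤ x) :
    house (k * α) ≤ k * x := by
  rw [house_nat_mul]; gcongr

theorem house_zero : house (0 : K) = 0 := by simp [house]

theorem house_one : house (1 : K) = 1 := by simpa using house_intCast (K := K) 1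

theorem house_taylorCoeff_le (hi : i ≤ n) {μ : K} {B : ℝ} (hB : 1 ≤ B) (hμ : house μ ≤ B)
    (t a c : ℕ) : house (taylorCoeff n i q μ t a c)
      ≤ ((2 + 2 * q + n) * (a + c + 3 * n * t)) ^ t * B ^ c := by
  have hB0 : 0 ≤ B := by linarith
  induction t generalizing a c with
  | zero =>
    rw [pow_zero, one_mul, taylorCoeff]
    split_ifs
    · exact (house_pow_le _ _).trans (pow_le_pow_left₀ (house_nonneg _) hμ c)
    · rw [house_zero]; positivity
  | succ t ih =>
    set M : ℝ := ((2 + 2 * q + n) * (a + c + 3 * n * (t + 1 : ℕ))) ^ t * B ^ c with hM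
    have hM0 : 0 ≤ M := by positivity
    have key : ∀ a' c' : ℕ, a' ≤ a + 3 * n → c' ≤ c → house (taylorCoeff n i q μ t a' c') ≤ M := by
      intro a' c' ha hc
      have h1 : (a' : ℝ) ≤ a + 3 * n := by exact_mod_cast ha
      have h2 : (c' : ℝ) ≤ c := by exact_mod_cast hc
      refine (ih a' c').trans (mul_le_mul (pow_le_pow_left₀ (by positivity) ?_ _)
        (pow_le_pow_right₀ hB hc) (by positivity) (by positivity))
      refine mul_le_mul_of_nonneg_left ?_ (by positivity)
      push_cast
      linarith
    have k1 := house_natCast_mul_le a (key (a - 1) c (by omega) le_rfl)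
    have k2 := house_natCast_mul_le a (key (a - 1 + 2 * n) c (by omega) le_rfl)
    have k3 := house_natCast_mul_le (c * q) (key (a + i) (c - 1) (by omega) (by omega))
    have k4 := house_natCast_mul_le (c * q) (key (a + i + 2 * n) (c - 1) (by omega) (by omega))
    have k5 := house_natCast_mul_le (c * n) (key (a + (2 * n - 1)) c (by omega) le_rfl)
    push_cast at k3 k4 k5
    have h : house (taylorCoeff n i q μ (t + 1) a c)
        ≤ a * M + a * M + c * q * M + c * q * M + c * n * M := by
      rw [taylorCoeff]
      refine (house_sub_le _ _).trans (add_le_add ?_ k5)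
      refine (house_sub_le _ _).trans (add_le_add ?_ k4)
      refine (house_add_le _ _).trans (add_le_add ?_ k3)
      exact (house_sub_le _ _).trans (add_le_add k1 k2)
    refine h.trans ?_
    have e : ((2 + 2 * q + n : ℝ) * (a + c + 3 * n * (t + 1 : ℕ))) ^ (t + 1) * B ^ c
        = ((2 + 2 * q + n : ℝ) * (a + c + 3 * n * (t + 1 : ℕ))) * M := by rw [hM, pow_succ]; ring
    rw [e]
    have : (a : ℝ) + a + c * q + c * q + c * n ≤ (2 + 2 * q + n : ℝ) * (a + c + 3 * n * (t + 1 : ℕ)) := by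
      have : (0 : ℝ) ≤ (2 + 2 * q + n) * (3 * n * (t + 1 : ℕ)) := by positivity
      have : (0 : ℝ) ≤ 2 * q * a + n * a + 2 * c := by positivity
      nlinarith
    nlinarith

end House

end TaylorCoefficients

/-! ### Auxiliary functions -/

section AuxiliaryFunctions

open Metric Set NumberField Polynomial

variable {n i q L : ℕ}

/-- The value of a polynomial in two variables of degree less than `L` in each variable. -/
noncomputable def polyVal (p : Fin L × Fin L → ℂ) (x w : ℂ) : ℂ :=
  ∑ j, p j * (x ^ (j.1 : ℕ) * w ^ (j.2 : ℕ))

theorem differentiable_polyVal (p : Fin L × Fin L → ℂ) (q : ℂ) :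
    Differentiable ℂ fun z : ℂ × ℂ => polyVal p z.1 (q * z.2) := by
  unfold polyVal
  fun_prop

theorem polyBound_polyVal {p : Fin L × Fin L → ℂ} {H : ℝ} (hH : 0 ≤ H) (hp : ∀ j, ‖p j‖ ≤ H)
    (hq : 1 ≤ q) : PolyBound (fun x w => polyVal p x (q * w)) (L ^ 2 * H * q ^ L) L L := by
  intro x w
  have hq' : (1 : ℝ) ≤ q := by exact_mod_cast hq
  have h : ∀ j : Fin L × Fin L, ‖p j * (x ^ (j.1 : ℕ) * (q * w) ^ (j.2 : ℕ))‖
      ≤ H * (max 1 ‖x‖ ^ L * (q ^ L * (1 + ‖w‖) ^ L)) := by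
    intro j
    rw [norm_mul, norm_mul, norm_pow, norm_pow, norm_mul, Complex.norm_natCast]
    have h1 : ‖x‖ ^ (j.1 : ℕ) ≤ max 1 ‖x‖ ^ L :=
      (pow_le_pow_left₀ (norm_nonneg _) (le_max_right _ _) _).trans
        (pow_le_pow_right₀ (le_max_left _ _) j.1.2.le)
    have h2 : (q * ‖w‖) ^ (j.2 : ℕ) ≤ q ^ L * (1 + ‖w‖) ^ L := by
      rw [← mul_pow]
      refine (pow_le_pow_left₀ (by positivity) ?_ _).trans
        (pow_le_pow_right₀ (a := q * (1 + ‖w‖)) ?_ j.2.2.le)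
      · nlinarith
      · nlinarith [norm_nonneg w]
    exact mul_le_mul (hp j) (mul_le_mul h1 h2 (by positivity) (by positivity)) (by positivity) hH
  refine (norm_sum_le_of_le _ fun j _ => h j).trans_eq ?_
  simp
  ring

theorem vanishesTo_polyVal_le (hn : 2 ≤ n) (hi : i ≤ n - 2) (hq : q ≠ 0) {w : ℂ → ℂ}
    (hw : DifferentiableOn ℂ w (ball 0 1))
    (hode : ∀ x ∈ ball (0 : ℂ) 1,
      diffOp n w x = -(n * x ^ (2 * n - 1) * w x) + q * x ^ i * (1 - x ^ (2 * n)))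
    {p : Fin L × Fin L → ℂ} (hp : p ≠ 0) {t : ℕ} (h : VanishesTo t fun x => polyVal p x (w x)) :
    t ≤ (3 * n + 2) * L ^ 2 := by
  classical
  let f : ℕ → ℂ[X] := fun c => if hc : c < L then ∑ a : Fin L, C (p (a, ⟨c, hc⟩)) * X ^ (a : ℕ) else 0
  have hf0 : ∃ c, c < L ∧ f c ≠ 0 := by
    obtain ⟨⟨a, c⟩, hac⟩ := Function.ne_iff.1 hp
    refine ⟨c, c.2, fun h => hac ?_⟩
    have := congrArg (fun g => g.coeff (a : ℕ)) h
    simpa [f, coeff_X_pow, Fin.val_inj] using this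
  obtain ⟨c₀, hc₀, hfc₀⟩ := hf0
  have hL : ∀ c, f c ≠ 0 → c < L := fun c hc => by
    by_contra h
    exact hc (dif_neg h)
  let l := Nat.findGreatest (fun c => f c ≠ 0) L
  have hl : f l ≠ 0 := Nat.findGreatest_spec (P := fun c => f c ≠ 0) hc₀.le hfc₀
  have hf : ∀ k, l < k → f k = 0 := by
    intro k hk
    by_contra h
    exact Nat.findGreatest_is_greatest hk (hL k h).le h
  have hd : ∀ k, (f k).natDegree ≤ L := by
    intro k
    simp only [f]
    split_ifs
    · refine natDegree_sum_le_of_forall_le _ _ fun a _ => ?_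
      exact (natDegree_C_mul_X_pow_le _ _).trans a.2.le
    · simp
  have hlL := hL l hl
  have he : (fun x => polyVal p x (w x)) = evalSum l w f := by
    funext x
    have h1 : polyVal p x (w x) = ∑ c ∈ Finset.range L, (f c).eval x * w x ^ c := by
      rw [← Fin.sum_univ_eq_sum_range (fun c => (f c).eval x * w x ^ c), polyVal,
        Fintype.sum_prod_type, Finset.sum_comm]
      refine Finset.sum_congr rfl fun c _ => ?_
      simp only [f, c.2, dif_pos, eval_finsetSum, Finset.sum_mul]
      simp [mul_assoc]
    rw [h1, evalSum, Fin.sum_univ_eq_sum_range (fun c => (f c).eval x * w x ^ c)]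
    symm
    refine Finset.sum_subset (Finset.range_subset_range.2 hlL) fun c _ hc => ?_
    rw [hf c (by simpa using hc)]
    simp
  rw [he] at h
  have := vanishesTo_evalSum_le hn hi (Nat.cast_ne_zero.2 hq) hw hode hl hf hd h
  refine this.trans ?_
  have : (l + 1) * (L + 3 * n * l) ≤ L * (L + 3 * n * L) := by gcongr; omega
  nlinarith

theorem exists_exact_order {F : ℂ → ℂ} {T Z : ℕ} (hZ : ∀ t, VanishesTo t F → t ≤ Z)
    (hT : VanishesTo T F) : ∃ T₀ G, T ≤ T₀ ∧ T₀ ≤ Z ∧ DifferentiableOn ℂ G (ball 0 1) ∧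
      (∀ x ∈ ball (0 : ℂ) 1, F x = x ^ T₀ * G x) ∧ G 0 ≠ 0 := by
  classical
  have hle := Nat.le_findGreatest (P := fun t => VanishesTo t F) (hZ T hT) hT
  have hs := Nat.findGreatest_spec (P := fun t => VanishesTo t F) (hZ T hT) hT
  obtain ⟨G, hG, hF⟩ := hs
  refine ⟨_, G, hle, Nat.findGreatest_le _, hG, hF, fun h0 => ?_⟩
  have h1 := vanishesTo_succ hG hF h0
  exact Nat.findGreatest_is_greatest (P := fun t => VanishesTo t F) (Nat.lt_succ_self _) (hZ _ h1) h1

/-- The function `q Y (μ + Φ)` on the unit disc. -/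
noncomputable def twist (n i q : ℕ) (μ x : ℂ) : ℂ := q * (root n x * (abelInt n i x + μ))

theorem root_zero (hn : n ≠ 0) : root n 0 = 1 := by
  simp [root, hn]

theorem twist_zero (hn : n ≠ 0) (μ : ℂ) : twist n i q μ 0 = q * μ := by
  simp [twist, root_zero hn, abelInt_zero]

theorem differentiableOn_twist (hn : n ≠ 0) (μ : ℂ) :
    DifferentiableOn ℂ (twist n i q μ) (ball 0 1) := fun _ hx =>
  have hx' := ball_subset_slit hn hx
  (((hasDerivAt_root hx').mul ((hasDerivAt_abelInt i hx').add_const μ)).const_mul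
    (q : ℂ)).differentiableAt.differentiableWithinAt

theorem diffOp_twist (hn : n ≠ 0) (μ : ℂ) {x : ℂ} (hx : x ∈ ball (0 : ℂ) 1) :
    diffOp n (twist n i q μ) x
      = -(n * x ^ (2 * n - 1) * twist n i q μ x) + q * x ^ i * (1 - x ^ (2 * n)) := by
  have hx' := ball_subset_slit hn hx
  have h := (((hasDerivAt_root hx').mul ((hasDerivAt_abelInt i hx').add_const μ)).const_mul
    (q : ℂ)).deriv
  have e : deriv (twist n i q μ) x = _ := h
  have h0 := root_ne_zero hx'
  rw [diffOp, e, ← root_sq x, twist]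
  field_simp

theorem val_polyVal_sheet (p : Fin L × Fin L → ℂ) (i : Fin (n - 1)) (ε : ℤˣ)
    (l : EuclideanSpace ℂ (Fin (n - 1))) (x : ℂ) :
    val (fun x w => polyVal p x (q * w)) i ((sheet n ε).pt l x)
      = polyVal p x (twist n i q ((ε : ℤ) * l i) x) := by
  have h := unit_sq ε
  simp only [val, Chart.pt, sheet, twist, abelVec, PiLp.add_apply, PiLp.smul_apply, smul_eq_mul]
  congr 2
  linear_combination (root n x * abelInt n i x) * h

end AuxiliaryFunctions

/-! ### Siegel's lemma and the pigeonhole argument -/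

section SiegelLemma

open Metric Set NumberField

variable {n i q L : ℕ} (K : Type*) [Field K] [NumberField K]

/-- Siegel's lemma with twice as many unknowns as equations. -/
theorem exists_siegel_const : ∃ c : ℝ, 1 ≤ c ∧ ∀ (α β : Type) [Fintype α] [Fintype β]
    (a : Matrix α β (𝓞 K)) (A : ℝ), 0 < Fintype.card α → Fintype.card β = 2 * Fintype.card α →
    1 ≤ A → (∀ k l, house (a k l : K) ≤ A) →
    ∃ ξ : β → 𝓞 K, ξ ≠ 0 ∧ a.mulVec ξ = 0 ∧ ∀ l, house (ξ l : K) ≤ c * Fintype.card β * A := by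
  classical
  obtain ⟨c₁, h⟩ : ∃ c₁ : ℝ, ∀ (α β : Type) [Fintype α] [Fintype β] (a : Matrix α β (𝓞 K)) (A : ℝ),
      a ≠ 0 → 0 < Fintype.card α → Fintype.card α < Fintype.card β →
      (∀ k l, house (a k l : K) ≤ A) → ∃ ξ : β → 𝓞 K, ξ ≠ 0 ∧ a.mulVec ξ = 0 ∧ ∀ l,
        house (ξ l : K) ≤ c₁ * ((c₁ * (Fintype.card β : ℕ) * A) ^
          (((Fintype.card α : ℕ) : ℝ) / ((Fintype.card β : ℕ) - (Fintype.card α : ℕ)))) :=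
    ⟨_, fun α β _ _ a A ha h0 hlt hA =>
      house.exists_ne_zero_int_vec_house_le K a ha h0 hlt rfl hA rfl⟩
  refine ⟨c₁ ^ 2 + 1, by nlinarith [sq_nonneg c₁], fun α β _ _ a A h0 hc hA1 hA => ?_⟩
  have hβ : (1 : ℝ) ≤ Fintype.card β := by exact_mod_cast (by omega)
  rcases eq_or_ne a 0 with rfl | ha
  · have : Nonempty β := Fintype.card_pos_iff.1 (by omega)
    refine ⟨fun _ => 1, Function.ne_iff.2 ⟨Classical.arbitrary β, by simp⟩, by simp, fun l => ?_⟩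
    have h1 : house (((1 : 𝓞 K) : 𝓞 K) : K) = 1 := by simpa using house_one (K := K)
    rw [h1]
    exact one_le_mul_of_one_le_of_one_le
      (one_le_mul_of_one_le_of_one_le (by nlinarith [sq_nonneg c₁]) hβ) hA1
  · obtain ⟨ξ, h1, h2, h3⟩ := h α β a A ha h0 (by omega) hA
    refine ⟨ξ, h1, h2, fun l => (h3 l).trans ?_⟩
    have : (0 : ℝ) < Fintype.card α := by exact_mod_cast h0
    have e : (((Fintype.card α : ℕ) : ℝ) / ((Fintype.card β : ℕ) - (Fintype.card α : ℕ))) = 1 := by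
      rw [hc]; push_cast; field_simp; ring
    rw [e, Real.rpow_one]
    have : 0 ≤ (Fintype.card β : ℝ) * A := by positivity
    nlinarith

/-- The auxiliary polynomial. -/
theorem exists_auxiliary : ∃ c : ℝ, 1 ≤ c ∧ ∀ (n i q N k : ℕ), i ≤ n → 0 < N → 0 < k →
    ∀ (ν : Fin N → 𝓞 K) (B : ℝ), 1 ≤ B → (∀ b, house (ν b : K) ≤ B) →
    ∃ p : Fin (2 * k * N) × Fin (2 * k * N) → 𝓞 K, p ≠ 0 ∧
      (∀ b, ∀ t < k * (2 * k * N), ∑ j, p j * taylorCoeff n i q (ν b) t j.1 j.2 = 0) ∧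
      ∀ j, house (p j : K) ≤ c * (2 * k * N : ℕ) ^ 2 *
        (((2 + 2 * q + n) * (3 * (n + 1) * (k * (2 * k * N) : ℕ))) ^ (k * (2 * k * N))
          * B ^ (2 * k * N)) := by
  obtain ⟨c, hc, h⟩ := exists_siegel_const K
  refine ⟨c, hc, fun n i q N k hi hN hk ν B hB hν => ?_⟩
  set L := 2 * k * N with hL
  set T := k * L with hT
  have hL0 : 0 < L := by positivity
  have hT0 : 0 < T := by positivity
  have hT1 : (1 : ℝ) ≤ T := by exact_mod_cast hT0
  have hLT : (L : ℝ) ≤ T := by exact_mod_cast Nat.le_mul_of_pos_left L hk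
  have hX : (1 : ℝ) ≤ (2 + 2 * q + n) * (3 * (n + 1) * (T : ℕ)) := by
    have h1 : (1 : ℝ) ≤ 2 + 2 * q + n := by
      have : (0 : ℝ) ≤ 2 * q + n := by positivity
      linarith
    have h2 : (1 : ℝ) ≤ 3 * (n + 1) := by
      have : (0 : ℝ) ≤ n := by positivity
      linarith
    exact one_le_mul_of_one_le_of_one_le h1 (one_le_mul_of_one_le_of_one_le h2 hT1)
  have hA : ∀ (r : Fin N × Fin T) (j : Fin L × Fin L),
      house ((taylorCoeff n i q (ν r.1) r.2 j.1 j.2 : 𝓞 K) : K)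
        ≤ ((2 + 2 * q + n) * (3 * (n + 1) * (T : ℕ))) ^ T * B ^ L := by
    rintro ⟨b, t⟩ ⟨x, y⟩
    have e : ((taylorCoeff n i q (ν b) t x y : 𝓞 K) : K) = taylorCoeff n i q (ν b : K) t x y :=
      map_taylorCoeff (algebraMap (𝓞 K) K) _ _ _ _
    dsimp only
    rw [e]
    refine (house_taylorCoeff_le hi hB (hν b) _ _ _).trans ?_
    have hx : (x : ℝ) ≤ L := by exact_mod_cast x.2.le
    have hy : (y : ℝ) ≤ L := by exact_mod_cast y.2.le
    have ht : (t : ℝ) ≤ T := by exact_mod_cast t.2.le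
    refine mul_le_mul ?_ (pow_le_pow_right₀ hB y.2.le) (by positivity) (by positivity)
    refine (pow_le_pow_left₀ (by positivity) ?_ _).trans (pow_le_pow_right₀ hX t.2.le)
    refine mul_le_mul_of_nonneg_left ?_ (by positivity)
    have : (n : ℝ) * t ≤ n * T := by gcongr
    nlinarith
  obtain ⟨ξ, h1, h2, h3⟩ := h (Fin N × Fin T) (Fin L × Fin L)
    (fun r j => taylorCoeff n i q (ν r.1) r.2 j.1 j.2)
    (((2 + 2 * q + n) * (3 * (n + 1) * (T : ℕ))) ^ T * B ^ L) (by simp; omega)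
    (by simp [hT, hL]; ring) (one_le_mul_of_one_le_of_one_le (one_le_pow₀ hX) (one_le_pow₀ hB)) hA
  refine ⟨ξ, h1, fun b t ht => ?_, fun j => (h3 j).trans_eq ?_⟩
  · have := congrFun h2 (b, ⟨t, ht⟩)
    simp only [Matrix.mulVec, dotProduct, Pi.zero_apply] at this
    rw [← this]
    exact Finset.sum_congr rfl fun j _ => mul_comm _ _
  · rw [Fintype.card_prod, Fintype.card_fin, Nat.cast_mul, pow_two]

/-- Liouville's inequality. -/
theorem one_le_norm_mul_house_pow {K : Type*} [Field K] [NumberField K] {α : 𝓞 K} (hα : α ≠ 0)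
    (σ : K →+* ℂ) {H : ℝ} (hH : house (α : K) ≤ H) :
    1 ≤ ‖σ α‖ * H ^ Module.finrank ℚ K := by
  have h0 : (α : K) ≠ 0 := by simpa using hα
  have hH1 : 1 ≤ H := (one_le_house_of_isIntegral α.isIntegral_coe h0).trans hH
  have h1 := norm_norm_le_norm_mul_house_pow (α : K) σ
  have h2 : 1 ≤ ‖Algebra.norm ℚ (α : K)‖ := by
    have hN : Algebra.norm ℤ α ≠ 0 := Algebra.norm_ne_zero_iff.2 hα
    rw [← Algebra.coe_norm_int, ← Rat.norm_cast_real, Real.norm_eq_abs]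
    have := Int.one_le_abs hN
    push_cast
    exact_mod_cast this
  refine (h2.trans h1).trans (mul_le_mul_of_nonneg_left ?_ (norm_nonneg _))
  exact (pow_le_pow_left₀ (house_nonneg _) hH _).trans (pow_le_pow_right₀ hH1 (Nat.sub_le _ _))

theorem exists_slow_variation {E ι : Type*} [SeminormedAddCommGroup E] (v : ι → E) (o : ι → ℕ)
    (ρ : ℝ) (s Z : ℕ) (h0 : ∃ j, v j = 0 ∧ o j ≤ Z) (hpos : ∀ j, ‖v j‖ ≤ s * ρ → 0 < o j)
    (hZ : Z < 2 ^ s) (hρ : 0 ≤ ρ) :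
    ∃ j, ‖v j‖ ≤ s * ρ ∧ ∀ j', ‖v j' - v j‖ ≤ ρ → o j ≤ 2 * o j' := by
  by_contra! hcon
  have : ∀ k ≤ s, ∃ j, ‖v j‖ ≤ k * ρ ∧ 2 ^ k * o j ≤ Z := by
    intro k hk
    induction k with
    | zero => obtain ⟨j, hj, hj'⟩ := h0; exact ⟨j, by simp [hj], by simpa using hj'⟩
    | succ k ih =>
      obtain ⟨j, hj, hj'⟩ := ih (by omega)
      have hks : (k : ℝ) * ρ ≤ s * ρ := by gcongr; omega
      obtain ⟨j', h1, h2⟩ := hcon j (hj.trans hks)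
      refine ⟨j', ?_, ?_⟩
      · have := norm_sub_norm_le (v j') (v j)
        push_cast
        linarith
      · rw [pow_succ]
        nlinarith [Nat.pos_of_ne_zero (pow_ne_zero k two_ne_zero : (2 : ℕ) ^ k ≠ 0)]
  obtain ⟨j, hj, hj'⟩ := this s le_rfl
  have := Nat.mul_le_mul_left (2 ^ s) (hpos j hj)
  omega

end SiegelLemma

/-! ### Growth comparisons -/

section Asymptotics

open Metric Set NumberField Filter Polynomial

variable {n i q L : ℕ}

theorem exists_norm_abelVec_le (hn : n ≠ 0) :
    ∃ B : ℕ, ∀ x : ℂ, ‖x‖ ≤ 1 / 2 → ‖abelVec n x‖ ≤ B := by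
  have hsub : closedBall (0 : ℂ) (1 / 2) ⊆ slit n :=
    (closedBall_subset_ball (by norm_num)).trans (ball_subset_slit hn)
  have hc : ContinuousOn (abelVec n) (closedBall 0 (1 / 2)) := fun x hx =>
    (hasDerivAt_toLp fun j => hasDerivAt_abelInt j (hsub hx)).continuousAt.continuousWithinAt
  obtain ⟨C, hC⟩ := (isCompact_closedBall (0 : ℂ) (1 / 2)).exists_bound_of_continuousOn hc
  obtain ⟨B, hB⟩ := exists_nat_ge C
  exact ⟨B, fun x hx => (hC x (by simpa using hx)).trans hB⟩

theorem eventually_eval_lt_exp (P : ℝ[X]) : ∀ᶠ r : ℕ in atTop, P.eval (r : ℝ) < Real.exp r := by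
  have h := ((Polynomial.tendsto_div_exp_atTop P).comp tendsto_natCast_atTop_atTop).eventually_lt_const
    one_pos
  filter_upwards [h] with r hr
  rwa [Function.comp_apply, div_lt_one (Real.exp_pos _)] at hr

theorem eventually_eval_lt_two_pow (P : ℝ[X]) :
    ∀ᶠ r : ℕ in atTop, P.eval (r : ℝ) < 2 ^ (2 * r) := by
  filter_upwards [eventually_eval_lt_exp P] with r hr
  refine hr.trans_le ?_
  rw [pow_mul, ← Real.exp_one_pow]
  exact pow_le_pow_left₀ (Real.exp_pos _).le (by linarith [Real.exp_one_lt_d9]) _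

theorem eventually_eval_mul_exp_lt_one (P : ℝ[X]) {δ : ℝ} (hδ : 0 < δ) (B : ℝ) :
    ∀ᶠ r : ℕ in atTop, P.eval (r : ℝ) * Real.exp (-(δ * (r ^ 2 - B ^ 2))) < 1 := by
  have h1 : ∀ᶠ r : ℕ in atTop, 1 / δ + B ^ 2 + 1 ≤ r :=
    tendsto_natCast_atTop_atTop.eventually_ge_atTop _
  filter_upwards [eventually_eval_lt_exp P, h1] with r hr h1
  have hr0 : 0 < 1 / δ := by positivity
  have hB := sq_nonneg B
  have h2 : (r : ℝ) ≤ δ * (r ^ 2 - B ^ 2) := by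
    have h3 : 1 ≤ δ * (r - B ^ 2) := by
      have : δ * (1 / δ) = 1 := by field_simp
      nlinarith
    have h4 : (r : ℝ) * (r - B ^ 2) ≤ r ^ 2 - B ^ 2 := by nlinarith
    nlinarith
  calc _ < Real.exp r * Real.exp (-(δ * (r ^ 2 - B ^ 2))) :=
        mul_lt_mul_of_pos_right hr (Real.exp_pos _)
    _ = Real.exp (r - δ * (r ^ 2 - B ^ 2)) := by rw [← Real.exp_add, ← sub_eq_add_neg]
    _ ≤ 1 := Real.exp_le_one_iff.2 (by linarith)

/-- Comparison of the analytic upper bound with the arithmetic lower bound. -/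
theorem one_le_of_bounds {M g H c X X' Y B E : ℝ} {T₀ T T₁ d : ℕ} (hT : T ≤ T₀) (hL : L ≤ T₀)
    (hT₁ : T₁ ≤ T₀) (hT₀ : T₀ ≠ 0) (hc0 : 0 ≤ c) (hX0 : 0 ≤ X) (hX0' : 0 ≤ X') (hY0 : 0 ≤ Y)
    (hB0 : 0 ≤ B) (hE : 0 ≤ E) (hg0 : 0 ≤ g) (hc : c ≤ M) (hLM : (L : ℝ) ≤ M) (hX : X ≤ M)
    (hX' : X' ≤ M) (hY : Y ≤ M) (hB : B ≤ M) (hq : (q : ℝ) ≤ M) (hTM : (T₀ : ℝ) ≤ M) (h20 : 20 ≤ M)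
    (hH : H = c * L ^ 2 * (X ^ T * B ^ L))
    (hg : g ≤ 2 ^ T₀ * (L ^ 2 * H * q ^ L * 20 ^ T₁ * Y ^ L * E))
    (h : 1 ≤ T₀.factorial * g * (L ^ 2 * (H * (X' ^ T₀ * B ^ L))) ^ d) :
    1 ≤ (M ^ (12 + 9 * d)) ^ T₀ * E := by
  have hM1 : 1 ≤ M := by linarith
  set m := M ^ T₀ with hm
  have hm0 : 0 ≤ m := by positivity
  have hp : ∀ {a : ℝ} {k : ℕ}, 0 ≤ a → a ≤ M → k ≤ T₀ → a ^ k ≤ m := fun ha hle hk =>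
    (pow_le_pow_left₀ ha hle _).trans (pow_le_pow_right₀ hM1 hk)
  have h1 : ∀ {a : ℝ}, 0 ≤ a → a ≤ M → a ≤ m := fun ha hle => by
    simpa using hp (k := 1) ha hle (Nat.one_le_iff_ne_zero.2 hT₀)
  have kL : (L : ℝ) ≤ m := h1 (Nat.cast_nonneg _) hLM
  have kB : B ^ L ≤ m := hp hB0 hB hL
  have kH : H ≤ m ^ 5 := by
    rw [hH]
    calc _ ≤ m * m ^ 2 * (m * m) := by
          gcongr
          · exact h1 hc0 hc
          · exact hp hX0 hX hT
      _ = m ^ 5 := by ring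
  have hH0 : 0 ≤ H := by rw [hH]; positivity
  have kg : g ≤ m ^ 11 * E := by
    refine hg.trans ?_
    calc _ ≤ m * (m ^ 2 * m ^ 5 * m * m * m * E) := by
          gcongr
          · exact hp (by norm_num) (by linarith) le_rfl
          · exact hp (Nat.cast_nonneg _) hq hL
          · exact hp (by norm_num) h20 hT₁
          · exact hp hY0 hY hL
      _ = _ := by ring
  have kf : (T₀.factorial : ℝ) ≤ m := by
    refine le_trans ?_ (hp (Nat.cast_nonneg T₀) hTM le_rfl)
    exact_mod_cast Nat.factorial_le_pow T₀
  have kh : L ^ 2 * (H * (X' ^ T₀ * B ^ L)) ≤ m ^ 9 := by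
    calc _ ≤ m ^ 2 * (m ^ 5 * (m * m)) := by
          gcongr
          exact hp hX0' hX' le_rfl
      _ = m ^ 9 := by ring
  refine h.trans ?_
  calc _ ≤ m * (m ^ 11 * E) * (m ^ 9) ^ d := by gcongr
    _ = _ := by rw [pow_right_comm M (12 + 9 * d) T₀, ← hm]; ring

section NumberField

variable {K : Type*} [Field K]

theorem diffOp_iterate_polyVal (hn : n ≠ 0) (φ : 𝓞 K →+* ℂ) (p : Fin L × Fin L → 𝓞 K) {ν : 𝓞 K}
    {μ : ℂ} (hν : q * μ = φ ν) (t : ℕ) :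
    (diffOp n)^[t] (fun x => polyVal (fun j => φ (p j)) x (twist n i q μ x)) 0
      = φ (∑ j, p j * taylorCoeff n i q ν t j.1 j.2) := by
  have hw := differentiableOn_twist (i := i) (q := q) hn μ
  have h := diffOp_iterate_sum (n := n) Finset.univ (fun j : Fin L × Fin L => φ (p j))
    (f := fun j x => x ^ (j.1 : ℕ) * twist n i q μ x ^ (j.2 : ℕ))
    (fun j _ => (differentiableOn_id.pow _).mul (hw.pow _)) t (mem_ball_self one_pos)
  refine h.trans ?_
  simp only [map_sum, map_mul, map_taylorCoeff, ← hν]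
  refine Finset.sum_congr rfl fun j _ => ?_
  rw [diffOp_iterate_monomial hw (fun x hx => diffOp_twist hn μ hx), twist_zero hn]

theorem house_auxiliary_le [NumberField K] (hi : i ≤ n) {p : Fin L × Fin L → 𝓞 K} {H : ℝ}
    (hp : ∀ j, house (p j : K) ≤ H) {ν : 𝓞 K} {B : ℝ} (hB : 1 ≤ B) (hν : house (ν : K) ≤ B) (t : ℕ) :
    house ((∑ j, p j * taylorCoeff n i q ν t j.1 j.2 : 𝓞 K) : K)
      ≤ L ^ 2 * (H * (((2 + 2 * q + n) * (2 * L + 3 * n * t)) ^ t * B ^ L)) := by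
  have e : ((∑ j, p j * taylorCoeff n i q ν t j.1 j.2 : 𝓞 K) : K)
      = ∑ j, (p j : K) * taylorCoeff n i q (ν : K) t j.1 j.2 := by
    refine (map_sum (algebraMap (𝓞 K) K) _ _).trans (Finset.sum_congr rfl fun j _ => ?_)
    exact (map_mul (algebraMap (𝓞 K) K) _ _).trans
      (congrArg _ (map_taylorCoeff (algebraMap (𝓞 K) K) _ _ _ _))
  rw [e]
  refine (house_sum_le_sum_house _ _).trans ?_
  calc _ ≤ ∑ _j : Fin L × Fin L, H * (((2 + 2 * q + n) * (2 * L + 3 * n * t)) ^ t * B ^ L) := by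
        refine Finset.sum_le_sum fun j _ => (house_mul_le _ _).trans ?_
        refine mul_le_mul (hp j) ?_ (house_nonneg _) ((house_nonneg _).trans (hp j))
        refine (house_taylorCoeff_le hi hB hν _ _ _).trans ?_
        have h1 : ((j.1 : ℕ) : ℝ) ≤ L := by exact_mod_cast j.1.2.le
        have h2 : ((j.2 : ℕ) : ℝ) ≤ L := by exact_mod_cast j.2.2.le
        refine mul_le_mul (pow_le_pow_left₀ (by positivity) (mul_le_mul_of_nonneg_left ?_
          (by positivity)) _) (pow_le_pow_right₀ hB j.2.2.le) (by positivity) (by positivity)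
        linarith
    _ = _ := by
        rw [Finset.sum_const, Finset.card_univ, Fintype.card_prod, Fintype.card_fin, nsmul_eq_mul,
          Nat.cast_mul, ← pow_two]

end NumberField

end Asymptotics

/-! ### The extrapolation inequality -/

section Extrapolation

open Metric Set NumberField Filter Polynomial

variable {n q L : ℕ}

/-- Among the translates of bounded size by periods, there is one where the order of vanishing is at
most about twice that at all neighbouring ones. -/
theorem exists_slow_order (hn : 2 ≤ n) (i : Fin (n - 1)) (hq : q ≠ 0) {P : Fin L × Fin L → ℂ}
    (hP : P ≠ 0) {ρ : ℝ} (hρ : 0 ≤ ρ) {s T : ℕ} (hT : 0 < T) (hZ : (3 * n + 2) * L ^ 2 < 2 ^ s)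
    (hvan : ∀ (ε : ℤˣ) (m : Fin (2 * n) → ℤ), ‖period n m‖ ≤ (s + 1) * ρ →
      VanishesTo T fun x => polyVal P x (twist n i q ((ε : ℤ) * period n m i) x)) :
    ∃ (ε₀ : ℤˣ) (m₀ : Fin (2 * n) → ℤ) (T₀ : ℕ) (G : ℂ → ℂ), ‖period n m₀‖ ≤ s * ρ ∧ T ≤ T₀ ∧
      T₀ ≤ (3 * n + 2) * L ^ 2 ∧ DifferentiableOn ℂ G (ball 0 1) ∧
      (∀ x ∈ ball (0 : ℂ) 1,
        polyVal P x (twist n i q ((ε₀ : ℤ) * period n m₀ i) x) = x ^ T₀ * G x) ∧ G 0 ≠ 0 ∧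
      ∀ (ε : ℤˣ) (m : Fin (2 * n) → ℤ), ‖period n m - period n m₀‖ ≤ ρ →
        VanishesTo ((T₀ + 1) / 2)
          fun x => polyVal P x (twist n i q ((ε : ℤ) * period n m i) x) := by
  have hn0 : n ≠ 0 := by omega
  have hi : (i : ℕ) ≤ n - 2 := by have := i.2; omega
  let f : ℤˣ × (Fin (2 * n) → ℤ) → ℂ → ℂ := fun j x =>
    polyVal P x (twist n i q (((j.1 : ℤ) : ℂ) * period n j.2 i) x)
  have hfd : ∀ j, DifferentiableOn ℂ (f j) (ball 0 1) := fun j => by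
    have h := (differentiable_polyVal P 1).comp_differentiableOn
      (differentiableOn_id.prodMk (differentiableOn_twist (i := i) (q := q) hn0
        (((j.1 : ℤ) : ℂ) * period n j.2 i)))
    simpa [f, Function.comp_def] using h
  have hfZ : ∀ j t, VanishesTo t (f j) → t ≤ (3 * n + 2) * L ^ 2 := fun j t h =>
    vanishesTo_polyVal_le hn hi hq (differentiableOn_twist hn0 _)
      (fun x hx => diffOp_twist hn0 _ hx) hP h
  have hex : ∀ j, ∃ T₀ G, (‖period n j.2‖ ≤ (s + 1) * ρ → T ≤ T₀) ∧
      T₀ ≤ (3 * n + 2) * L ^ 2 ∧ DifferentiableOn ℂ G (ball 0 1) ∧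
      (∀ x ∈ ball (0 : ℂ) 1, f j x = x ^ T₀ * G x) ∧ G 0 ≠ 0 := fun j => by
    by_cases hj : ‖period n j.2‖ ≤ (s + 1) * ρ
    · obtain ⟨T₀, G, h1, h2⟩ := exists_exact_order (hfZ j) (hvan j.1 j.2 hj)
      exact ⟨T₀, G, fun _ => h1, h2⟩
    · obtain ⟨T₀, G, -, h2⟩ := exists_exact_order (hfZ j) (T := 0) ⟨_, hfd j, by simp⟩
      exact ⟨T₀, G, fun h => absurd h hj, h2⟩
  choose o G hoT hoZ hG hfG hG0 using hex
  have h0 : period n 0 = 0 := by ext; simp [period]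
  obtain ⟨j₀, hv, hslow⟩ := exists_slow_variation
    (fun j : ℤˣ × (Fin (2 * n) → ℤ) => period n j.2) o ρ s ((3 * n + 2) * L ^ 2)
    ⟨(1, 0), h0, hoZ _⟩
    (fun j hj => hT.trans_le (hoT j (hj.trans (by nlinarith)))) hZ hρ
  refine ⟨j₀.1, j₀.2, o j₀, G j₀, hv, hoT _ (hv.trans (by nlinarith)), hoZ _, hG _, hfG _, hG0 _,
    fun ε m hm => ?_⟩
  have h1 : o j₀ ≤ 2 * o (ε, m) := hslow (ε, m) hm
  have h2 : (o j₀ + 1) / 2 ≤ o (ε, m) := by omega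
  exact VanishesTo.mono h2 ⟨G (ε, m), hG (ε, m), hfG (ε, m)⟩

theorem exp_neg_mul_le_pow {κ B r S : ℝ} {T₀ : ℕ} (hκ : 0 ≤ κ) (hr : B ≤ r) (hB : 0 ≤ B)
    (hS : (T₀ : ℝ) ≤ 32 * (n + 1) * S) : Real.exp (-(κ * S * (r ^ 2 - B ^ 2)))
      ≤ Real.exp (-(κ / (32 * (n + 1)) * (r ^ 2 - B ^ 2))) ^ T₀ := by
  rw [← Real.exp_nat_mul, Real.exp_le_exp]
  have h1 : B ^ 2 ≤ r ^ 2 := by gcongr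
  have h3 : T₀ * (κ / (32 * (n + 1))) ≤ κ * S := by
    rw [← mul_div_assoc, div_le_iff₀ (by positivity)]
    calc T₀ * κ ≤ 32 * (n + 1) * S * κ := by gcongr
      _ = _ := by ring
  have h4 := mul_le_mul_of_nonneg_right h3 (sub_nonneg.2 h1)
  linarith

section NumberField

variable {K : Type*} [Field K] [NumberField K]

/-- Up to the factor `q`, the `i`-th coordinates of the periods of bounded size are images of few
algebraic integers of small house. -/
theorem exists_bounded_points (hn : n ≠ 0) (i : Fin (n - 1)) (φ : 𝓞 K →+* ℂ) {Z θ : 𝓞 K}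
    (hZ : φ Z = zeta n) (hθ : φ θ = q * (realInt n i / n)) : ∃ C c : ℕ, ∀ R : ℕ,
    ∃ ν : Fin ((2 * (C * R) + 1) ^ (2 * n)) → 𝓞 K,
      (∀ b, house (ν b : K) ≤ C * R * c + 1) ∧
      ∀ (ε : ℤˣ) (m : Fin (2 * n) → ℤ), ‖period n m‖ ≤ R →
        ∃ b, q * ((ε : ℤ) * period n m i) = φ (ν b) := by
  obtain ⟨C₀, hC₀, hb⟩ := exists_bounded_coeff hn
  obtain ⟨C, hC⟩ := exists_nat_ge C₀
  obtain ⟨c, hc⟩ := exists_nat_ge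
    (∑ k : Fin (2 * n), house ((θ * Z ^ ((k : ℕ) * (i + 1)) : 𝓞 K) : K))
  refine ⟨C, c, fun R => ?_⟩
  set A := C * R with hA
  let e : Fin ((2 * A + 1) ^ (2 * n)) ≃ (Fin (2 * n) → Fin (2 * A + 1)) :=
    (Fintype.equivFinOfCardEq (by simp)).symm
  have hsum : ∀ a : Fin (2 * n) → ℤ, (∀ k, |a k| ≤ (A : ℤ)) →
      house ((∑ k, (a k : 𝓞 K) * (θ * Z ^ ((k : ℕ) * (i + 1))) : 𝓞 K) : K) ≤ C * R * c + 1 := by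
    intro a ha
    have e1 : ((∑ k, (a k : 𝓞 K) * (θ * Z ^ ((k : ℕ) * (i + 1))) : 𝓞 K) : K)
        = ∑ k, (a k : K) * ((θ * Z ^ ((k : ℕ) * (i + 1)) : 𝓞 K) : K) := by
      refine (map_sum (algebraMap (𝓞 K) K) _ _).trans (Finset.sum_congr rfl fun k _ => ?_)
      rw [map_mul, map_intCast]
    rw [e1]
    have e2 : ((A : ℕ) : ℝ) = C * R := by rw [hA]; push_cast; ring
    calc _ ≤ ∑ k, house ((a k : K) * ((θ * Z ^ ((k : ℕ) * (i + 1)) : 𝓞 K) : K)) :=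
          house_sum_le_sum_house _ _
      _ ≤ ∑ k : Fin (2 * n), (A : ℝ) * house ((θ * Z ^ ((k : ℕ) * (i + 1)) : 𝓞 K) : K) := by
          refine Finset.sum_le_sum fun k _ => (house_mul_le _ _).trans ?_
          refine mul_le_mul_of_nonneg_right ?_ (house_nonneg _)
          rw [house_intCast]
          exact_mod_cast ha k
      _ ≤ A * c := by rw [← Finset.mul_sum]; gcongr
      _ ≤ _ := by rw [e2]; linarith
  refine ⟨fun b => ∑ k, ((((e b k : ℕ) : ℤ) - A : ℤ) : 𝓞 K) * (θ * Z ^ ((k : ℕ) * (i + 1))),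
    fun b => hsum _ fun k => ?_, fun ε m hm => ?_⟩
  · have := (e b k).2
    rw [abs_le]; constructor <;> omega
  · obtain ⟨b, h1, h2⟩ := hb m R hm
    have hbA : ∀ k, |(ε : ℤ) * b k| ≤ (A : ℤ) := by
      intro k
      have : |(b k : ℝ)| ≤ (A : ℕ) := (h1 k).trans (by rw [hA, Nat.cast_mul]; gcongr)
      have h3 : |b k| ≤ (A : ℤ) := by exact_mod_cast this
      rcases Int.units_eq_one_or ε with rfl | rfl <;> simpa using h3
    have hlt : ∀ k, ((ε : ℤ) * b k + A).toNat < 2 * A + 1 := by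
      intro k
      have := abs_le.1 (hbA k)
      omega
    refine ⟨e.symm fun k => ⟨((ε : ℤ) * b k + A).toNat, hlt k⟩, ?_⟩
    have hk : ∀ k, ((((ε : ℤ) * b k + A).toNat : ℤ) - A : ℤ) = (ε : ℤ) * b k := by
      intro k
      have := abs_le.1 (hbA k)
      omega
    simp only [Equiv.apply_symm_apply, hk, map_sum, map_mul, map_pow, map_intCast, hZ, hθ, h2,
      Int.cast_mul, Finset.mul_sum]
    exact Finset.sum_congr rfl fun k _ => by ring

set_option maxHeartbeats 800000 in
/-- The inequality resulting from the extrapolation at scale `r`. -/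
theorem one_le_pow_mul_exp (hn : 2 ≤ n) {κ : ℝ}
    (hκ : ∀ x y : ℂ, y ^ 2 = 1 - x ^ (2 * n) → κ * ‖mon n x‖ ^ 2
        < ‖y‖ ^ 2 / (1 + ‖x‖ ^ 2) ^ 2 + (n * ‖x‖ ^ (2 * n - 1)) ^ 2 / (1 + ‖y‖ ^ 2) ^ 2)
    (hκ0 : 0 < κ) (i : Fin (n - 1)) (hq : 1 ≤ q) (σ : K →+* ℂ) {B r : ℕ}
    (hB : ∀ x : ℂ, ‖x‖ ≤ 1 / 2 → ‖abelVec n x‖ ≤ B) (hr : B ≤ r) {N : ℕ} (hN : 0 < N)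
    (hL : L = 2 * (8 * (n + 1)) * N) (hZ : (3 * n + 2) * L ^ 2 < 2 ^ (2 * r)) {ν : Fin N → 𝓞 K}
    {b c M : ℝ} (hb : 1 ≤ b) (hνb : ∀ a, house (ν a : K) ≤ b)
    (hν : ∀ (ε : ℤˣ) (m : Fin (2 * n) → ℤ), ‖period n m‖ ≤ (2 * r + 1) * (r + 1 + B) →
      ∃ a, q * ((ε : ℤ) * period n m i) = σ (ν a))
    {p : Fin L × Fin L → 𝓞 K} (hp0 : p ≠ 0)
    (hp : ∀ a, ∀ t < 8 * (n + 1) * L, ∑ j, p j * taylorCoeff n i q (ν a) t j.1 j.2 = 0)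
    (hpH : ∀ j, house (p j : K) ≤ c * (L : ℝ) ^ 2 *
      (((2 + 2 * q + n) * (3 * (n + 1) * (8 * (n + 1) * L : ℕ))) ^ (8 * (n + 1) * L) * b ^ L))
    (hc0 : 1 ≤ c) (hc : c ≤ M) (hLM : (L : ℝ) ≤ M)
    (hXM : (2 + 2 * q + n) * (3 * (n + 1) * ((3 * n + 2) * (L : ℝ) ^ 2)) ≤ M) (hbM : b ≤ M)
    (hqM : (q : ℝ) ≤ M) (h20 : 20 ≤ M) (hZM : (3 * n + 2) * (L : ℝ) ^ 2 ≤ M)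
    (hYM : 1 + 2 * (r + 1 + 2 * r * (r + 1 + B) + 2 * B : ℝ) ≤ M) :
    1 ≤ M ^ (12 + 9 * Module.finrank ℚ K)
      * Real.exp (-(κ / (32 * (n + 1)) * ((r : ℝ) ^ 2 - (B : ℝ) ^ 2))) := by
  have hn0 : n ≠ 0 := by omega
  set T := 8 * (n + 1) * L with hT
  set d := Module.finrank ℚ K
  set H := c * (L : ℝ) ^ 2 *
      (((2 + 2 * q + n) * (3 * (n + 1) * (T : ℕ))) ^ T * b ^ L) with hH
  have hL0 : 0 < L := by rw [hL]; positivity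
  have hH0 : 0 < H := by positivity
  let φ : 𝓞 K →+* ℂ := σ.comp (algebraMap (𝓞 K) K)
  have hφ : ∀ a, φ a = σ a := fun _ => rfl
  let P : Fin L × Fin L → ℂ := fun j => φ (p j)
  have hP0 : P ≠ 0 := by
    obtain ⟨j, hj⟩ := Function.ne_iff.1 hp0
    refine Function.ne_iff.2 ⟨j, fun h => hj ?_⟩
    have : (p j : K) = 0 := σ.injective (by rw [map_zero]; exact h)
    simpa using this
  have hrB : (0 : ℝ) ≤ r + 1 + B := by positivity
  have hT0 : 0 < T := by positivity
  obtain ⟨ε₀, m₀, T₀, G, hv, hTT₀, hT₀Z, hG, hGe, hG0, hvan⟩ := exists_slow_order hn i (q := q)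
    (by omega) hP0 hrB (T := T) hT0 hZ fun ε m hm => by
      obtain ⟨a, ha⟩ := hν ε m (by exact_mod_cast hm)
      refine vanishesTo_of_diffOp_iterate hn0 ?_ T fun s hs => ?_
      · have h := (differentiable_polyVal P 1).comp_differentiableOn
          (differentiableOn_id.prodMk (differentiableOn_twist (i := i) (q := q) hn0
            (((ε : ℤ) : ℂ) * period n m i)))
        simpa [Function.comp_def] using h
      · refine (diffOp_iterate_polyVal hn0 φ p (ν := ν a) ha s).trans ?_
        rw [hp a s hs, map_zero]
  have hv' : ‖period n m₀‖ ≤ 2 * r * (r + 1 + B) := by exact_mod_cast hv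
  set S := T₀ / (16 * (n + 1)) with hS
  have hLn : 16 * (n + 1) ≤ L := by rw [hL]; nlinarith
  have hLT : L ≤ T := by rw [hT]; nlinarith
  have hT1 : 128 * (n + 1) ≤ T := by rw [hT]; nlinarith
  have hS0 : 0 < S := Nat.div_pos (by omega) (by positivity)
  have hS1 : 16 * (n + 1) * S ≤ T₀ := Nat.mul_div_le _ _
  have hS2 : T₀ < 16 * (n + 1) * (S + 1) := Nat.lt_mul_div_succ _ (by positivity)
  have hS3 : T₀ ≤ 32 * (n + 1) * S := by nlinarith
  have hST : L + n * L + 2 * (n + 1) * S + 1 ≤ (T₀ + 1) / 2 := by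
    have h1 : 8 * (L + n * L) = T := by rw [hT]; ring
    have h2 : 8 * (2 * (n + 1) * S) ≤ T₀ := by linarith
    omega
  have hq0 : (1 : ℝ) ≤ q := by exact_mod_cast hq
  have hP : ∀ j, ‖P j‖ ≤ H := fun j => (norm_embedding_le_house _ σ).trans (hpH j)
  have hlead := norm_leading_le hn0 hκ hκ0.le (C := (L : ℝ) ^ 2 * H * q ^ L) (by positivity)
    (polyBound_polyVal hH0.le hP hq) (differentiable_polyVal P q) i hS0 hST hB
    (by exact_mod_cast hr : (B : ℝ) ≤ r) (ε₀ := ε₀) (m₀ := m₀)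
    (fun ε m hm => by simpa only [val_polyVal_sheet] using hvan ε m hm) hG
    (fun x hx => by simpa only [val_polyVal_sheet] using hGe x hx)
  obtain ⟨a, ha⟩ := hν ε₀ m₀ (hv.trans (by push_cast; nlinarith))
  have hα := (diffOp_iterate_polyVal hn0 φ p (ν := ν a) ha T₀).symm.trans
    (diffOp_iterate_zero hn0 hG hGe)
  set α := ∑ j, p j * taylorCoeff n i q (ν a) T₀ j.1 j.2 with hαdef
  have hα0 : α ≠ 0 := by
    rintro h0
    rw [h0, map_zero] at hα
    exact mul_ne_zero (Nat.cast_ne_zero.2 T₀.factorial_ne_zero) hG0 hα.symm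
  have harith := one_le_norm_mul_house_pow hα0 σ
    (house_auxiliary_le (n := n) (i := i) (q := q) (by omega) hpH hb (hνb a) T₀)
  have hnα : ‖σ α‖ = T₀.factorial * ‖G 0‖ := by
    rw [← hφ, hα, norm_mul, Complex.norm_natCast]
  rw [hnα] at harith
  have hT₀Z' : (T₀ : ℝ) ≤ (3 * n + 2) * (L : ℝ) ^ 2 := by exact_mod_cast hT₀Z
  have hTZ' : (T : ℝ) ≤ (3 * n + 2) * (L : ℝ) ^ 2 := by exact_mod_cast hTT₀.trans hT₀Z
  have hLT' : (L : ℝ) ≤ T₀ := by exact_mod_cast hLT.trans hTT₀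
  have key := one_le_of_bounds (M := M) (X := (2 + 2 * q + n) * (3 * (n + 1) * T))
    (X' := (2 + 2 * q + n) * (2 * L + 3 * n * T₀)) (Y := 1 + 2 * (r + 1 + ‖period n m₀‖ + 2 * B))
    (q := q) hTT₀ (hLT.trans hTT₀) (T₁ := (T₀ + 1) / 2) (by omega) (by omega) (by linarith)
    (by positivity) (by positivity) (by positivity) (by linarith) (Real.exp_pos _).le
    (norm_nonneg _) hc hLM ((by gcongr : _ ≤ _).trans hXM)
    ((mul_le_mul_of_nonneg_left (by nlinarith) (by positivity)).trans hXM)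
    ((by linarith : _ ≤ _).trans hYM) hbM hqM (hT₀Z'.trans hZM) h20 rfl hlead harith
  have hexp := exp_neg_mul_le_pow hκ0.le (by exact_mod_cast hr : (B : ℝ) ≤ r) (Nat.cast_nonneg B)
    (by exact_mod_cast hS3 : (T₀ : ℝ) ≤ 32 * (n + 1) * S)
  refine (one_le_pow_iff_of_nonneg ?_ (n := T₀) (by omega)).1 ?_
  · have : 0 ≤ M := by linarith
    positivity
  · rw [mul_pow]
    refine key.trans (mul_le_mul_of_nonneg_left hexp ?_)
    have : 0 ≤ M := by linarith
    positivity

end NumberField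

end Extrapolation

/-! ### Transcendence of the integrals -/

section Conclusion

open Metric Set NumberField Filter Polynomial

section NumberField

variable {n q : ℕ} {K : Type*} [Field K] [NumberField K]

theorem not_exists_algebraic_data (hn : 2 ≤ n) (i : Fin (n - 1)) (hq : 1 ≤ q) (σ : K →+* ℂ)
    {Z θ : 𝓞 K} (hZ : σ Z = zeta n) (hθ : σ θ = q * (realInt n i / n)) : False := by
  have hn0 : n ≠ 0 := by omega
  have hi : (i : ℕ) ≤ n := by have := i.2; omega
  obtain ⟨κ, hκ0, hκ⟩ := exists_metric_bound hn
  obtain ⟨B, hB⟩ := exists_norm_abelVec_le hn0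
  obtain ⟨c, hc, haux⟩ := exists_auxiliary K
  obtain ⟨A, a, hpts⟩ := exists_bounded_points (q := q) hn0 i (σ.comp (algebraMap (𝓞 K) K)) hZ hθ
  let R : ℝ[X] := (2 * X + 1) * (X + 1 + (B : ℝ[X]))
  let ℓ : ℝ[X] := 2 * (8 * ((n : ℝ[X]) + 1)) * (2 * ((A : ℝ[X]) * R) + 1) ^ (2 * n)
  let M : ℝ[X] := C c + ℓ + (2 + 2 * (q : ℝ[X]) + (n : ℝ[X])) *
      (3 * ((n : ℝ[X]) + 1) * ((3 * (n : ℝ[X]) + 2) * ℓ ^ 2))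
    + ((A : ℝ[X]) * R * (a : ℝ[X]) + 1) + (q : ℝ[X]) + 20 + (3 * (n : ℝ[X]) + 2) * ℓ ^ 2
    + (1 + 2 * (X + 1 + 2 * X * (X + 1 + (B : ℝ[X])) + 2 * (B : ℝ[X])))
  obtain ⟨r, hrB, hrZ, hr1⟩ := ((eventually_ge_atTop B).and
    ((eventually_eval_lt_two_pow ((3 * (n : ℝ[X]) + 2) * ℓ ^ 2)).and
      (eventually_eval_mul_exp_lt_one (M ^ (12 + 9 * Module.finrank ℚ K))
        (show 0 < κ / (32 * (n + 1)) by positivity) B))).exists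
  set r' : ℕ := (2 * r + 1) * (r + 1 + B) with hr'
  set N : ℕ := (2 * (A * r') + 1) ^ (2 * n) with hN
  set L : ℕ := 2 * (8 * (n + 1)) * N with hL
  have eR : R.eval (r : ℝ) = (r' : ℕ) := by simp [R, hr']
  have eL : ℓ.eval (r : ℝ) = (L : ℕ) := by
    simp only [ℓ, hL, hN, eval_mul, eval_add, eval_pow, eval_natCast, eval_ofNat, eval_one, eR]
    push_cast
    ring
  have eM : M.eval (r : ℝ) = c + L + (2 + 2 * q + n) * (3 * (n + 1) * ((3 * n + 2) * (L : ℝ) ^ 2))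
      + (A * r' * a + 1) + q + 20 + (3 * n + 2) * (L : ℝ) ^ 2
      + (1 + 2 * (r + 1 + 2 * r * (r + 1 + B) + 2 * B)) := by
    simp only [M, eval_mul, eval_add, eval_pow, eval_natCast, eval_ofNat, eval_one, eval_C, eval_X,
      eR, eL]
  obtain ⟨ν, hνb, hν⟩ := hpts r'
  have hb : (1 : ℝ) ≤ A * r' * a + 1 := by
    have : (0 : ℝ) ≤ A * r' * a := by positivity
    linarith
  have hN0 : 0 < N := by positivity
  obtain ⟨p, hp0, hp, hpH⟩ := haux n i q N (8 * (n + 1)) hi hN0 (by positivity) ν _ hb hνb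
  have hZ' : (3 * n + 2) * L ^ 2 < 2 ^ (2 * r) := by
    simp only [eval_mul, eval_add, eval_pow, eval_natCast, eval_ofNat, eL] at hrZ
    exact_mod_cast hrZ
  have h0 : (0 : ℝ) ≤ (2 + 2 * q + n) * (3 * (n + 1) * ((3 * n + 2) * (L : ℝ) ^ 2)) := by positivity
  have h1 : (0 : ℝ) ≤ (3 * n + 2) * (L : ℝ) ^ 2 := by positivity
  have h2 : (0 : ℝ) ≤ 1 + 2 * (r + 1 + 2 * r * (r + 1 + B) + 2 * B) := by positivity
  have h3 : (0 : ℝ) ≤ L := by positivity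
  have h4 : (0 : ℝ) ≤ q := by positivity
  have key := one_le_pow_mul_exp hn hκ hκ0 i hq σ hB hrB hN0 hL hZ' (M := M.eval (r : ℝ)) hb hνb
    (fun ε m hm => hν ε m (hm.trans (by rw [hr']; push_cast; exact le_rfl))) hp0 hp hpH hc
    (by linarith) (by linarith) (by linarith) (by linarith) (by linarith) (by linarith)
    (by linarith) (by linarith)
  rw [eval_pow] at hr1
  exact hr1.not_ge key

end NumberField

theorem transcendental_realInt {n : ℕ} (hn : 2 ≤ n) {i : ℕ} (hi : i ≤ n - 2) :
    Transcendental ℚ (realInt n i) := by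
  intro halg
  have hn0 : n ≠ 0 := by omega
  have hI : IsAlgebraic ℚ ((realInt n i : ℝ) : ℂ) := halg.algebraMap
  have hz : IsIntegral ℤ (zeta n) := (isPrimitiveRoot_zeta hn0).isIntegral (by omega)
  have hzQ : IsIntegral ℚ (zeta n) := hz.tower_top
  let K := IntermediateField.adjoin ℚ {zeta n, ((realInt n i : ℝ) : ℂ)}
  have : FiniteDimensional ℚ K := IntermediateField.finiteDimensional_adjoin (by
    rintro x (rfl | rfl)
    exacts [hzQ, hI.isIntegral])
  have : NumberField K := { }
  let z : K := ⟨zeta n, IntermediateField.subset_adjoin _ _ (by simp)⟩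
  let t : K := ⟨((realInt n i : ℝ) : ℂ), IntermediateField.subset_adjoin _ _ (by simp)⟩
  have hzK : IsIntegral ℤ z := (isIntegral_algebraMap_iff (A := K) (B := ℂ)
    (algebraMap K ℂ).injective).1 hz
  have ht : IsAlgebraic ℤ (t / n) :=
    (IsFractionRing.isAlgebraic_iff ℤ ℚ K).2 (Algebra.IsAlgebraic.isAlgebraic _)
  obtain ⟨y, hy, hyt⟩ := ht.exists_integral_multiple
  let σ : K →+* ℂ := algebraMap K ℂ
  have hyt' : IsIntegral ℤ ((y.natAbs : K) * (t / n)) := by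
    rw [zsmul_eq_mul] at hyt
    rcases y.natAbs_eq with h | h
    · rw [h] at hyt; simpa using hyt
    · rw [h] at hyt; simpa using hyt.neg
  refine not_exists_algebraic_data hn ⟨i, by omega⟩ (q := y.natAbs) (by omega) σ
    (Z := ⟨z, hzK⟩) (θ := ⟨_, hyt'⟩) rfl ?_
  change σ (y.natAbs * (t / n)) = _
  rw [map_mul, map_div₀, map_natCast, map_natCast]
  rfl

end Conclusion

end ErdosLemniscate

/-- For `n ≥ 2` and `0 ≤ i ≤ n-2`, `I_{n,i} = ∫₀¹ s^i/√(1-s^{2n}) ds` is transcendental over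
`ℚ`.  In particular the length `2n·2^{1/n}·I_{n,0}` of the Erdős lemniscate with `n` leaves
is transcendental. -/
theorem stmt_4 (n : ℕ) (hn : 2 ≤ n) (i : ℕ) (hi : i ≤ n - 2) :
    Transcendental ℚ (∫ s in (0:ℝ)..1, s ^ i / Real.sqrt (1 - s ^ (2 * n))) ∧
    Transcendental ℚ
      (2 * (n : ℝ) * (2 : ℝ) ^ ((1 : ℝ) / (n : ℝ)) *
        ∫ s in (0:ℝ)..1, 1 / Real.sqrt (1 - s ^ (2 * n))) := by
  refine ⟨ErdosLemniscate.transcendental_realInt hn hi, fun h => ?_⟩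
  have h0 := ErdosLemniscate.transcendental_realInt hn (Nat.zero_le (n - 2))
  have e : ∫ s in (0:ℝ)..1, 1 / Real.sqrt (1 - s ^ (2 * n)) = ErdosLemniscate.realInt n 0 := by
    simp [ErdosLemniscate.realInt]
  rw [e] at h
  have hroot : IsAlgebraic ℚ ((2 : ℝ) ^ ((1 : ℝ) / (n : ℝ))) := by
    refine IsAlgebraic.of_pow (n := n) (by omega) ?_
    rw [one_div, Real.rpow_inv_natCast_pow (by norm_num) (by omega)]
    exact isAlgebraic_natCast 2
  have hcoef : IsAlgebraic ℚ (2 * (n : ℝ) * (2 : ℝ) ^ ((1 : ℝ) / (n : ℝ))) :=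
    ((isAlgebraic_natCast 2).mul (isAlgebraic_natCast n)).mul hroot
  have hne : 2 * (n : ℝ) * (2 : ℝ) ^ ((1 : ℝ) / (n : ℝ)) ≠ 0 := by
    have : (0 : ℝ) < n := by exact_mod_cast (by omega : 0 < n)
    positivity
  refine h0 ?_
  have := hcoef.inv.mul h
  rwa [inv_mul_cancel_left₀ hne] at this
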